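/- arXiv:1709.03550 — 4 statements merged into one kernel-verified Lean document; each statement's English description precedes it below -/
import Mathlib

section
/- Let A be an infinite multiplicative Sidon set of positive integers. If limsup_{n→∞} (|A(n)| − π(n)) / (n^{3/4}/(log n)^3) ≥ 73643, then liminf_{n→∞} (|A(n)| − π(n)) / (n/(log n)^{48}) < 0. -/
open Filter

/-- `A` is a multiplicative Sidon set: for every `s`, the equation `x * y = s` has at most
one solution (up to ordering) with `x, y ∈ A`. -/
def MulSidon (A : Set ℕ) : Prop :=
  ∀ x ∈ A, ∀ y ∈ A, ∀ z ∈ A, ∀ w ∈ A, x * y = z * w → (x = z ∧ y = w) ∨ (x = w ∧ y = z)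

namespace MulSidon

variable {A : Set ℕ}

open scoped Classical in
/-- A bipartite graph on `X × Y` whose edges `(x, y)` have `x * y` in a multiplicative Sidon set
contains no 4-cycle. -/
lemma sum_sq_fiber_le (hpos : ∀ a ∈ A, 0 < a) (hS : MulSidon A) (X Y : Finset ℕ) :
    ∑ y ∈ Y, (X.filter (fun x => x * y ∈ A)).card ^ 2 ≤
      ∑ y ∈ Y, (X.filter (fun x => x * y ∈ A)).card + X.card ^ 2 := by
  set F : ℕ → Finset ℕ := fun y => X.filter (fun x => x * y ∈ A) with hF
  have hdisj : (Y : Set ℕ).PairwiseDisjoint (fun y => (F y).offDiag) := by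
    intro y hy y' hy' hne
    refine Finset.disjoint_left.2 ?_
    rintro ⟨x, x'⟩ h h'
    simp only [hF, Finset.mem_offDiag, Finset.mem_filter] at h h'
    obtain ⟨⟨-, h1⟩, ⟨-, h2⟩, hx⟩ := h
    obtain ⟨⟨-, h3⟩, ⟨-, h4⟩, -⟩ := h'
    have hx0 : 0 < x := Nat.pos_of_mul_pos_right (hpos _ h1)
    have hy0 : 0 < y := Nat.pos_of_mul_pos_left (hpos _ h1)
    rcases hS _ h1 _ h4 _ h3 _ h2 (by ring) with ⟨h, -⟩ | ⟨h, -⟩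
    · exact hne (Nat.eq_of_mul_eq_mul_left hx0 h)
    · exact hx (Nat.eq_of_mul_eq_mul_right hy0 h)
  have hsum : ∑ y ∈ Y, (F y).offDiag.card ≤ X.card ^ 2 := by
    rw [← Finset.card_biUnion hdisj, sq, ← Finset.card_product]
    refine Finset.card_le_card ?_
    intro ⟨x, x'⟩ h
    simp only [hF, Finset.mem_biUnion, Finset.mem_offDiag, Finset.mem_filter] at h
    obtain ⟨y, -, ⟨h1, -⟩, ⟨h2, -⟩, -⟩ := h
    exact Finset.mem_product.2 ⟨h1, h2⟩
  calc ∑ y ∈ Y, (F y).card ^ 2 = ∑ y ∈ Y, ((F y).card + (F y).offDiag.card) := by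
        refine Finset.sum_congr rfl fun y _ => ?_
        rw [Finset.offDiag_card, sq]
        have := Nat.le_mul_self (F y).card
        omega
    _ ≤ _ := by rw [Finset.sum_add_distrib]; exact Nat.add_le_add_left hsum _

open scoped Classical in
lemma card_le_sum_fiber (X Y S : Finset ℕ) (hSA : ∀ a ∈ S, a ∈ A)
    (h : ∀ a ∈ S, ∃ x ∈ X, ∃ y ∈ Y, a = x * y) :
    S.card ≤ ∑ y ∈ Y, (X.filter (fun x => x * y ∈ A)).card := by
  rw [← Finset.card_sigma]
  refine Finset.card_le_card_of_surjOn (fun e => e.2 * e.1) ?_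
  intro a ha
  obtain ⟨x, hx, y, hy, rfl⟩ := h a ha
  exact ⟨⟨y, x⟩, by simpa [hx, hy] using hSA _ ha, rfl⟩

lemma card_le_add_sq (hpos : ∀ a ∈ A, 0 < a) (hS : MulSidon A) (X Y S : Finset ℕ)
    (hSA : ∀ a ∈ S, a ∈ A) (h : ∀ a ∈ S, ∃ x ∈ X, ∃ y ∈ Y, a = x * y) :
    S.card ≤ Y.card + X.card ^ 2 := by
  classical
  have h1 := card_le_sum_fiber X Y S hSA h
  have h2 := sum_sq_fiber_le hpos hS X Y
  have h3 : 2 * ∑ y ∈ Y, (X.filter (fun x => x * y ∈ A)).card ≤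
      Y.card + ∑ y ∈ Y, (X.filter (fun x => x * y ∈ A)).card ^ 2 := by
    rw [Finset.mul_sum, Finset.card_eq_sum_ones, ← Finset.sum_add_distrib]
    refine Finset.sum_le_sum fun y _ => ?_
    generalize (X.filter (fun x => x * y ∈ A)).card = d
    zify
    nlinarith [sq_nonneg ((d : ℤ) - 1)]
  omega

lemma card_le_mul_sqrt (hpos : ∀ a ∈ A, 0 < a) (hS : MulSidon A) (X Y S : Finset ℕ)
    (hSA : ∀ a ∈ S, a ∈ A) (h : ∀ a ∈ S, ∃ x ∈ X, ∃ y ∈ Y, a = x * y) :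
    (S.card : ℝ) ≤ X.card * √Y.card + Y.card := by
  classical
  have h1 := card_le_sum_fiber X Y S hSA h
  have h2 := sum_sq_fiber_le hpos hS X Y
  have h3 := sq_sum_le_card_mul_sum_sq (s := Y)
    (f := fun y => (X.filter (fun x => x * y ∈ A)).card)
  set e := ∑ y ∈ Y, (X.filter (fun x => x * y ∈ A)).card
  have h4 : e ^ 2 ≤ Y.card * (e + X.card ^ 2) := h3.trans (Nat.mul_le_mul_left _ h2)
  have h5 : (e : ℝ) ^ 2 ≤ Y.card * (e + (X.card : ℝ) ^ 2) := by exact_mod_cast h4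
  refine (Nat.cast_le.2 h1).trans ?_
  have hs : (Y.card : ℝ) = √Y.card ^ 2 := (Real.sq_sqrt (Nat.cast_nonneg _)).symm
  have hs0 : 0 ≤ √(Y.card : ℝ) := Real.sqrt_nonneg _
  generalize √(Y.card : ℝ) = s at hs hs0 ⊢
  rw [hs] at h5 ⊢
  by_contra! hlt
  have hX : (0 : ℝ) ≤ X.card := Nat.cast_nonneg _
  have h6 : 0 ≤ (X.card : ℝ) * s := by positivity
  nlinarith [mul_nonneg h6 (sq_nonneg s)]

/-- A version of `card_le_mul_sqrt` with upper bounds in place of the cardinalities. -/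
lemma card_le_mul_sqrt_of_le (hpos : ∀ a ∈ A, 0 < a) (hS : MulSidon A) (X Y S : Finset ℕ)
    (hSA : ∀ a ∈ S, a ∈ A) (h : ∀ a ∈ S, ∃ x ∈ X, ∃ y ∈ Y, a = x * y) {b c : ℝ}
    (hX : (X.card : ℝ) ≤ b) (hY : (Y.card : ℝ) ≤ c) : (S.card : ℝ) ≤ b * √c + c :=
  (card_le_mul_sqrt hpos hS X Y S hSA h).trans <| by
    have := (Nat.cast_nonneg _).trans hX
    gcongr

/-- A Chebyshev bound in dyadic intervals, from the prime divisors of the central binomial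
coefficient. -/
lemma card_primes_Ico_le {t : ℝ} (ht : 1 < t) (S : Finset ℕ)
    (hS : ∀ p ∈ S, p.Prime ∧ t ≤ p ∧ (p : ℝ) < 2 * t) :
    (S.card : ℝ) ≤ 1 + Real.log 4 * (t + 1) / Real.log t := by
  have hlog : 0 < Real.log t := Real.log_pos ht
  set k := ⌈t⌉₊ with hk
  have hkt : t ≤ k := Nat.le_ceil t
  have hkt' : (k : ℝ) < t + 1 := Nat.ceil_lt_add_one (by linarith)
  have hk0 : k ≠ 0 := by rintro h; rw [h] at hkt; norm_num at hkt; linarith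
  set T := S.erase k
  have hT : ∀ p ∈ T, p.Prime ∧ k < p ∧ p < 2 * k := by
    intro p hp
    obtain ⟨hne, hp⟩ := Finset.mem_erase.1 hp
    obtain ⟨h1, h2, h3⟩ := hS p hp
    refine ⟨h1, lt_of_le_of_ne (Nat.ceil_le.2 h2) hne.symm, ?_⟩
    have : (p : ℝ) < 2 * k := by linarith
    exact_mod_cast this
  have hdvd : ∏ p ∈ T, p ∣ k.centralBinom := by
    refine Finset.prod_primes_dvd _ (fun p hp => (hT p hp).1.prime) fun p hp => ?_
    obtain ⟨h1, h2, h3⟩ := hT p hp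
    rw [Nat.centralBinom_eq_two_mul_choose]
    exact h1.dvd_choose h2 (by omega) h3.le
  have hle : (t ^ T.card : ℝ) ≤ 4 ^ k := by
    have h1 : ∏ p ∈ T, p ≤ 4 ^ k :=
      (Nat.le_of_dvd (Nat.centralBinom_pos k) hdvd).trans (Nat.centralBinom_le_four_pow k)
    calc (t ^ T.card : ℝ) = ∏ _p ∈ T, t := by simp
      _ ≤ ∏ p ∈ T, (p : ℝ) := by
        refine Finset.prod_le_prod (fun _ _ => by linarith) fun p hp => ?_
        exact (hS p (Finset.mem_of_mem_erase hp)).2.1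
      _ ≤ 4 ^ k := by
        have h2 : ((∏ p ∈ T, p : ℕ) : ℝ) ≤ ((4 ^ k : ℕ) : ℝ) := Nat.cast_le.2 h1
        push_cast at h2
        exact h2
  have hlogle : T.card * Real.log t ≤ Real.log 4 * (t + 1) := by
    have := Real.log_le_log (by positivity) hle
    rw [Real.log_pow, Real.log_pow] at this
    have h4 : 0 < Real.log 4 := Real.log_pos (by norm_num)
    nlinarith
  have hST : (S.card : ℝ) ≤ T.card + 1 := by
    exact_mod_cast Nat.sub_le_iff_le_add.1 (Finset.pred_card_le_card_erase (s := S) (a := k))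
  rw [← le_div_iff₀ hlog] at hlogle
  linarith

/-- The numerical sum bounding the number of products of four primes close to `n ^ (1 / 4)`. -/
lemma sum_range_geometric_le (M : ℕ) :
    ∑ m ∈ Finset.range M, ∑ K ∈ Finset.range (2 * m + 1),
      (√2)⁻¹ ^ m * ((K : ℝ) + 1) ≤ 200 := by
  set r : ℝ := (√2)⁻¹ with hr
  have h2 : (1.414 : ℝ) ≤ √2 := Real.le_sqrt_of_sq_le (by norm_num)
  have hr0 : 0 ≤ r := by positivity
  have hr1 : r ≤ 0.70722 := by
    rw [hr]
    calc (√2)⁻¹ ≤ (1.414 : ℝ)⁻¹ := inv_anti₀ (by norm_num) h2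
      _ ≤ _ := by norm_num
  have hin : ∀ m : ℕ, ∑ K ∈ Finset.range (2 * m + 1), r ^ m * ((K : ℝ) + 1) ≤
      4 * (((m + 2).choose 2 : ℕ) * r ^ m) := by
    intro m
    have e1 : ∀ k : ℕ, ∑ K ∈ Finset.range k, ((K : ℝ) + 1) = k * (k + 1) / 2 := by
      intro k
      induction k with
      | zero => simp
      | succ k ih => rw [Finset.sum_range_succ, ih]; push_cast; ring
    rw [← Finset.mul_sum, e1, Nat.cast_choose_two]
    push_cast
    have := pow_nonneg hr0 m
    have hm : (0 : ℝ) ≤ m := Nat.cast_nonneg m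
    nlinarith [mul_nonneg this hm]
  have hs := hasSum_choose_mul_geometric_of_norm_lt_one (𝕜 := ℝ) 2 (r := r)
    (by rw [Real.norm_of_nonneg hr0]; linarith)
  calc _ ≤ ∑ m ∈ Finset.range M, 4 * (((m + 2).choose 2 : ℕ) * r ^ m) :=
        Finset.sum_le_sum fun m _ => hin m
    _ = 4 * ∑ m ∈ Finset.range M, (((m + 2).choose 2 : ℕ) * r ^ m) := by rw [Finset.mul_sum]
    _ ≤ 4 * (1 / (1 - r) ^ (2 + 1)) := by
        gcongr
        exact sum_le_hasSum _ (fun m _ => by positivity) hs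
    _ ≤ 4 * (1 / (0.29278 : ℝ) ^ (2 + 1)) := by
        gcongr
        linarith
    _ ≤ 200 := by norm_num

open scoped Classical in
/-- The primes up to `n` that are not in `A`. -/
noncomputable def missing (A : Set ℕ) (n : ℕ) : Finset ℕ :=
  (Finset.Icc 1 n).filter (fun p => p.Prime ∧ p ∉ A)

lemma mem_missing {n p : ℕ} : p ∈ missing A n ↔ p ≤ n ∧ p.Prime ∧ p ∉ A := by
  simp only [missing, Finset.mem_filter, Finset.mem_Icc]
  exact ⟨fun h => ⟨h.1.2, h.2⟩, fun h => ⟨⟨h.2.1.one_le, h.1⟩, h.2⟩⟩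

lemma card_missing_le (A : Set ℕ) (n : ℕ) : (missing A n).card ≤ n := by
  have h : missing A n ⊆ Finset.Icc 1 n := fun p hp => by
    rw [mem_missing] at hp
    exact Finset.mem_Icc.2 ⟨hp.2.1.one_le, hp.1⟩
  simpa using Finset.card_le_card h

lemma card_missing_mono (A : Set ℕ) {m n : ℕ} (h : m ≤ n) :
    (missing A m).card ≤ (missing A n).card := by
  refine Finset.card_le_card fun p hp => ?_
  rw [mem_missing] at hp ⊢
  exact ⟨hp.1.trans h, hp.2⟩

open scoped Classical in
lemma card_primes_add_card_missing (A : Set ℕ) (n : ℕ) :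
    ((Finset.Icc 1 n).filter (fun p => p ∈ A ∧ p.Prime)).card + (missing A n).card =
      Nat.primeCounting n := by
  rw [← Nat.primesLE_card_eq_primeCounting, ← Finset.card_union_of_disjoint]
  · congr 1
    ext p
    simp only [Finset.mem_union, mem_missing, Nat.mem_primesLE, Finset.mem_filter, Finset.mem_Icc]
    constructor
    · rintro (h | h)
      · exact ⟨h.1.2, h.2.2⟩
      · exact ⟨h.1, h.2.1⟩
    · intro h
      by_cases hp : p ∈ A
      · exact .inl ⟨⟨h.2.one_le, h.1⟩, hp, h.2⟩
      · exact .inr ⟨h.1, h.2, hp⟩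
  · refine Finset.disjoint_left.2 fun p hp hq => ?_
    rw [mem_missing] at hq
    exact hq.2.2 (Finset.mem_filter.1 hp).2.1

/-- If no divisor of `a` lies in `[α, β]`, then a divisor below `α` can be multiplied by a prime
exceeding `β / α`. -/
lemma exists_prime_mul_dvd {a : ℕ} {α β y : ℝ} (hy : α * y ≤ β) (ha : β < a) (hα : 0 < α)
    (hαβ : α ≤ β)
    (hdiv : ∀ d : ℕ, d ∣ a → (d : ℝ) < α ∨ β < d) {d : ℕ} (hd : d ∣ a) (hdα : (d : ℝ) < α) :
    ∃ p : ℕ, p.Prime ∧ y < p ∧ d * p ∣ a := by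
  classical
  have ha0 : a ≠ 0 := by
    rintro rfl
    norm_num at ha
    linarith
  set D := a.divisors.filter (fun e => d ∣ e ∧ (e : ℝ) < α) with hD
  have hDne : D.Nonempty := ⟨d, by simp [hD, hd, ha0, hdα]⟩
  obtain ⟨e, he, hmax⟩ := Finset.exists_max_image D id hDne
  simp only [hD, Finset.mem_filter, Nat.mem_divisors, id] at he hmax
  obtain ⟨⟨⟨c, rfl⟩, -⟩, hde, heα⟩ := he
  have hc1 : c ≠ 1 := by
    rintro rfl
    rw [mul_one] at ha
    linarith
  obtain ⟨p, hp, hpc⟩ := Nat.exists_prime_and_dvd hc1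
  have hep : e * p ∣ e * c := Nat.mul_dvd_mul_left e hpc
  refine ⟨p, hp, ?_, (Nat.mul_dvd_mul_right hde p).trans hep⟩
  have he0 : 0 < e := Nat.pos_of_ne_zero (by rintro rfl; simp at ha0)
  rcases hdiv _ hep with h | h
  · have h1 := hmax (e * p) ⟨⟨hep, ha0⟩, hde.mul_right p, h⟩
    have h2 := hp.two_le
    nlinarith
  · by_contra! hpy
    push_cast at h
    have : (e : ℝ) * p ≤ α * y :=
      mul_le_mul heα.le hpy (Nat.cast_nonneg _) hα.le
    linarith

lemma exists_sorted_of_four (P : ℕ → Prop) {p₁ p₂ p₃ p₄ : ℕ} (h₁ : P p₁) (h₂ : P p₂) (h₃ : P p₃)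
    (h₄ : P p₄) : ∃ q₁ q₂ q₃ q₄, P q₁ ∧ P q₂ ∧ P q₃ ∧ P q₄ ∧ q₄ ≤ q₃ ∧ q₃ ≤ q₂ ∧ q₃ ≤ q₁ ∧
      p₁ * p₂ * p₃ * p₄ = q₁ * q₂ * q₃ * q₄ := by
  have key : ∀ a b c d : ℕ, P a → P b → P c → P d → d ≤ a → d ≤ b → d ≤ c →
      ∃ q₁ q₂ q₃ q₄, P q₁ ∧ P q₂ ∧ P q₃ ∧ P q₄ ∧ q₄ ≤ q₃ ∧ q₃ ≤ q₂ ∧ q₃ ≤ q₁ ∧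
        a * b * c * d = q₁ * q₂ * q₃ * q₄ := by
    intro a b c d ha hb hc hd h1 h2 h3
    rcases le_total a b with hab | hab <;> rcases le_total b c with hbc | hbc <;>
      rcases le_total a c with hac | hac
    · exact ⟨b, c, a, d, hb, hc, ha, hd, h1, hac, hab, by ring⟩
    · exact ⟨b, c, a, d, hb, hc, ha, hd, h1, hab.trans hbc, hab, by ring⟩
    · exact ⟨b, c, a, d, hb, hc, ha, hd, h1, hac, hab, by ring⟩
    · exact ⟨a, b, c, d, ha, hb, hc, hd, h3, hbc, hac, by ring⟩
    · exact ⟨a, c, b, d, ha, hc, hb, hd, h2, hbc, hab, by ring⟩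
    · exact ⟨a, c, b, d, ha, hc, hb, hd, h2, hbc, hab, by ring⟩
    · exact ⟨a, b, c, d, ha, hb, hc, hd, h3, hbc, hbc.trans hab, by ring⟩
    · exact ⟨a, b, c, d, ha, hb, hc, hd, h3, hbc, hac, by ring⟩
  by_cases g4 : p₄ ≤ p₁ ∧ p₄ ≤ p₂ ∧ p₄ ≤ p₃
  · exact key _ _ _ _ h₁ h₂ h₃ h₄ g4.1 g4.2.1 g4.2.2
  by_cases g3 : p₃ ≤ p₁ ∧ p₃ ≤ p₂ ∧ p₃ ≤ p₄
  · obtain ⟨a, b, c, d, h⟩ := key _ _ _ _ h₁ h₂ h₄ h₃ g3.1 g3.2.1 g3.2.2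
    exact ⟨a, b, c, d, by rwa [mul_right_comm]⟩
  by_cases g2 : p₂ ≤ p₁ ∧ p₂ ≤ p₃ ∧ p₂ ≤ p₄
  · obtain ⟨a, b, c, d, h⟩ := key _ _ _ _ h₁ h₃ h₄ h₂ g2.1 g2.2.1 g2.2.2
    refine ⟨a, b, c, d, ?_⟩
    rwa [show p₁ * p₂ * p₃ * p₄ = p₁ * p₃ * p₄ * p₂ by ring]
  · obtain ⟨a, b, c, d, h⟩ := key _ _ _ _ h₂ h₃ h₄ h₁ (by omega) (by omega) (by omega)
    refine ⟨a, b, c, d, ?_⟩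
    rwa [show p₁ * p₂ * p₃ * p₄ = p₂ * p₃ * p₄ * p₁ by ring]

/-- The possible shapes of an element `a ≤ n` of `A`. -/
lemma shape {n a : ℕ} {α β y z : ℝ} (hz : 0 < z) (hz2 : z * z = α) (hzα : z ≤ α)
    (hy : α * y ≤ β) (hzβ : z * β = n) (hαβ : α ≤ β)
    (hα1 : 1 < α) (ha1 : 1 ≤ a) (han : a ≤ n) (hprime : ¬ a.Prime) (haβ : β < a)
    (hdiv : ∀ d : ℕ, d ∣ a → (d : ℝ) < α ∨ β < d) :
    (∃ p : ℕ, p.Prime ∧ p ∈ A ∧ ∃ w : ℕ, 2 ≤ w ∧ (w : ℝ) ≤ β ∧ a = p * w) ∨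
    (∃ p ∈ missing A (n / 2), ∃ w : ℕ, 1 ≤ w ∧ (w : ℝ) ≤ z ∧ a = p * w) ∨
    (∃ p ∈ missing A ⌊α⌋₊, ∃ w : ℕ, 1 ≤ w ∧ (w : ℝ) ≤ α ∧ a = p * w) ∨
    (∃ p v : ℕ, 1 ≤ p ∧ 1 ≤ v ∧ (p : ℝ) ≤ z ∧ (v : ℝ) ≤ α ∧ a = p * v) ∨
    (∃ p₁ p₂ p₃ p₄ s : ℕ, (p₁.Prime ∧ y < p₁ ∧ p₁ < z) ∧ (p₂.Prime ∧ y < p₂ ∧ p₂ < z) ∧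
      (p₃.Prime ∧ y < p₃ ∧ p₃ < z) ∧ (p₄.Prime ∧ y < p₄ ∧ p₄ < z) ∧
      p₄ ≤ p₃ ∧ p₃ ≤ p₂ ∧ p₃ ≤ p₁ ∧ a = p₁ * p₂ * p₃ * p₄ * s) := by
  have hanR : (a : ℝ) ≤ n := Nat.cast_le.2 han
  by_cases hbig : ∃ p : ℕ, p.Prime ∧ p ∣ a ∧ z ≤ p
  · obtain ⟨p, hp, ⟨w, rfl⟩, hzp⟩ := hbig
    have hp0 : (0 : ℝ) < p := hz.trans_le hzp
    have hw0 : w ≠ 0 := by rintro rfl; simp at ha1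
    have hw1 : w ≠ 1 := by rintro rfl; simp [hp] at hprime
    have hw2 : 2 ≤ w := by omega
    push_cast at hanR haβ
    have hwβ : (w : ℝ) ≤ β := by
      by_contra! h
      have : z * β < p * w := mul_lt_mul' hzp h (by linarith) hp0
      linarith
    by_cases hpA : p ∈ A
    · exact .inl ⟨p, hp, hpA, w, hw2, hwβ, rfl⟩
    rcases hdiv p (dvd_mul_right _ _) with h | h
    · refine .inr (.inr (.inl ⟨p, mem_missing.2 ⟨Nat.le_floor h.le, hp, hpA⟩, w, by omega, ?_, rfl⟩))
      rcases hdiv w (dvd_mul_left _ _) with h' | h'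
      · exact h'.le
      · linarith
    · refine .inr (.inl ⟨p, mem_missing.2 ⟨?_, hp, hpA⟩, w, by omega, ?_, rfl⟩)
      · rw [Nat.le_div_iff_mul_le (by norm_num)]
        exact (Nat.mul_le_mul_left p hw2).trans han
      · by_contra! h'
        have : β * z < p * w := mul_lt_mul'' h h' (by linarith) hz.le
        linarith
  push Not at hbig
  obtain ⟨p₁, hp₁, hyp₁, hd₁⟩ := exists_prime_mul_dvd hy haβ (by linarith) hαβ hdiv (one_dvd a)
    (by simpa using hα1)
  rw [one_mul] at hd₁
  obtain ⟨b, rfl⟩ := hd₁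
  have hz₁ := hbig p₁ hp₁ (dvd_mul_right _ _)
  have hb0 : 1 ≤ b := Nat.pos_of_ne_zero (by rintro rfl; simp at ha1)
  rcases hdiv b (dvd_mul_left _ _) with hb | hb
  · exact .inr (.inr (.inr (.inl ⟨p₁, b, hp₁.one_le, hb0, hz₁.le, hb.le, rfl⟩)))
  have hdivb : ∀ d : ℕ, d ∣ b → (d : ℝ) < α ∨ β < d := fun d hd => hdiv d (hd.mul_left _)
  obtain ⟨p₂, hp₂, hyp₂, hd₂⟩ := exists_prime_mul_dvd hy hb (by linarith) hαβ hdivb (one_dvd b)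
    (by simpa using hα1)
  rw [one_mul] at hd₂
  have hz₂ := hbig p₂ hp₂ (hd₂.mul_left _)
  obtain ⟨p₃, hp₃, hyp₃, hd₃⟩ := exists_prime_mul_dvd hy hb (by linarith) hαβ hdivb hd₂
    (hz₂.trans_le hzα)
  have hz₃ := hbig p₃ hp₃ (((dvd_mul_left _ _).trans hd₃).mul_left _)
  obtain ⟨p₄, hp₄, hyp₄, s, hs⟩ := exists_prime_mul_dvd hy hb (by linarith) hαβ hdivb hd₃
    (by
      rw [← hz2]; push_cast
      exact mul_lt_mul'' hz₂ hz₃ (Nat.cast_nonneg _) (Nat.cast_nonneg _))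
  have hz₄ := hbig p₄ hp₄ (by rw [hs]; exact ((dvd_mul_left _ _).mul_right _).mul_left _)
  obtain ⟨q₁, q₂, q₃, q₄, h1, h2, h3, h4, h5, h6, h7, h8⟩ := exists_sorted_of_four
    (fun p => p.Prime ∧ y < p ∧ p < z) ⟨hp₁, hyp₁, hz₁⟩ ⟨hp₂, hyp₂, hz₂⟩ ⟨hp₃, hyp₃, hz₃⟩
    ⟨hp₄, hyp₄, hz₄⟩
  refine .inr (.inr (.inr (.inr ⟨q₁, q₂, q₃, q₄, s, h1, h2, h3, h4, h5, h6, h7, ?_⟩)))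
  rw [← h8, hs]
  ring

lemma card_Icc_floor_le {t : ℝ} (ht : 0 ≤ t) : ((Finset.Icc 1 ⌊t⌋₊).card : ℝ) ≤ t := by
  simpa using Nat.floor_le ht

lemma mem_Icc_floor {t : ℝ} {w : ℕ} (hw : 1 ≤ w) (hwt : (w : ℝ) ≤ t) :
    w ∈ Finset.Icc 1 ⌊t⌋₊ :=
  Finset.mem_Icc.2 ⟨hw, Nat.le_floor hwt⟩

/-- Each cofactor `w` occurs with at most one prime of `A`. -/
lemma card_le_of_prime_mul (hS : MulSidon A) {β : ℝ} (hβ : 0 ≤ β) (S : Finset ℕ)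
    (h : ∀ a ∈ S, a ∈ A ∧
      ∃ p : ℕ, p.Prime ∧ p ∈ A ∧ ∃ w : ℕ, 2 ≤ w ∧ (w : ℝ) ≤ β ∧ a = p * w) :
    (S.card : ℝ) ≤ β := by
  choose! hA p hp hpA w hw hwβ ha using h
  refine le_trans (Nat.cast_le.2 (Finset.card_le_card_of_injOn (t := Finset.Icc 1 ⌊β⌋₊) w ?_ ?_))
    (card_Icc_floor_le hβ)
  · intro a haS
    exact mem_Icc_floor (one_le_two.trans (hw a haS)) (hwβ a haS)
  · intro a haS b hbS hab
    have hmul : p b * a = p a * b :=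
      calc p b * a = p b * (p a * w a) := by rw [← ha a haS]
        _ = p a * (p b * w b) := by rw [hab]; ring
        _ = p a * b := by rw [← ha b hbS]
    rcases hS _ (hpA b hbS) _ (hA a haS) _ (hpA a haS) _ (hA b hbS) hmul with ⟨-, h⟩ | ⟨h, -⟩
    · exact h
    · exfalso
      have hprime := hp b hbS
      rw [h, ha b hbS] at hprime
      refine Nat.not_prime_mul (hp b hbS).ne_one ?_ hprime
      have := hw b hbS
      omega

lemma card_le_of_mid_divisor (hpos : ∀ a ∈ A, 0 < a) (hS : MulSidon A) {n N : ℕ} {β z : ℝ}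
    (hz : 1 ≤ z) (hzβ : z * β = n) (hβN : β < 2 ^ N) (S : Finset ℕ)
    (h : ∀ a ∈ S, a ∈ A ∧ a ≤ n ∧ ∃ d : ℕ, d ∣ a ∧ z * z ≤ d ∧ (d : ℝ) ≤ β) :
    (S.card : ℝ) ≤ 3 * β * N := by
  choose! hA han d hda hd hdβ using h
  have hmaps : ∀ a ∈ S, Nat.log 2 (d a) ∈ Finset.range N := by
    intro a haS
    have hd0 : d a ≠ 0 := by
      intro h0
      have := hd a haS
      rw [h0] at this
      norm_num at this
      nlinarith
    rw [Finset.mem_range]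
    refine Nat.log_lt_of_lt_pow hd0 ?_
    have := (hdβ a haS).trans_lt hβN
    exact_mod_cast this
  rw [Finset.card_eq_sum_card_fiberwise hmaps]
  push_cast
  have hfib : ∀ k ∈ Finset.range N,
      ((S.filter (fun a => Nat.log 2 (d a) = k)).card : ℝ) ≤ 3 * β := by
    intro k _
    rcases (S.filter (fun a => Nat.log 2 (d a) = k)).eq_empty_or_nonempty with he | ⟨a₀, ha₀⟩
    · rw [he]
      have : 0 ≤ z * β := hzβ ▸ Nat.cast_nonneg n
      have : 0 ≤ β := nonneg_of_mul_nonneg_right this (by linarith)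
      simpa using this
    have hpow : ∀ a ∈ S.filter (fun a => Nat.log 2 (d a) = k),
        2 ^ k ≤ d a ∧ d a < 2 * 2 ^ k := by
      intro a ha
      obtain ⟨haS, rfl⟩ := Finset.mem_filter.1 ha
      have hd0 : d a ≠ 0 := by
        intro h0
        have := hd a haS
        rw [h0] at this
        norm_num at this
        nlinarith
      refine ⟨Nat.pow_log_le_self 2 hd0, ?_⟩
      rw [mul_comm, ← pow_succ]
      exact Nat.lt_pow_succ_log_self (by norm_num) _
    have hD0 : (0 : ℝ) < 2 ^ k := by positivity
    have hDβ : (2 : ℝ) ^ k ≤ β := by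
      have h1 : ((2 ^ k : ℕ) : ℝ) ≤ d a₀ := Nat.cast_le.2 (hpow a₀ ha₀).1
      push_cast at h1
      exact h1.trans (hdβ a₀ (Finset.mem_filter.1 ha₀).1)
    have hDz : z * z ≤ 2 * 2 ^ k := by
      have h1 : ((d a₀ : ℕ) : ℝ) < ((2 * 2 ^ k : ℕ) : ℝ) := Nat.cast_lt.2 (hpow a₀ ha₀).2
      push_cast at h1
      linarith [hd a₀ (Finset.mem_filter.1 ha₀).1]
    have hcard := card_le_mul_sqrt_of_le hpos hS (Finset.Icc 1 ⌊(n : ℝ) / 2 ^ k⌋₊)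
      (Finset.Ico (2 ^ k) (2 * 2 ^ k)) (S.filter (fun a => Nat.log 2 (d a) = k))
      (fun a ha => hA a (Finset.mem_filter.1 ha).1)
      (by
        intro a ha
        have haS := (Finset.mem_filter.1 ha).1
        obtain ⟨w, hw⟩ := hda a haS
        have hw0 : 1 ≤ w := Nat.pos_of_ne_zero (by
          rintro rfl
          exact (hpos a (hA a haS)).ne' (by simpa using hw))
        refine ⟨w, mem_Icc_floor hw0 ?_, d a, Finset.mem_Ico.2 (hpow a ha), by rw [mul_comm, ← hw]⟩
        rw [le_div_iff₀ hD0]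
        have h1 : w * 2 ^ k ≤ n :=
          calc w * 2 ^ k ≤ w * d a := Nat.mul_le_mul_left w (hpow a ha).1
            _ = a := by rw [mul_comm, ← hw]
            _ ≤ n := han a haS
        exact_mod_cast h1)
      (card_Icc_floor_le (by positivity)) (c := 2 ^ k) (by
        simp only [Nat.card_Ico]
        rw [show 2 * 2 ^ k - 2 ^ k = 2 ^ k by omega]
        push_cast; exact le_rfl)
    refine hcard.trans ?_
    have hs : √(2 ^ k : ℝ) * √(2 ^ k : ℝ) = 2 ^ k := Real.mul_self_sqrt hD0.le
    have hs0 : 0 < √(2 ^ k : ℝ) := Real.sqrt_pos.2 hD0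
    have hzs : z ≤ 2 * √(2 ^ k : ℝ) := by
      by_contra! hlt
      nlinarith
    have : (n : ℝ) / 2 ^ k * √(2 ^ k : ℝ) ≤ 2 * β := by
      generalize √(2 ^ k : ℝ) = q at hs hs0 hzs ⊢
      rw [div_mul_eq_mul_div, div_le_iff₀ hD0, ← hzβ, ← hs]
      have : 0 ≤ β := hD0.le.trans hDβ
      nlinarith [mul_nonneg this hs0.le]
    linarith
  calc _ ≤ ∑ _k ∈ Finset.range N, 3 * β := Finset.sum_le_sum hfib
    _ = 3 * β * N := by simp [mul_comm]

open scoped Classical in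
/-- The primes in `(y, z)` in the dyadic class `[Q * 2 ^ x, Q * 2 ^ (x + 1))`. -/
noncomputable def primeClass (Q y z : ℝ) (x : ℤ) : Finset ℕ :=
  (Finset.range ⌈z⌉₊).filter
    (fun p => (p.Prime ∧ y < p ∧ (p : ℝ) < z) ∧ Int.log 2 ((p : ℝ) / Q) = x)

lemma mem_primeClass {Q y z : ℝ} {x : ℤ} {p : ℕ} :
    p ∈ primeClass Q y z x ↔
      (p.Prime ∧ y < p ∧ (p : ℝ) < z) ∧ Int.log 2 ((p : ℝ) / Q) = x := by
  simp only [primeClass, Finset.mem_filter, Finset.mem_range, Nat.lt_ceil]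
  exact ⟨fun h => h.2, fun h => ⟨h.1.2.2, h⟩⟩

lemma zpow_log_div_mul_le {Q : ℝ} (hQ : 0 < Q) {p : ℕ} (hp : 0 < p) :
    Q * (2 : ℝ) ^ Int.log 2 ((p : ℝ) / Q) ≤ p := by
  have h := Int.zpow_log_le_self (b := 2) (r := (p : ℝ) / Q) (by norm_num) (by positivity)
  rw [le_div_iff₀ hQ] at h
  rw [mul_comm]
  exact_mod_cast h

lemma lt_mul_zpow_log_div {Q : ℝ} (hQ : 0 < Q) (p : ℕ) :
    (p : ℝ) < 2 * (Q * (2 : ℝ) ^ Int.log 2 ((p : ℝ) / Q)) := by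
  have h := Int.lt_zpow_succ_log_self (b := 2) (by norm_num) ((p : ℝ) / Q)
  rw [div_lt_iff₀ hQ] at h
  push_cast at h
  rw [zpow_add_one₀ (by norm_num)] at h
  linarith

lemma card_primeClass_le {Q y z c : ℝ} (hQ : 0 < Q) (hc : 0 ≤ c)
    (hPC : ∀ t : ℝ, y / 2 ≤ t → ∀ S : Finset ℕ,
      (∀ p ∈ S, p.Prime ∧ t ≤ p ∧ (p : ℝ) < 2 * t) → (S.card : ℝ) ≤ c * t) (x : ℤ) :
    ((primeClass Q y z x).card : ℝ) ≤ c * (Q * 2 ^ x) := by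
  rcases (primeClass Q y z x).eq_empty_or_nonempty with he | ⟨p₀, hp₀⟩
  · rw [he]
    simp only [Finset.card_empty, Nat.cast_zero]
    positivity
  · have key : ∀ p ∈ primeClass Q y z x, p.Prime ∧ Q * 2 ^ x ≤ p ∧ (p : ℝ) < 2 * (Q * 2 ^ x) := by
      intro p hp
      obtain ⟨⟨h1, -, -⟩, rfl⟩ := mem_primeClass.1 hp
      exact ⟨h1, zpow_log_div_mul_le hQ h1.pos, lt_mul_zpow_log_div hQ p⟩
    refine hPC _ ?_ _ key
    linarith [(key p₀ hp₀).2.2, (mem_primeClass.1 hp₀).1.2.1]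

lemma card_products_le {Q y z c : ℝ} (hQ : 0 < Q) (hc : 0 ≤ c)
    (hPC : ∀ t : ℝ, y / 2 ≤ t → ∀ S : Finset ℕ,
      (∀ p ∈ S, p.Prime ∧ t ≤ p ∧ (p : ℝ) < 2 * t) → (S.card : ℝ) ≤ c * t)
    {i m : ℤ} (him : i ≤ m - i + 1) :
    ((((Finset.Icc i (m - i)) ×ˢ (Finset.Icc i (m - i))).biUnion fun x =>
      (primeClass Q y z x.1 ×ˢ primeClass Q y z x.2 ×ˢ
        Finset.Icc 1 ⌊(2 : ℝ) ^ (m - x.1 - x.2)⌋₊).image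
          (fun v => v.1 * v.2.1 * v.2.2)).card : ℝ) ≤
      ((m - 2 * i + 1 : ℤ) : ℝ) ^ 2 * (c ^ 2 * Q ^ 2 * 2 ^ m) := by
  refine (Nat.cast_le.2 Finset.card_biUnion_le).trans ?_
  push_cast
  calc _ ≤ ∑ x ∈ Finset.Icc i (m - i) ×ˢ Finset.Icc i (m - i), c ^ 2 * Q ^ 2 * (2 : ℝ) ^ m := by
        refine Finset.sum_le_sum fun x _ => ?_
        refine (Nat.cast_le.2 Finset.card_image_le).trans ?_
        rw [Finset.card_product, Finset.card_product]
        push_cast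
        have h1 := card_primeClass_le (z := z) hQ hc hPC x.1
        have h2 := card_primeClass_le (z := z) hQ hc hPC x.2
        have h3 := card_Icc_floor_le (t := (2 : ℝ) ^ (m - x.1 - x.2)) (by positivity)
        calc _ ≤ c * (Q * 2 ^ x.1) * (c * (Q * 2 ^ x.2) * (2 : ℝ) ^ (m - x.1 - x.2)) := by gcongr
          _ = _ := by
            have : (2 : ℝ) ^ m = 2 ^ x.1 * 2 ^ x.2 * 2 ^ (m - x.1 - x.2) := by
              rw [← zpow_add₀ (by norm_num), ← zpow_add₀ (by norm_num)]
              congr 1; ring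
            rw [this]; ring
    _ = _ := by
        rw [Finset.sum_const, Finset.card_product, Int.card_Icc, nsmul_eq_mul]
        push_cast
        have : (((m - i + 1 - i).toNat : ℕ) : ℝ) = ((m - i + 1 - i : ℤ) : ℝ) := by
          rw [← Int.cast_natCast, Int.toNat_of_nonneg (by omega)]
        rw [this]
        push_cast
        ring

/-- The bound for elements having four prime factors close to `n ^ (1 / 4)`. -/
lemma card_le_of_four_primes (hpos : ∀ a ∈ A, 0 < a) (hS : MulSidon A) {n R : ℕ} {Q y z c : ℝ}
    (hQ : 0 < Q) (hQn : Q ^ 4 = n) (hc : 0 ≤ c)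
    (hPC : ∀ t : ℝ, y / 2 ≤ t → ∀ S : Finset ℕ,
      (∀ p ∈ S, p.Prime ∧ t ≤ p ∧ (p : ℝ) < 2 * t) → (S.card : ℝ) ≤ c * t)
    (hyR : Q ≤ y * 2 ^ R) (hzR : z ≤ Q * 2 ^ R) (S : Finset ℕ)
    (h : ∀ a ∈ S, a ∈ A ∧ a ≤ n ∧ ∃ p₁ p₂ p₃ p₄ s : ℕ, (p₁.Prime ∧ y < p₁ ∧ p₁ < z) ∧
      (p₂.Prime ∧ y < p₂ ∧ p₂ < z) ∧ (p₃.Prime ∧ y < p₃ ∧ p₃ < z) ∧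
      (p₄.Prime ∧ y < p₄ ∧ p₄ < z) ∧
      p₄ ≤ p₃ ∧ p₃ ≤ p₂ ∧ p₃ ≤ p₁ ∧ a = p₁ * p₂ * p₃ * p₄ * s) :
    (S.card : ℝ) ≤ 200 * c ^ 3 * Q ^ 3 + 576 * c ^ 2 * Q ^ 2 * 2 ^ (6 * R) := by
  choose! hA han p₁ p₂ p₃ p₄ s h₁ h₂ h₃ h₄ h43 h32 h31 ha using h
  set cls : ℕ → ℤ := fun p => Int.log 2 ((p : ℝ) / Q) with hcls
  have hmono : ∀ {p q : ℕ}, 0 < p → p ≤ q → cls p ≤ cls q := by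
    intro p q hp hpq
    exact Int.log_mono_right (by positivity) (by gcongr)
  have hR : ∀ p : ℕ, p.Prime ∧ y < p ∧ (p : ℝ) < z → -(R : ℤ) - 1 < cls p ∧ cls p < R := by
    rintro p ⟨hp, hyp, hpz⟩
    have e1 := zpow_log_div_mul_le hQ hp.pos
    have e2 := lt_mul_zpow_log_div hQ p
    constructor
    · have : Q * 1 < Q * (2 : ℝ) ^ (cls p + 1 + R) := by
        rw [zpow_add₀ (by norm_num), zpow_add_one₀ (by norm_num), zpow_natCast]
        have h2R : (0 : ℝ) < 2 ^ R := by positivity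
        have := mul_lt_mul_of_pos_right (hyp.trans e2) h2R
        simp only [hcls]
        linarith
      have := lt_of_mul_lt_mul_left this hQ.le
      have := (one_lt_zpow_iff_right₀ (by norm_num : (1 : ℝ) < 2)).1 this
      omega
    · have : Q * (2 : ℝ) ^ cls p < Q * (2 : ℝ) ^ (R : ℤ) := by
        rw [zpow_natCast]
        exact e1.trans_lt (hpz.trans_le hzR)
      exact (zpow_lt_zpow_iff_right₀ (by norm_num)).1 (lt_of_mul_lt_mul_left this hQ.le)
  set φ : ℕ → ℤ × ℤ := fun a => (cls (p₃ a), cls (p₄ a)) with hφ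
  have hspos : ∀ a ∈ S, 0 < s a := by
    intro a haS
    refine Nat.pos_of_ne_zero fun h0 => ?_
    have h1 := ha a haS
    rw [h0, mul_zero] at h1
    exact (hpos a (hA a haS)).ne' h1
  have hprod : ∀ a ∈ S, (s a : ℝ) * 2 ^ (cls (p₁ a) + cls (p₂ a) + cls (p₃ a) + cls (p₄ a)) ≤ 1 := by
    intro a haS
    have e1 := zpow_log_div_mul_le hQ (h₁ a haS).1.pos
    have e2 := zpow_log_div_mul_le hQ (h₂ a haS).1.pos
    have e3 := zpow_log_div_mul_le hQ (h₃ a haS).1.pos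
    have e4 := zpow_log_div_mul_le hQ (h₄ a haS).1.pos
    have hQ4 : 0 < Q ^ 4 := by positivity
    refine le_of_mul_le_mul_left ?_ hQ4
    calc Q ^ 4 * ((s a : ℝ) * 2 ^ (cls (p₁ a) + cls (p₂ a) + cls (p₃ a) + cls (p₄ a)))
        = (Q * 2 ^ cls (p₁ a)) * (Q * 2 ^ cls (p₂ a)) * (Q * 2 ^ cls (p₃ a)) *
            (Q * 2 ^ cls (p₄ a)) * s a := by
          rw [zpow_add₀ (by norm_num), zpow_add₀ (by norm_num), zpow_add₀ (by norm_num)]; ring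
      _ ≤ (p₁ a : ℝ) * p₂ a * p₃ a * p₄ a * s a := by
          simp only [hcls]; gcongr
      _ = (a : ℝ) := by
          have := ha a haS
          exact_mod_cast this.symm
      _ ≤ n := Nat.cast_le.2 (han a haS)
      _ = Q ^ 4 * 1 := by rw [hQn, mul_one]
  have hsum : ∀ a ∈ S, cls (p₁ a) + cls (p₂ a) + cls (p₃ a) + cls (p₄ a) ≤ 0 := by
    intro a haS
    have h1 : (1 : ℝ) ≤ s a := by exact_mod_cast hspos a haS
    have h2 : (2 : ℝ) ^ (cls (p₁ a) + cls (p₂ a) + cls (p₃ a) + cls (p₄ a)) ≤ 1 := by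
      refine le_trans ?_ (hprod a haS)
      exact le_mul_of_one_le_left (by positivity) h1
    exact (zpow_le_one_iff_right₀ (by norm_num)).1 h2
  have hord : ∀ a ∈ S, cls (p₄ a) ≤ cls (p₃ a) ∧ cls (p₃ a) ≤ cls (p₂ a) ∧
      cls (p₃ a) ≤ cls (p₁ a) := fun a haS =>
    ⟨hmono (h₄ a haS).1.pos (h43 a haS), hmono (h₃ a haS).1.pos (h32 a haS),
      hmono (h₃ a haS).1.pos (h31 a haS)⟩
  set F := S.image φ with hF
  have hFmem : ∀ x ∈ F, x.2 ≤ x.1 ∧ 3 * x.1 + x.2 ≤ 0 ∧ -(R : ℤ) ≤ x.2 ∧ x.1 < R := by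
    intro x hx
    obtain ⟨a, haS, rfl⟩ := Finset.mem_image.1 hx
    have e1 := hord a haS
    have e2 := hsum a haS
    have e3 := hR _ (h₃ a haS)
    have e4 := hR _ (h₄ a haS)
    simp only [hφ]
    omega
  set r : ℝ := (√2)⁻¹ with hr
  have hr0 : 0 ≤ r := by positivity
  set ψ : ℤ × ℤ → (_ : ℕ) × ℕ := fun x => ⟨(-(x.1 + x.2)).toNat, (-(3 * x.1 + x.2)).toNat⟩ with hψ
  set T : (_ : ℕ) × ℕ → ℝ := fun u => r ^ u.1 * ((u.2 : ℝ) + 1) with hT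
  have hfib : ∀ x ∈ F, ((S.filter (fun a => φ a = x)).card : ℝ) ≤
      c ^ 3 * Q ^ 3 * T (ψ x) + 64 * c ^ 2 * Q ^ 2 * 2 ^ (4 * R) := by
    rintro ⟨i, j⟩ hx
    obtain ⟨hji, h3ij, hjR, hiR⟩ := hFmem _ hx
    simp only at hji h3ij hjR hiR
    obtain ⟨m, hm⟩ : ∃ m : ℕ, (m : ℤ) = -(i + j) := ⟨(-(i + j)).toNat, by omega⟩
    obtain ⟨K, hK⟩ : ∃ K : ℕ, (K : ℤ) = -(3 * i + j) := ⟨(-(3 * i + j)).toNat, by omega⟩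
    have hψx : ψ (i, j) = ⟨m, K⟩ := by
      simp only [hψ, ← hm, ← hK, Int.toNat_natCast]
    have hX : (((primeClass Q y z i ×ˢ primeClass Q y z j).image
        (fun v => v.1 * v.2)).card : ℝ) ≤ c ^ 2 * Q ^ 2 * (2 ^ m)⁻¹ := by
      refine (Nat.cast_le.2 Finset.card_image_le).trans ?_
      rw [Finset.card_product]
      push_cast
      have h1 := card_primeClass_le (z := z) hQ hc hPC i
      have h2 := card_primeClass_le (z := z) hQ hc hPC j
      calc _ ≤ c * (Q * 2 ^ i) * (c * (Q * 2 ^ j)) := by gcongr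
        _ = c ^ 2 * Q ^ 2 * (2 ^ i * 2 ^ j) := by ring
        _ = _ := by
          rw [← zpow_add₀ (by norm_num), show i + j = -(m : ℤ) by omega, zpow_neg, zpow_natCast]
    have hY := card_products_le (z := z) hQ hc hPC (i := i) (m := m) (by omega)
    rw [show ((m : ℤ) - 2 * i + 1) = K + 1 by omega, zpow_natCast] at hY
    push_cast at hY
    have hcard := card_le_mul_sqrt_of_le hpos hS _ _ (S.filter (fun a => φ a = (i, j)))
      (fun a ha => hA a (Finset.mem_filter.1 ha).1) (by
        intro a ha'
        obtain ⟨haS, hφa⟩ := Finset.mem_filter.1 ha'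
        obtain ⟨rfl, rfl⟩ := Prod.mk.inj hφa
        have e1 := hord a haS
        have e2 := hsum a haS
        refine ⟨p₃ a * p₄ a, Finset.mem_image.2 ⟨(p₃ a, p₄ a), Finset.mem_product.2
          ⟨mem_primeClass.2 ⟨h₃ a haS, rfl⟩, mem_primeClass.2 ⟨h₄ a haS, rfl⟩⟩, rfl⟩,
          p₁ a * p₂ a * s a, Finset.mem_biUnion.2 ⟨(cls (p₁ a), cls (p₂ a)), ?_,
            Finset.mem_image.2 ⟨(p₁ a, p₂ a, s a), Finset.mem_product.2
              ⟨mem_primeClass.2 ⟨h₁ a haS, rfl⟩, Finset.mem_product.2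
                ⟨mem_primeClass.2 ⟨h₂ a haS, rfl⟩, ?_⟩⟩, rfl⟩⟩, ?_⟩
        · simp only [Finset.mem_product, Finset.mem_Icc]
          omega
        · refine mem_Icc_floor (hspos a haS) ?_
          have e3 := hprod a haS
          rw [show cls (p₁ a) + cls (p₂ a) + cls (p₃ a) + cls (p₄ a) =
            -(m - cls (p₁ a) - cls (p₂ a)) by omega, zpow_neg] at e3
          have e4 : (0 : ℝ) < 2 ^ ((m : ℤ) - cls (p₁ a) - cls (p₂ a)) := by positivity
          rwa [← div_eq_mul_inv, div_le_one e4] at e3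
        · exact (ha a haS).trans (by ring)) hX hY
    refine hcard.trans ?_
    rw [hψx]
    simp only [hT]
    have hs2 : √((2 : ℝ) ^ m) = √2 ^ m := by
      rw [Real.sqrt_eq_iff_mul_self_eq (by positivity) (by positivity), ← mul_pow,
        Real.mul_self_sqrt (by norm_num)]
    have hsq : √(((K : ℝ) + 1) ^ 2 * (c ^ 2 * Q ^ 2 * 2 ^ m)) = ((K : ℝ) + 1) * (c * Q * √2 ^ m) := by
      rw [show ((K : ℝ) + 1) ^ 2 * (c ^ 2 * Q ^ 2 * 2 ^ m) = (((K : ℝ) + 1) * (c * Q)) ^ 2 * 2 ^ m by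
        ring, Real.sqrt_mul (by positivity), Real.sqrt_sq (by positivity), hs2]
      ring
    have h2m : ((2 : ℝ) ^ m)⁻¹ * √2 ^ m = r ^ m := by
      rw [hr, ← inv_pow, ← mul_pow]
      congr 1
      have h22 : √(2 : ℝ) * √2 = 2 := Real.mul_self_sqrt (by norm_num)
      have : √(2 : ℝ) ≠ 0 := by positivity
      field_simp
      rw [sq, h22]
    have hmain : c ^ 2 * Q ^ 2 * (2 ^ m)⁻¹ * (((K : ℝ) + 1) * (c * Q * √2 ^ m)) =
        c ^ 3 * Q ^ 3 * (r ^ m * ((K : ℝ) + 1)) := by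
      rw [← h2m]; ring
    rw [hsq, hmain]
    have hR2 : (R : ℝ) + 1 ≤ 2 ^ R := by
      have := Nat.lt_two_pow_self (n := R)
      exact_mod_cast this
    have hKR : (K : ℝ) + 1 ≤ 8 * 2 ^ R := by
      have : (K : ℝ) ≤ 4 * R := by
        have : (K : ℤ) ≤ 4 * R := by omega
        exact_mod_cast this
      linarith
    have hmR : (2 : ℝ) ^ m ≤ 2 ^ (2 * R) := pow_le_pow_right₀ (by norm_num) (by omega)
    have : ((K : ℝ) + 1) ^ 2 * (c ^ 2 * Q ^ 2 * 2 ^ m) ≤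
        (8 * 2 ^ R) ^ 2 * (c ^ 2 * Q ^ 2 * 2 ^ (2 * R)) := by gcongr
    have e : (8 * (2 : ℝ) ^ R) ^ 2 * (c ^ 2 * Q ^ 2 * 2 ^ (2 * R)) =
        64 * c ^ 2 * Q ^ 2 * 2 ^ (4 * R) := by
      rw [show 4 * R = 2 * R + R + R by ring, pow_add, pow_add]
      ring
    rw [e] at this
    exact add_le_add le_rfl this
  have hFcard : (F.card : ℝ) ≤ 9 * 2 ^ (2 * R) := by
    have h1 : F ⊆ Finset.Icc (-(R : ℤ)) R ×ˢ Finset.Icc (-(R : ℤ)) R := by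
      intro x hx
      have := hFmem x hx
      simp only [Finset.mem_product, Finset.mem_Icc]
      omega
    have h2 := Finset.card_le_card h1
    rw [Finset.card_product, Int.card_Icc, show ((R : ℤ) + 1 - -(R : ℤ)).toNat = 2 * R + 1 by omega]
      at h2
    have h3 : 2 * R + 1 ≤ 3 * 2 ^ R := by
      have := Nat.lt_two_pow_self (n := R)
      omega
    have h4 : F.card ≤ 9 * 2 ^ (2 * R) := by
      refine h2.trans ((Nat.mul_le_mul h3 h3).trans (le_of_eq ?_))
      rw [two_mul R, pow_add]; ring
    exact_mod_cast h4
  have hTsum : ∑ x ∈ F, T (ψ x) ≤ 200 := by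
    have hinj : Set.InjOn ψ F := by
      intro x hx x' hx' hxx
      have e1 := hFmem x hx
      have e2 := hFmem x' hx'
      simp only [hψ, Sigma.mk.injEq, heq_eq_eq] at hxx
      ext <;> omega
    rw [← Finset.sum_image (f := T) hinj]
    refine le_trans ?_ (sum_range_geometric_le (2 * R + 1))
    rw [Finset.sum_sigma']
    refine Finset.sum_le_sum_of_subset_of_nonneg ?_ fun _ _ _ => by positivity
    intro u hu
    obtain ⟨x, hx, rfl⟩ := Finset.mem_image.1 hu
    have e1 := hFmem x hx
    simp only [hψ, Finset.mem_sigma, Finset.mem_range]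
    omega
  calc (S.card : ℝ) = ∑ x ∈ F, ((S.filter (fun a => φ a = x)).card : ℝ) := by
        rw [Finset.card_eq_sum_card_image φ S]; push_cast; rfl
    _ ≤ ∑ x ∈ F, (c ^ 3 * Q ^ 3 * T (ψ x) + 64 * c ^ 2 * Q ^ 2 * 2 ^ (4 * R)) :=
        Finset.sum_le_sum hfib
    _ = c ^ 3 * Q ^ 3 * ∑ x ∈ F, T (ψ x) + F.card * (64 * c ^ 2 * Q ^ 2 * 2 ^ (4 * R)) := by
        rw [Finset.sum_add_distrib, Finset.mul_sum, Finset.sum_const, nsmul_eq_mul]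
    _ ≤ c ^ 3 * Q ^ 3 * 200 + 9 * 2 ^ (2 * R) * (64 * c ^ 2 * Q ^ 2 * 2 ^ (4 * R)) := by
        gcongr
    _ = _ := by
        rw [show 6 * R = 2 * R + 4 * R by ring, pow_add]
        ring

open scoped Classical in
lemma card_le_of_or {S : Finset ℕ} {q r : ℕ → Prop} {b c : ℝ}
    (hq : ∀ T ⊆ S, (∀ a ∈ T, q a) → (T.card : ℝ) ≤ b)
    (hr : ∀ T ⊆ S, (∀ a ∈ T, r a) → (T.card : ℝ) ≤ c) :
    ∀ T ⊆ S, (∀ a ∈ T, q a ∨ r a) → (T.card : ℝ) ≤ b + c := by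
  intro T hT h
  rw [← Finset.card_filter_add_card_filter_not (s := T) q, Nat.cast_add]
  refine add_le_add (hq _ ((Finset.filter_subset _ _).trans hT) fun a ha => ?_)
    (hr _ ((Finset.filter_subset _ _).trans hT) fun a ha => ?_)
  · exact (Finset.mem_filter.1 ha).2
  · obtain ⟨haT, hqa⟩ := Finset.mem_filter.1 ha
    exact (h a haT).resolve_left hqa

open scoped Classical in
/-- The upper bound for `A(n)` obtained by counting each shape of element separately. -/
lemma card_add_card_missing_le_of_shape (hpos : ∀ a ∈ A, 0 < a) (hS : MulSidon A) {n N R : ℕ}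
    {Q α β y z c : ℝ} (hQ : 0 < Q) (hQn : Q ^ 4 = n) (hc : 0 ≤ c)
    (hPC : ∀ t : ℝ, y / 2 ≤ t → ∀ S : Finset ℕ,
      (∀ p ∈ S, p.Prime ∧ t ≤ p ∧ (p : ℝ) < 2 * t) → (S.card : ℝ) ≤ c * t)
    (hyR : Q ≤ y * 2 ^ R) (hzR : z ≤ Q * 2 ^ R) (hz1 : 1 < z) (hz2 : z * z = α)
    (hyβ : α * y ≤ β) (hzβ : z * β = n) (hαβ : α ≤ β) (hnN : n < 2 ^ N) :
    (((Finset.Icc 1 n).filter (fun a => a ∈ A)).card : ℝ) + (missing A n).card ≤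
      Nat.primeCounting n + (missing A (n / 2)).card +
        (α * √(missing A ⌊α⌋₊).card + (missing A ⌊α⌋₊).card) +
        (2 * β + 3 * β * N + 3 * α + 200 * c ^ 3 * Q ^ 3 + 576 * c ^ 2 * Q ^ 2 * 2 ^ (6 * R)) := by
  have hz0 : 0 < z := by linarith
  have hzα : z ≤ α := hz2 ▸ le_mul_of_one_le_left hz0.le hz1.le
  have hα1 : 1 < α := hz1.trans_le hzα
  have hα0 : 0 < α := by linarith
  have hβ0 : 0 < β := hα0.trans_le hαβ
  have hβN : β < 2 ^ N := by
    have h1 : (n : ℝ) < 2 ^ N := by exact_mod_cast hnN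
    exact (le_mul_of_one_le_left hβ0.le hz1.le).trans_lt (hzβ.trans_lt h1)
  set S := (Finset.Icc 1 n).filter (fun a => a ∈ A) with hSdef
  have hmem : ∀ {a}, a ∈ S → a ∈ A ∧ 1 ≤ a ∧ a ≤ n := fun {a} ha => by
    rw [hSdef, Finset.mem_filter, Finset.mem_Icc] at ha
    exact ⟨ha.2, ha.1⟩
  clear_value S
  have hcover := fun (a : ℕ) (haS : a ∈ S) => (em a.Prime).imp_right fun hp =>
    (em ((a : ℝ) ≤ β)).imp_right fun haβ =>
      (em (∃ d : ℕ, d ∣ a ∧ z * z ≤ d ∧ (d : ℝ) ≤ β)).imp_right fun hd =>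
        shape (A := A) hz0 hz2 hzα hyβ hzβ hαβ hα1 (hmem haS).2.1 (hmem haS).2.2 hp
          (not_le.1 haβ) fun d hda => by
            by_contra! hcon
            exact hd ⟨d, hda, hz2.trans_le hcon.1, hcon.2⟩
  refine (add_le_add_left (card_le_of_or ?_ (card_le_of_or ?_ (card_le_of_or ?_ (card_le_of_or ?_
    (card_le_of_or ?_ (card_le_of_or ?_ (card_le_of_or ?_ ?_)))))) S subset_rfl hcover) _).trans
      (le_of_eq (a := ((Nat.primeCounting n : ℝ) - (missing A n).card + (β + (3 * β * N + (β +
        ((missing A (n / 2)).card + α + (α * √(missing A ⌊α⌋₊).card + (missing A ⌊α⌋₊).card +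
          (z * √α + α + (200 * c ^ 3 * Q ^ 3 + 576 * c ^ 2 * Q ^ 2 * 2 ^ (6 * R)))))))))
            + (missing A n).card) ?_)
  · intro T hT h
    have h1 : T ⊆ (Finset.Icc 1 n).filter (fun p => p ∈ A ∧ p.Prime) := fun a ha =>
      Finset.mem_filter.2 ⟨Finset.mem_Icc.2 (hmem (hT ha)).2, (hmem (hT ha)).1, h a ha⟩
    have h2 := Finset.card_le_card h1
    rw [le_sub_iff_add_le, ← card_primes_add_card_missing A n]
    push_cast
    gcongr
  · intro T hT h
    refine le_trans (Nat.cast_le.2 (Finset.card_le_card fun a ha => ?_)) (card_Icc_floor_le hβ0.le)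
    exact mem_Icc_floor (hmem (hT ha)).2.1 (h a ha)
  · exact fun T hT h => card_le_of_mid_divisor hpos hS hz1.le hzβ hβN T fun a ha =>
      ⟨(hmem (hT ha)).1, (hmem (hT ha)).2.2, h a ha⟩
  · exact fun T hT h => card_le_of_prime_mul hS hβ0.le T fun a ha => ⟨(hmem (hT ha)).1, h a ha⟩
  · intro T hT h
    have h1 := card_le_add_sq hpos hS (Finset.Icc 1 ⌊z⌋₊) (missing A (n / 2)) T
      (fun a ha => (hmem (hT ha)).1) (by
        intro a ha
        obtain ⟨p, hp, w, hw1, hwz, rfl⟩ := h a ha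
        exact ⟨w, mem_Icc_floor hw1 hwz, p, hp, mul_comm _ _⟩)
    have h2 : (T.card : ℝ) ≤ (missing A (n / 2)).card + ((Finset.Icc 1 ⌊z⌋₊).card : ℝ) ^ 2 := by
      exact_mod_cast h1
    have h3 : ((Finset.Icc 1 ⌊z⌋₊).card : ℝ) ^ 2 ≤ z ^ 2 :=
      pow_le_pow_left₀ (Nat.cast_nonneg _) (card_Icc_floor_le hz0.le) 2
    rw [← hz2, ← sq]
    linarith
  · intro T hT h
    refine card_le_mul_sqrt_of_le hpos hS (Finset.Icc 1 ⌊α⌋₊) (missing A ⌊α⌋₊) T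
      (fun a ha => (hmem (hT ha)).1) ?_ (card_Icc_floor_le hα0.le) le_rfl
    intro a ha
    obtain ⟨p, hp, w, hw1, hwz, rfl⟩ := h a ha
    exact ⟨w, mem_Icc_floor hw1 hwz, p, hp, mul_comm _ _⟩
  · intro T hT h
    refine card_le_mul_sqrt_of_le hpos hS (Finset.Icc 1 ⌊z⌋₊) (Finset.Icc 1 ⌊α⌋₊) T
      (fun a ha => (hmem (hT ha)).1) ?_ (card_Icc_floor_le hz0.le) (card_Icc_floor_le hα0.le)
    intro a ha
    obtain ⟨p, v, hp1, hv1, hpz, hvα, rfl⟩ := h a ha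
    exact ⟨p, mem_Icc_floor hp1 hpz, v, mem_Icc_floor hv1 hvα, rfl⟩
  · exact fun T hT h => card_le_of_four_primes hpos hS hQ hQn hc hPC hyR hzR T fun a ha =>
      ⟨(hmem (hT ha)).1, (hmem (hT ha)).2.2, h a ha⟩
  · have hsα : √α = z := by rw [← hz2, Real.sqrt_mul_self hz0.le]
    rw [hsα, hz2]
    ring

open scoped Classical in
/-- The upper bound for `A(n)` in terms of the primes missing from `A`. -/
lemma card_add_card_missing_le (hpos : ∀ a ∈ A, 0 < a) (hS : MulSidon A) {n N : ℕ} {Q L : ℝ}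
    (hL : 100 ≤ L) (hQL : L ^ 200 ≤ Q) (hQn : Q ^ 4 = n) (hnN : n < 2 ^ N) (hNL : (N : ℝ) ≤ 3 * L)
    (hPC : ∀ t : ℝ, Q / L ^ 15 / 2 ≤ t → ∀ S : Finset ℕ,
      (∀ p ∈ S, p.Prime ∧ t ≤ p ∧ (p : ℝ) < 2 * t) → (S.card : ℝ) ≤ 6 / L * t) :
    (((Finset.Icc 1 n).filter (fun a => a ∈ A)).card : ℝ) + (missing A n).card ≤
      Nat.primeCounting n + (missing A (n / 2)).card +
        (Q ^ 2 * L ^ 10 * √(missing A ⌊Q ^ 2 * L ^ 10⌋₊).card +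
          (missing A ⌊Q ^ 2 * L ^ 10⌋₊).card) + 72000 * (Q ^ 3 / L ^ 3) := by
  have hL0 : 0 < L := by linarith
  have hL1 : 1 ≤ L := by linarith
  have hQ0 : 0 < Q := lt_of_lt_of_le (by positivity) hQL
  have hpow : ∀ k : ℕ, k ≤ 200 → L ^ k ≤ Q := fun k hk =>
    (pow_le_pow_right₀ hL1 hk).trans hQL
  have hQ1 : 100 ≤ Q := hL.trans (by simpa using hpow 1 (by norm_num))
  set z := Q * L ^ 5 with hz
  set α := Q ^ 2 * L ^ 10 with hα
  set β := Q ^ 3 / L ^ 5 with hβ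
  set y := Q / L ^ 15 with hy
  set E := Q ^ 3 / L ^ 3 with hE
  have hE0 : 0 < E := by positivity
  have hz1 : 1 < z := by
    have := one_le_pow₀ (n := 5) hL1
    nlinarith
  have hz0 : 0 < z := by positivity
  have hα0 : 0 < α := by positivity
  have hβ0 : 0 < β := by positivity
  have hz2 : z * z = α := by rw [hz, hα]; ring
  have hyβ : α * y ≤ β := by
    refine le_of_eq ?_
    rw [hα, hy, hβ]; field_simp
  have hzβ : z * β = n := by rw [← hQn, hz, hβ]; field_simp
  have hαE : L * α ≤ E := by
    rw [hα, hE, le_div_iff₀ (by positivity)]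
    calc L * (Q ^ 2 * L ^ 10) * L ^ 3 = Q ^ 2 * L ^ 14 := by ring
      _ ≤ Q ^ 2 * Q := by gcongr; exact hpow 14 (by norm_num)
      _ = Q ^ 3 := by ring
  have hβE : L ^ 2 * β = E := by rw [hβ, hE]; field_simp
  have hαβ : α ≤ β := by
    rw [hα, hβ, le_div_iff₀ (by positivity)]
    calc Q ^ 2 * L ^ 10 * L ^ 5 = Q ^ 2 * L ^ 15 := by ring
      _ ≤ Q ^ 2 * Q := by gcongr; exact hpow 15 (by norm_num)
      _ = Q ^ 3 := by ring
  obtain ⟨R, hR1, hR2⟩ : ∃ R : ℕ, L ^ 15 ≤ 2 ^ R ∧ (2 : ℝ) ^ R ≤ 2 * L ^ 15 := by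
    obtain ⟨r, hr1, hr2⟩ := exists_nat_pow_near (one_le_pow₀ (n := 15) hL1) (one_lt_two (α := ℝ))
    exact ⟨r + 1, hr2.le, by rw [pow_succ]; linarith⟩
  have hyR : Q ≤ y * 2 ^ R := by
    rw [hy, div_mul_eq_mul_div, le_div_iff₀ (by positivity)]
    gcongr
  have hzR : z ≤ Q * 2 ^ R := by
    rw [hz]
    gcongr
    exact (pow_le_pow_right₀ hL1 (by norm_num)).trans hR1
  have key := card_add_card_missing_le_of_shape hpos hS hQ0 hQn (by positivity) hPC hyR hzR hz1 hz2
    hyβ hzβ hαβ hnN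
  have e1 : 200 * (6 / L) ^ 3 * Q ^ 3 = 43200 * E := by
    rw [hE]; field_simp; norm_num
  have e2 : 576 * (6 / L) ^ 2 * Q ^ 2 * 2 ^ (6 * R) ≤ E := by
    have h1 : (2 : ℝ) ^ (6 * R) ≤ 64 * L ^ 90 := by
      rw [mul_comm, pow_mul]
      calc ((2 : ℝ) ^ R) ^ 6 ≤ (2 * L ^ 15) ^ 6 := by gcongr
        _ = _ := by ring
    have h2 : 1327104 ≤ L ^ 4 := by
      have : (100 : ℝ) ^ 4 ≤ L ^ 4 := by gcongr
      linarith
    rw [hE, le_div_iff₀ (by positivity)]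
    calc 576 * (6 / L) ^ 2 * Q ^ 2 * 2 ^ (6 * R) * L ^ 3
        ≤ 576 * (6 / L) ^ 2 * Q ^ 2 * (64 * L ^ 90) * L ^ 3 := by gcongr
      _ = 1327104 * (Q ^ 2 * L ^ 91) := by field_simp; norm_num
      _ ≤ L ^ 4 * (Q ^ 2 * L ^ 91) := by gcongr
      _ = Q ^ 2 * L ^ 95 := by ring
      _ ≤ Q ^ 2 * Q := by gcongr; exact hpow 95 (by norm_num)
      _ = Q ^ 3 := by ring
  have e3 : 3 * β * N ≤ E := by
    calc 3 * β * N ≤ 3 * β * (3 * L) := by gcongr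
      _ = 9 * (L * β) := by ring
      _ ≤ L * (L * β) := by gcongr; linarith
      _ = E := by rw [← hβE]; ring
  have e4 : β ≤ E := by
    rw [← hβE]; exact le_mul_of_one_le_left hβ0.le (one_le_pow₀ hL1)
  have e5 : α ≤ E := (le_mul_of_one_le_left hα0.le hL1).trans hαE
  linarith only [key, e1, e2, e3, e4, e5, hE0]

lemma card_primes_le_of_log {Q L : ℝ} (hL : 100 ≤ L) (hQ0 : 0 < Q) (hQ : Real.log Q = L / 4)
    (hQL : L ^ 1500 ≤ Q)
    {t : ℝ} (ht : Q / L ^ 15 / 2 ≤ t) (S : Finset ℕ)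
    (hS : ∀ p ∈ S, p.Prime ∧ t ≤ p ∧ (p : ℝ) < 2 * t) : (S.card : ℝ) ≤ 6 / L * t := by
  have hL0 : 0 < L := by linarith
  have hL1 : 1 ≤ L := by linarith
  have ht' : 50 * L ^ 2 ≤ t := by
    refine le_trans ?_ ht
    rw [le_div_iff₀ (by norm_num), le_div_iff₀ (by positivity)]
    calc 50 * L ^ 2 * 2 * L ^ 15 = 100 * L ^ 17 := by ring
      _ ≤ L * L ^ 17 := by gcongr
      _ = L ^ 18 := by ring
      _ ≤ L ^ 1500 := pow_le_pow_right₀ hL1 (by norm_num)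
      _ ≤ Q := hQL
  have ht1 : 1 < t := by nlinarith
  have h4 : Real.log 4 ≤ 1.3864 := by
    rw [show (4 : ℝ) = 2 ^ 2 by norm_num, Real.log_pow]
    have := Real.log_two_lt_d9
    push_cast
    linarith
  have hlogL : 1500 * Real.log L ≤ L / 4 := by
    have := Real.log_le_log (by positivity) hQL
    rw [Real.log_pow, hQ] at this
    exact_mod_cast this
  have hlogt : 0.24 * L ≤ Real.log t := by
    have h1 := Real.log_le_log (by positivity) ht
    rw [Real.log_div (by positivity) (by norm_num), Real.log_div (by positivity) (by positivity),
      Real.log_pow, hQ] at h1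
    have := Real.log_two_lt_d9
    push_cast at h1
    linarith
  have h := card_primes_Ico_le ht1 S hS
  have h2 : Real.log 4 * (t + 1) / Real.log t ≤ 1.3864 * (t + 1) / (0.24 * L) := by
    gcongr
  have h3 : 1 + 1.3864 * (t + 1) / (0.24 * L) ≤ 6 / L * t := by
    rw [← sub_nonneg]
    have : 6 / L * t - (1 + 1.3864 * (t + 1) / (0.24 * L)) =
        (0.24 * 6 * t - 0.24 * L - 1.3864 * (t + 1)) / (0.24 * L) := by field_simp; ring
    rw [this]
    refine div_nonneg ?_ (by positivity)
    nlinarith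
  linarith

lemma eventually_log_pow_le : ∀ᶠ n : ℕ in atTop, (10 : ℝ) ^ 6 ≤ Real.log n ∧
    Real.log n ^ 1500 ≤ (n : ℝ) ^ (1 / 4 : ℝ) := by
  have hn : Tendsto (fun n : ℕ => (n : ℝ)) atTop atTop := tendsto_natCast_atTop_atTop
  refine ((Real.tendsto_log_atTop.comp hn).eventually_ge_atTop _).and ?_
  have h := ((isLittleO_log_rpow_rpow_atTop 1500 (by norm_num : (0 : ℝ) < 1 / 4)).comp_tendsto
    hn).def one_pos
  filter_upwards [h, eventually_ge_atTop 1] with n h h1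
  have : 0 ≤ Real.log n := Real.log_natCast_nonneg n
  simp only [Function.comp, Real.norm_eq_abs, one_mul] at h
  rw [abs_of_nonneg (by positivity), abs_of_nonneg (by positivity)] at h
  exact_mod_cast h

/-- Iterating `B n ≤ B (n / 2) + 2 * n / log n ^ k` down to `M`. -/
lemma le_of_halving {B : ℕ → ℝ} {M k : ℕ} (hM : 2 ≤ M) (hB : ∀ n, B n ≤ n)
    (h : ∀ n, M ≤ n → B n ≤ B (n / 2) + 2 * (n / Real.log n ^ k)) (n : ℕ) :
    B n ≤ M + 4 * (n / Real.log M ^ k) := by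
  have hlog : 0 < Real.log M := Real.log_pos (by exact_mod_cast hM)
  induction n using Nat.strong_induction_on with
  | _ n ih =>
    rcases lt_or_ge n M with hn | hn
    · have h1 : (n : ℝ) ≤ M := by exact_mod_cast hn.le
      have h2 : 0 ≤ (n : ℝ) / Real.log M ^ k := by positivity
      linarith [hB n]
    · have h1 := h n hn
      have h2 := ih (n / 2) (by omega)
      have h3 : ((n / 2 : ℕ) : ℝ) / Real.log M ^ k ≤ n / 2 / Real.log M ^ k := by
        gcongr
        exact Nat.cast_div_le
      have h4 : (n : ℝ) / Real.log n ^ k ≤ n / Real.log M ^ k := by gcongr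
      have h5 : (n : ℝ) / 2 / Real.log M ^ k = n / Real.log M ^ k / 2 := by ring
      linarith

open scoped Classical in
/-- The upper bound for `A(n)` with the parameters of the decomposition chosen. -/
lemma eventually_card_add_card_missing_le (hpos : ∀ a ∈ A, 0 < a) (hS : MulSidon A) :
    ∀ᶠ n : ℕ in atTop, ∀ Q L : ℝ, Q = (n : ℝ) ^ (1 / 4 : ℝ) → L = Real.log n →
      (Nat.card ↥(A ∩ Set.Icc 1 n) : ℝ) + (missing A n).card ≤
      Nat.primeCounting n + (missing A (n / 2)).card +
        (Q ^ 2 * L ^ 10 * √(missing A ⌊Q ^ 2 * L ^ 10⌋₊).card +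
          (missing A ⌊Q ^ 2 * L ^ 10⌋₊).card) + 72000 * (Q ^ 3 / L ^ 3) := by
  filter_upwards [eventually_log_pow_le, eventually_ge_atTop 2] with n ⟨h1, h2⟩ hn Q L hQ hL
  rw [← hQ, ← hL] at h2
  rw [← hL] at h1
  have hn0 : (0 : ℝ) < n := by positivity
  have hL100 : 100 ≤ L := le_trans (by norm_num) h1
  have hQ4 : Q ^ 4 = n := by
    rw [hQ, ← Real.rpow_natCast, ← Real.rpow_mul hn0.le]
    norm_num
  have hcard : Nat.card ↥(A ∩ Set.Icc 1 n) = ((Finset.Icc 1 n).filter (fun a => a ∈ A)).card := by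
    rw [← Nat.card_eq_finsetCard]
    congr 2
    ext a
    simp only [Set.mem_inter_iff, Set.mem_Icc, Finset.mem_coe, Finset.mem_filter, Finset.mem_Icc]
    tauto
  rw [hcard]
  refine card_add_card_missing_le hpos hS (N := Nat.log 2 n + 1) hL100
    ((pow_le_pow_right₀ (by linarith) (by norm_num)).trans h2) hQ4
    (Nat.lt_pow_succ_log_self one_lt_two n) ?_ ?_
  · have h3 : Nat.log 2 n * Real.log 2 ≤ L := by
      rw [hL, ← Real.log_pow]
      refine Real.log_le_log (by positivity) ?_
      exact_mod_cast Nat.pow_log_le_self 2 (by omega)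
    have h4 := Real.log_two_gt_d9
    have h5 : (Nat.log 2 n : ℝ) * 0.6 ≤ Nat.log 2 n * Real.log 2 := by gcongr; linarith
    push_cast
    linarith
  · intro t ht S hSp
    refine card_primes_le_of_log hL100 (by rw [hQ]; positivity) ?_ h2 ht S hSp
    rw [hQ, Real.log_rpow hn0, hL]
    ring

/-- If `A(n)` is never much smaller than `π n`, few primes are missing from `A`. -/
lemma exists_card_missing_le (hpos : ∀ a ∈ A, 0 < a) (hS : MulSidon A)
    (h : ∀ᶠ n : ℕ in atTop, -((n : ℝ) / Real.log n ^ 48) ≤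
      Nat.card ↥(A ∩ Set.Icc 1 n) - Nat.primeCounting n) :
    ∃ N₀ : ℕ, ∀ M ≥ N₀, ∀ n : ℕ, ((missing A n).card : ℝ) ≤ M + 4 * (n / Real.log M ^ 48) := by
  have h1 : ∀ᶠ n : ℕ in atTop, ((missing A n).card : ℝ) ≤
      (missing A (n / 2)).card + 2 * (n / Real.log n ^ 48) := by
    filter_upwards [h, eventually_card_add_card_missing_le hpos hS, eventually_log_pow_le,
      eventually_ge_atTop 2] with n h1 h2 ⟨h3, h4⟩ hn
    have hn0 : (0 : ℝ) < n := by positivity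
    specialize h2 _ _ rfl rfl
    set Q := (n : ℝ) ^ (1 / 4 : ℝ) with hQ
    set L := Real.log n with hL
    have hL1 : 1 ≤ L := le_trans (by norm_num) h3
    have hQ0 : 0 < Q := by positivity
    have hL0 : 0 < L := by linarith
    have hpow : ∀ k : ℕ, k ≤ 1500 → L ^ k ≤ Q := fun k hk =>
      (pow_le_pow_right₀ hL1 hk).trans h4
    have hQ1 : 1 ≤ Q := by simpa using hpow 0 (by norm_num)
    have hQ4 : Q ^ 4 = n := by
      rw [hQ, ← Real.rpow_natCast, ← Real.rpow_mul hn0.le]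
      norm_num
    set α := Q ^ 2 * L ^ 10 with hα
    have hα0 : 0 ≤ α := by positivity
    have hB : ((missing A ⌊α⌋₊).card : ℝ) ≤ α :=
      (Nat.cast_le.2 (card_missing_le A _)).trans (Nat.floor_le hα0)
    have hsq : √((missing A ⌊α⌋₊).card : ℝ) ≤ Q * L ^ 5 := by
      refine (Real.sqrt_le_sqrt hB).trans (le_of_eq ?_)
      rw [hα, show Q ^ 2 * L ^ 10 = (Q * L ^ 5) ^ 2 by ring, Real.sqrt_sq (by positivity)]
    set E := (n : ℝ) / L ^ 48 with hE
    have hE' : Q ^ 3 * L ^ 16 ≤ E := by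
      rw [hE, le_div_iff₀ (by positivity), ← hQ4]
      calc Q ^ 3 * L ^ 16 * L ^ 48 = Q ^ 3 * L ^ 64 := by ring
        _ ≤ Q ^ 3 * Q := by gcongr; exact hpow 64 (by norm_num)
        _ = Q ^ 4 := by ring
    have e1 : α * √((missing A ⌊α⌋₊).card : ℝ) ≤ Q ^ 3 * L ^ 15 := by
      calc _ ≤ Q ^ 2 * L ^ 10 * (Q * L ^ 5) := by gcongr
        _ = _ := by ring
    have e2 : α ≤ Q ^ 3 * L ^ 15 := by rw [hα]; gcongr <;> first | assumption | norm_num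
    have e3 : Q ^ 3 / L ^ 3 ≤ Q ^ 3 * L ^ 15 := by
      rw [div_eq_mul_inv]
      gcongr
      exact (inv_le_one_of_one_le₀ (one_le_pow₀ hL1)).trans (one_le_pow₀ hL1)
    have e4 : 72002 * (Q ^ 3 * L ^ 15) ≤ E := by
      refine le_trans ?_ hE'
      calc 72002 * (Q ^ 3 * L ^ 15) ≤ L * (Q ^ 3 * L ^ 15) := by gcongr; linarith
        _ = _ := by ring
    linarith only [h1, h2, hB, e1, e2, e3, e4]
  obtain ⟨N, hN⟩ := eventually_atTop.1 h1
  refine ⟨max N 2, fun M hM n => ?_⟩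
  exact le_of_halving (B := fun n => ((missing A n).card : ℝ)) (le_of_max_le_right hM)
    (fun n => Nat.cast_le.2 (card_missing_le A n))
    (fun n hn => hN n ((le_of_max_le_left hM).trans hn)) n

lemma eventually_card_sub_primeCounting_le (hpos : ∀ a ∈ A, 0 < a) (hS : MulSidon A)
    (h : ∀ᶠ n : ℕ in atTop, -((n : ℝ) / Real.log n ^ 48) ≤
      Nat.card ↥(A ∩ Set.Icc 1 n) - Nat.primeCounting n) :
    ∀ᶠ n : ℕ in atTop, (Nat.card ↥(A ∩ Set.Icc 1 n) : ℝ) - Nat.primeCounting n ≤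
      73000 * ((n : ℝ) ^ (3 / 4 : ℝ) / Real.log n ^ 3) := by
  obtain ⟨N₀, hN₀⟩ := exists_card_missing_le hpos hS h
  have hM : ∀ᶠ n : ℕ in atTop, N₀ ≤ ⌊(n : ℝ) ^ (1 / 4 : ℝ)⌋₊ :=
    (tendsto_nat_floor_atTop.comp ((tendsto_rpow_atTop (by norm_num)).comp
      tendsto_natCast_atTop_atTop)).eventually_ge_atTop N₀
  filter_upwards [hM, eventually_card_add_card_missing_le hpos hS, eventually_log_pow_le,
    eventually_ge_atTop 2] with n h1 h2 ⟨h3, h4⟩ hn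
  have hn0 : (0 : ℝ) < n := by positivity
  specialize h2 _ _ rfl rfl
  have hQ3 : (n : ℝ) ^ (3 / 4 : ℝ) = ((n : ℝ) ^ (1 / 4 : ℝ)) ^ 3 := by
    rw [← Real.rpow_natCast, ← Real.rpow_mul hn0.le]
    norm_num
  have hlogQ : Real.log ((n : ℝ) ^ (1 / 4 : ℝ)) = Real.log n / 4 := by
    rw [Real.log_rpow hn0]; ring
  rw [hQ3]
  set Q := (n : ℝ) ^ (1 / 4 : ℝ) with hQ
  set L := Real.log n with hL
  have hL1 : 1 ≤ L := le_trans (by norm_num) h3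
  have hQ0 : 0 < Q := by positivity
  have hL0 : 0 < L := by linarith
  have hpow : ∀ k : ℕ, k ≤ 1500 → L ^ k ≤ Q := fun k hk =>
    (pow_le_pow_right₀ hL1 hk).trans h4
  have hQ2 : 2 ≤ Q := by
    refine le_trans ?_ (hpow 1 (by norm_num))
    linarith
  set α := Q ^ 2 * L ^ 10 with hα
  have hα0 : 0 ≤ α := by positivity
  have hlogM : L / 5 ≤ Real.log ⌊Q⌋₊ := by
    have h5 : Q / 2 ≤ ⌊Q⌋₊ := by linarith [Nat.lt_floor_add_one Q]
    have h6 := Real.log_le_log (by positivity) h5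
    rw [Real.log_div (by positivity) (by norm_num), hlogQ] at h6
    have := Real.log_two_lt_d9
    linarith
  have hB : ((missing A ⌊α⌋₊).card : ℝ) ≤ (Q * (L ^ 15)⁻¹) ^ 2 := by
    refine (hN₀ _ h1 ⌊α⌋₊).trans ?_
    have e1 : ((⌊Q⌋₊ : ℕ) : ℝ) ≤ Q ^ 2 * (L ^ 30)⁻¹ / 2 := by
      refine (Nat.floor_le hQ0.le).trans ?_
      rw [← div_eq_mul_inv, div_div, le_div_iff₀ (by positivity)]
      calc Q * (L ^ 30 * 2) ≤ Q * (L ^ 30 * L) := by gcongr; linarith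
        _ ≤ Q * Q := by gcongr; exact hpow 31 (by norm_num)
        _ = Q ^ 2 := by ring
    have e2 : 4 * ((⌊α⌋₊ : ℕ) / Real.log ⌊Q⌋₊ ^ 48) ≤ Q ^ 2 * (L ^ 30)⁻¹ / 2 := by
      have h8 : (8 : ℝ) * 5 ^ 48 ≤ L ^ 8 := by
        refine le_trans ?_ (pow_le_pow_left₀ (by norm_num) h3 8)
        norm_num
      calc 4 * ((⌊α⌋₊ : ℕ) / Real.log ⌊Q⌋₊ ^ 48) ≤ 4 * (α / (L / 5) ^ 48) := by
            gcongr
            exact Nat.floor_le hα0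
        _ = 8 * 5 ^ 48 * (Q ^ 2 * (L ^ 38)⁻¹ / 2) := by
            rw [hα]; field_simp; norm_num
        _ ≤ L ^ 8 * (Q ^ 2 * (L ^ 38)⁻¹ / 2) := by gcongr
        _ = _ := by field_simp
    calc _ ≤ Q ^ 2 * (L ^ 30)⁻¹ / 2 + Q ^ 2 * (L ^ 30)⁻¹ / 2 := add_le_add e1 e2
      _ = _ := by rw [mul_pow, inv_pow, ← pow_mul]; ring
  have hsq : √((missing A ⌊α⌋₊).card : ℝ) ≤ Q * (L ^ 15)⁻¹ :=
    (Real.sqrt_le_sqrt hB).trans (Real.sqrt_sq (by positivity)).le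
  set E := Q ^ 3 / L ^ 3 with hE
  have e1 : α * √((missing A ⌊α⌋₊).card : ℝ) ≤ E := by
    calc _ ≤ Q ^ 2 * L ^ 10 * (Q * (L ^ 15)⁻¹) := by gcongr
      _ = Q ^ 3 / L ^ 5 := by field_simp
      _ ≤ E := by rw [hE]; gcongr <;> first | assumption | norm_num
  have e2 : ((missing A ⌊α⌋₊).card : ℝ) ≤ E := by
    refine hB.trans ?_
    rw [mul_pow, inv_pow, ← pow_mul, ← div_eq_mul_inv, hE]
    gcongr <;> first | assumption | linarith
  have e3 : ((missing A (n / 2)).card : ℝ) ≤ (missing A n).card :=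
    Nat.cast_le.2 (card_missing_mono A (Nat.div_le_self n 2))
  have hE0 : 0 ≤ E := by positivity
  linarith only [h2, e1, e2, e3, hE0]

end MulSidon

theorem stmt_0 (A : Set ℕ) (hpos : ∀ a ∈ A, 0 < a) (hinf : A.Infinite) (hS : MulSidon A)
    (h : ((73643 : ℝ) : EReal) ≤ Filter.limsup (fun n : ℕ =>
        ((((Nat.card ↥(A ∩ Set.Icc 1 n) : ℝ) - (Nat.primeCounting n : ℝ)) /
          ((n : ℝ) ^ ((3 : ℝ) / 4) / (Real.log n) ^ 3) : ℝ) : EReal)) atTop) :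
    Filter.liminf (fun n : ℕ =>
        ((((Nat.card ↥(A ∩ Set.Icc 1 n) : ℝ) - (Nat.primeCounting n : ℝ)) /
          ((n : ℝ) / (Real.log n) ^ 48) : ℝ) : EReal)) atTop < (0 : EReal) := by
  by_contra! hlim
  have h1 : ∀ᶠ n : ℕ in atTop, -((n : ℝ) / Real.log n ^ 48) ≤
      Nat.card ↥(A ∩ Set.Icc 1 n) - Nat.primeCounting n := by
    have h0 : ((-1 : ℝ) : EReal) < 0 := by exact_mod_cast neg_one_lt_zero
    filter_upwards [eventually_lt_of_lt_liminf (h0.trans_le hlim), eventually_ge_atTop 2]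
      with n hn hn2
    have hlog : 0 < Real.log n := Real.log_pos (by exact_mod_cast hn2)
    have hpos : 0 < (n : ℝ) / Real.log n ^ 48 := by positivity
    have := (lt_div_iff₀ hpos).1 (EReal.coe_lt_coe_iff.1 hn)
    linarith
  have h2 : limsup (fun n : ℕ =>
        ((((Nat.card ↥(A ∩ Set.Icc 1 n) : ℝ) - (Nat.primeCounting n : ℝ)) /
          ((n : ℝ) ^ ((3 : ℝ) / 4) / (Real.log n) ^ 3) : ℝ) : EReal)) atTop ≤
      ((73000 : ℝ) : EReal) := by
    refine limsup_le_of_le (h := ?_)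
    filter_upwards [MulSidon.eventually_card_sub_primeCounting_le hpos hS h1,
      eventually_ge_atTop 2] with n hn hn2
    have hlog : 0 < Real.log n := Real.log_pos (by exact_mod_cast hn2)
    have hpos : 0 < (n : ℝ) ^ ((3 : ℝ) / 4) / Real.log n ^ 3 := by positivity
    exact EReal.coe_le_coe_iff.2 ((div_le_iff₀ hpos).2 hn)
  have h3 := EReal.coe_le_coe_iff.1 (h.trans h2)
  norm_num at h3
end

section
/- Let A be an infinite multiplicative Sidon set of positive integers. Then liminf_{n→∞} (|A(n)| − π(n)) / (n^{3/4}/(log n)^3) < 73643. -/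
open Filter

open Finset in
/-- Two elements sharing the factor `u` determine a pair of cofactors, and a multiplicative Sidon
set sees every pair of cofactors at most once. -/
lemma MulSidon.exists_fiber_bound {A : Set ℕ} (hA : MulSidon A) {S U V : Finset ℕ}
    (hSA : ∀ m ∈ S, m ∈ A) (h : ∀ m ∈ S, ∃ u ∈ U, ∃ v ∈ V, u * v = m) :
    ∃ d : ℕ → ℕ, ∑ u ∈ U, d u = #S ∧ ∑ u ∈ U, (d u * d u - d u) ≤ #V * #V := by
  choose! f hfU g hgV hfg using h
  refine ⟨fun u => #{m ∈ S | f m = u}, (card_eq_sum_card_fiberwise hfU).symm, ?_⟩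
  simp_rw [← offDiag_card]
  have hdisj : (U : Set ℕ).PairwiseDisjoint fun u => {m ∈ S | f m = u}.offDiag := by
    intro u _ u' _ huu'
    rw [Function.onFun, Finset.disjoint_left]
    rintro ⟨x, y⟩ h1 h2
    simp only [mem_offDiag, mem_filter] at h1 h2
    exact huu' (h1.1.2.symm.trans h2.1.2)
  rw [← card_biUnion hdisj, ← card_product]
  refine card_le_card_of_injOn (fun q => (g q.1, g q.2)) ?_ ?_
  · rintro ⟨x, y⟩ hq
    simp only [coe_biUnion, Set.mem_iUnion, mem_coe, mem_offDiag, mem_filter] at hq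
    obtain ⟨u, _, ⟨hx, _⟩, ⟨hy, _⟩, _⟩ := hq
    exact mem_coe.2 (mem_product.2 ⟨hgV x hx, hgV y hy⟩)
  · rintro ⟨x, y⟩ hq ⟨x', y'⟩ hq' he
    simp only [coe_biUnion, Set.mem_iUnion, mem_coe, mem_offDiag, mem_filter] at hq hq'
    obtain ⟨u, _, ⟨hx, hxu⟩, ⟨hy, hyu⟩, hxy⟩ := hq
    obtain ⟨u', _, ⟨hx', hxu'⟩, ⟨hy', hyu'⟩, _⟩ := hq'
    simp only [Prod.mk.injEq] at he ⊢
    have key : x * y' = y * x' := by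
      rw [← hfg x hx, ← hfg y hy, ← hfg x' hx', ← hfg y' hy', hxu, hyu, hxu', hyu', he.1, he.2]
      ring
    rcases hA x (hSA x hx) y' (hSA y' hy') y (hSA y hy) x' (hSA x' hx') key with h | h
    · exact absurd h.1 hxy
    · exact ⟨h.1, h.2.symm⟩

open Finset in
lemma MulSidon.card_le_add_sq_s1 {A : Set ℕ} (hA : MulSidon A) {S U V : Finset ℕ}
    (hSA : ∀ m ∈ S, m ∈ A) (h : ∀ m ∈ S, ∃ u ∈ U, ∃ v ∈ V, u * v = m) :
    #S ≤ #U + #V * #V := by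
  obtain ⟨d, hd, hd2⟩ := hA.exists_fiber_bound hSA h
  rw [← hd, card_eq_sum_ones]
  refine le_trans ?_ (Nat.add_le_add_left hd2 _)
  rw [← sum_add_distrib]
  refine sum_le_sum fun u _ => ?_
  rcases Nat.lt_or_ge (d u) 2 with h1 | h1
  · omega
  · have : 2 * d u ≤ d u * d u := Nat.mul_le_mul_right _ h1
    omega

open Finset in
lemma MulSidon.card_le_add_mul_sqrt {A : Set ℕ} (hA : MulSidon A) {S U V : Finset ℕ}
    (hSA : ∀ m ∈ S, m ∈ A) (h : ∀ m ∈ S, ∃ u ∈ U, ∃ v ∈ V, u * v = m) :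
    (#S : ℝ) ≤ #U + #V * √(#U : ℝ) := by
  obtain ⟨d, hd, hd2⟩ := hA.exists_fiber_bound hSA h
  have h1 : ((∑ u ∈ U, (d u : ℝ)) ^ 2) ≤ #U * ∑ u ∈ U, (d u : ℝ) ^ 2 :=
    sq_sum_le_card_mul_sum_sq
  have h2 : ∑ u ∈ U, (d u : ℝ) ^ 2 ≤ (#V : ℝ) ^ 2 + #S := by
    have : ∑ u ∈ U, (d u * d u) ≤ #V * #V + #S := by
      rw [← hd]
      refine le_trans ?_ (Nat.add_le_add_right hd2 _)
      rw [← sum_add_distrib]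
      exact sum_le_sum fun u _ => by omega
    have h3 : ((∑ u ∈ U, (d u * d u) : ℕ) : ℝ) ≤ ((#V * #V + #S : ℕ) : ℝ) := by
      exact_mod_cast this
    push_cast at h3
    simpa only [sq] using h3
  have h4 : (∑ u ∈ U, (d u : ℝ)) = #S := by exact_mod_cast hd
  rw [h4] at h1
  have hU : (0 : ℝ) ≤ #U := Nat.cast_nonneg _
  have hV : (0 : ℝ) ≤ #V := Nat.cast_nonneg _
  set s := √(#U : ℝ) with hs
  have hs0 : 0 ≤ s := Real.sqrt_nonneg _
  have hs2 : s ^ 2 = #U := Real.sq_sqrt hU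
  have h5 : (#S : ℝ) ^ 2 ≤ #U * ((#V : ℝ) ^ 2 + #S) :=
    h1.trans (mul_le_mul_of_nonneg_left h2 hU)
  by_contra! hc
  have hVs : 0 ≤ (#V : ℝ) * s := mul_nonneg hV hs0
  nlinarith [mul_nonneg hU hVs, mul_self_nonneg ((#V : ℝ) * s)]

/-- A divisor chain with small prime steps cannot jump over a long interval. -/
lemma exists_dvd_mem_Ico {m d X Y : ℕ} (hm : m ≠ 0) (hdm : d ∣ m) (hdX : d < X) (hXm : X ≤ m)
    (hq : ∀ q, q.Prime → q ∣ m / d → q * X ≤ Y) : ∃ e, e ∣ m ∧ X ≤ e ∧ e < Y := by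
  classical
  have hex : ∃ e, (d ∣ e ∧ e ∣ m) ∧ X ≤ e := ⟨m, ⟨hdm, dvd_rfl⟩, hXm⟩
  obtain ⟨⟨hde, hem⟩, hXe⟩ := Nat.find_spec hex
  have hmin := fun e' => Nat.find_min (m := e') hex
  set e := Nat.find hex
  refine ⟨e, hem, hXe, ?_⟩
  obtain ⟨c, hc⟩ := hde
  have he0 : 0 < e := Nat.pos_of_dvd_of_pos hem (Nat.pos_of_ne_zero hm)
  have hd0 : 0 < d := Nat.pos_of_dvd_of_pos hdm (Nat.pos_of_ne_zero hm)
  have hc1 : c ≠ 1 := by rintro rfl; omega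
  obtain ⟨q, hqp, hqc⟩ := Nat.exists_prime_and_dvd hc1
  obtain ⟨b, rfl⟩ := hqc
  have hqm : q ∣ m / d := by
    obtain ⟨z, hz⟩ := hem
    refine ⟨b * z, ?_⟩
    rw [hz, hc]
    rw [Nat.div_eq_iff_eq_mul_left hd0 ⟨q * b * z, by ring⟩]
    ring
  have hlt : d * b < e := by
    have hb : 0 < d * b := by
      rcases Nat.eq_zero_or_pos (d * b) with h | h
      · have : e = q * (d * b) := by rw [hc]; ring
        rw [h] at this; omega
      · exact h
    calc d * b < q * (d * b) := by nlinarith [hqp.two_le]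
      _ = e := by rw [hc]; ring
  have hX : d * b < X := by
    by_contra! hcon
    refine hmin _ hlt ⟨⟨⟨b, rfl⟩, ?_⟩, hcon⟩
    exact dvd_trans ⟨q, by rw [hc]; ring⟩ hem
  calc e = q * (d * b) := by rw [hc]; ring
    _ < q * X := Nat.mul_lt_mul_of_pos_left hX hqp.pos
    _ ≤ Y := hq q hqp hqm

/-- The primes in the dyadic interval `[2 ^ a, 2 ^ (a + 1))`. -/
def dyadicPrimes (a : ℕ) : Finset ℕ := (Finset.Ico (2 ^ a) (2 ^ (a + 1))).filter Nat.Prime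

lemma mem_dyadicPrimes_log {p : ℕ} (hp : p.Prime) : p ∈ dyadicPrimes (Nat.log 2 p) := by
  simp only [dyadicPrimes, Finset.mem_filter, Finset.mem_Ico]
  exact ⟨⟨Nat.pow_log_le_self 2 hp.ne_zero, Nat.lt_pow_succ_log_self one_lt_two p⟩, hp⟩

lemma prime_and_lt_of_mem_dyadicPrimes {a p : ℕ} (ha : 2 ≤ a) (hp : p ∈ dyadicPrimes a) :
    p.Prime ∧ 2 ^ a < p ∧ p < 2 ^ (a + 1) := by
  simp only [dyadicPrimes, Finset.mem_filter, Finset.mem_Ico] at hp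
  refine ⟨hp.2, lt_of_le_of_ne hp.1.1 ?_, hp.1.2⟩
  rintro rfl
  exact Nat.Prime.not_prime_pow ha hp.2

lemma mul_card_dyadicPrimes_le {a : ℕ} (ha : 2 ≤ a) :
    a * (dyadicPrimes a).card ≤ 2 ^ (a + 1) := by
  have hlt := fun p (hp : p ∈ dyadicPrimes a) => prime_and_lt_of_mem_dyadicPrimes ha hp
  have hdvd : ∏ p ∈ dyadicPrimes a, p ∣ (2 ^ a).centralBinom := by
    refine Finset.prod_primes_dvd _ (fun p hp => (hlt p hp).1.prime) fun p hp => ?_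
    obtain ⟨h1, h2, h3⟩ := hlt p hp
    have h4 : p ∣ (2 * 2 ^ a).factorial := (h1.dvd_factorial).2 (by rw [pow_succ] at h3; omega)
    have h5 : ¬ p ∣ (2 ^ a).factorial := fun h => by
      have := (h1.dvd_factorial).1 h
      omega
    have h6 := Nat.choose_mul_factorial_mul_factorial (n := 2 * 2 ^ a) (k := 2 ^ a) (by omega)
    rw [← h6, show 2 * 2 ^ a - 2 ^ a = 2 ^ a by omega] at h4
    rw [Nat.centralBinom]
    rcases h1.dvd_mul.1 h4 with h | h
    · rcases h1.dvd_mul.1 h with h | h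
      · exact h
      · exact absurd h h5
    · exact absurd h h5
  have h1 : (2 ^ a) ^ (dyadicPrimes a).card ≤ 2 ^ (2 ^ (a + 1)) :=
    calc (2 ^ a) ^ (dyadicPrimes a).card ≤ ∏ p ∈ dyadicPrimes a, p :=
          Finset.pow_card_le_prod _ _ _ fun p hp => (hlt p hp).2.1.le
      _ ≤ (2 ^ a).centralBinom := Nat.le_of_dvd (Nat.centralBinom_pos _) hdvd
      _ ≤ 2 ^ (2 * 2 ^ a) := by
          rw [Nat.centralBinom]; exact Nat.choose_le_two_pow _ _
      _ = 2 ^ (2 ^ (a + 1)) := by rw [pow_succ' 2 a]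
  rw [← pow_mul] at h1
  exact (Nat.pow_le_pow_iff_right one_lt_two).1 h1

open Classical in
/-- The elements of `A` in `[1, n]`. -/
noncomputable def initialPart (A : Set ℕ) (n : ℕ) : Finset ℕ :=
  (Finset.Icc 1 n).filter (· ∈ A)

lemma mem_initialPart {A : Set ℕ} {n m : ℕ} : m ∈ initialPart A n ↔ (1 ≤ m ∧ m ≤ n) ∧ m ∈ A := by
  simp [initialPart]

open Classical in
/-- The primes up to `T ^ 6` having a multiple `p * c` in `A` with a small cofactor `c`. -/
noncomputable def primesWithMultiple (A : Set ℕ) (T : ℕ) : Finset ℕ :=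
  (Finset.Icc 1 (T ^ 6)).filter fun p => p.Prime ∧ ∃ c, (1 ≤ c ∧ c ≤ T ^ 2) ∧ p * c ∈ A

lemma mem_primesWithMultiple {A : Set ℕ} {T p : ℕ} : p ∈ primesWithMultiple A T ↔
    p ≤ T ^ 6 ∧ p.Prime ∧ ∃ c, (1 ≤ c ∧ c ≤ T ^ 2) ∧ p * c ∈ A := by
  simp only [primesWithMultiple, Finset.mem_filter, Finset.mem_Icc]
  exact ⟨fun h => ⟨h.1.2, h.2⟩, fun h => ⟨⟨h.2.1.one_le, h.1⟩, h.2⟩⟩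

lemma card_filter_prime_Icc (n : ℕ) :
    ((Finset.Icc 1 n).filter Nat.Prime).card = Nat.primeCounting n := by
  rw [Nat.primeCounting, Nat.primeCounting', Nat.count_eq_card_filter_range]
  congr 1
  ext p
  simp only [Finset.mem_filter, Finset.mem_Icc, Finset.mem_range]
  exact ⟨fun h => ⟨by omega, h.2⟩, fun h => ⟨⟨h.2.one_le, by omega⟩, h.2⟩⟩

/-- Erdős's factorisation: `m ≤ T ^ 6` has a large prime factor or splits in a balanced way. -/
lemma exists_prime_mul_or_balanced {T m : ℕ} (hT : 1 ≤ T) (hm : 1 ≤ m) (hmT : m ≤ T ^ 6) :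
    (∃ q c, q.Prime ∧ (1 ≤ c ∧ c ≤ T ^ 2) ∧ q * c = m) ∨
      ∃ u v, (1 ≤ u ∧ u ≤ T ^ 4) ∧ (1 ≤ v ∧ v ≤ T ^ 3) ∧ u * v = m := by
  classical
  have h24 : T ^ 2 ≤ T ^ 4 := Nat.pow_le_pow_right hT (by norm_num)
  rcases Nat.lt_or_ge m (T ^ 2) with h2 | h2
  · exact Or.inr ⟨m, 1, ⟨hm, by omega⟩, ⟨le_rfl, Nat.one_le_pow _ _ hT⟩, mul_one m⟩
  have hex : ∃ e, e ∣ m ∧ T ^ 2 ≤ e := ⟨m, dvd_rfl, h2⟩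
  obtain ⟨hem, hTe⟩ := Nat.find_spec hex
  have hmin := fun e' => Nat.find_min (m := e') hex
  set e := Nat.find hex
  have he0 : 0 < e := Nat.pos_of_dvd_of_pos hem hm
  obtain ⟨v, hv⟩ := hem
  have hv0 : 1 ≤ v := by
    rcases Nat.eq_zero_or_pos v with h | h
    · rw [h] at hv; omega
    · exact h
  have hT2 : 0 < T ^ 2 := by positivity
  have hT3 : 0 < T ^ 3 := by positivity
  have hT4 : 0 < T ^ 4 := by positivity
  rcases Nat.le_total e (T ^ 3) with h3 | h3
  · refine Or.inr ⟨v, e, ⟨hv0, ?_⟩, ⟨he0, h3⟩, by rw [hv]; ring⟩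
    refine Nat.le_of_mul_le_mul_left ?_ hT2
    calc T ^ 2 * v ≤ e * v := Nat.mul_le_mul_right _ hTe
      _ ≤ T ^ 6 := by omega
      _ = T ^ 2 * T ^ 4 := by ring
  rcases Nat.lt_or_ge (T ^ 4) e with h4 | h4
  swap
  · refine Or.inr ⟨e, v, ⟨he0, h4⟩, ⟨hv0, ?_⟩, hv.symm⟩
    refine Nat.le_of_mul_le_mul_left ?_ hT3
    calc T ^ 3 * v ≤ e * v := Nat.mul_le_mul_right _ h3
      _ ≤ T ^ 6 := by omega
      _ = T ^ 3 * T ^ 3 := by ring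
  have hve : v ≤ T ^ 2 := by
    refine Nat.le_of_mul_le_mul_left ?_ hT4
    calc T ^ 4 * v ≤ e * v := Nat.mul_le_mul_right _ h4.le
      _ ≤ T ^ 6 := by omega
      _ = T ^ 4 * T ^ 2 := by ring
  have he1 : e ≠ 1 := by omega
  obtain ⟨q, hq, b, hb⟩ := Nat.exists_prime_and_dvd he1
  have hb0 : 0 < b := by
    rcases Nat.eq_zero_or_pos b with h | h
    · rw [h] at hb; omega
    · exact h
  have hbe : b < e := by rw [hb]; nlinarith [hq.two_le]
  have hbT : b < T ^ 2 := by
    by_contra! hcon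
    exact hmin b hbe ⟨⟨q * v, by rw [hv, hb]; ring⟩, hcon⟩
  have hqT : T ^ 2 ≤ q := by
    by_contra! hcon
    have : e < T ^ 2 * T ^ 2 := by
      rw [hb]; exact Nat.mul_lt_mul_of_lt_of_le hcon hbT.le hT2
    rw [show T ^ 2 * T ^ 2 = T ^ 4 by ring] at this
    omega
  have hqe : q = e := by
    refine le_antisymm (Nat.le_of_dvd he0 ⟨b, hb⟩) ?_
    by_contra! hcon
    exact hmin q hcon ⟨⟨b * v, by rw [hv, hb]; ring⟩, hqT⟩
  exact Or.inl ⟨q, v, hq, ⟨hv0, hve⟩, by rw [hqe, hv]⟩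

open Finset in
lemma MulSidon.card_initialPart_le {A : Set ℕ} (hA : MulSidon A) {T : ℕ} (hT : 1 ≤ T) :
    #(initialPart A (T ^ 6)) ≤ #(primesWithMultiple A T) + 3 * T ^ 5 := by
  classical
  set S := initialPart A (T ^ 6)
  set S₁ := {m ∈ S | ∃ q c, q.Prime ∧ (1 ≤ c ∧ c ≤ T ^ 2) ∧ q * c = m}
  set S₂ := {m ∈ S | ¬ ∃ q c, q.Prime ∧ (1 ≤ c ∧ c ≤ T ^ 2) ∧ q * c = m}
  have hS : #S₁ + #S₂ = #S := card_filter_add_card_filter_not _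
  have h1 : #S₁ ≤ #(primesWithMultiple A T) + T ^ 2 * T ^ 2 := by
    have := hA.card_le_add_sq_s1 (S := S₁) (U := primesWithMultiple A T) (V := Icc 1 (T ^ 2))
      (fun m hm => (mem_initialPart.1 (mem_filter.1 hm).1).2) ?_
    · simpa using this
    · intro m hm
      obtain ⟨hmS, q, c, hq, hc, rfl⟩ := mem_filter.1 hm
      have hmS := mem_initialPart.1 hmS
      refine ⟨q, mem_primesWithMultiple.2 ⟨?_, hq, c, hc, hmS.2⟩, c, mem_Icc.2 hc, rfl⟩
      exact (Nat.le_mul_of_pos_right q hc.1).trans hmS.1.2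
  have h2 : (#S₂ : ℝ) ≤ T ^ 4 + T ^ 3 * T ^ 2 := by
    have := hA.card_le_add_mul_sqrt (S := S₂) (U := Icc 1 (T ^ 4)) (V := Icc 1 (T ^ 3))
      (fun m hm => (mem_initialPart.1 (mem_filter.1 hm).1).2) ?_
    · have h4 : √((T : ℝ) ^ 4) = T ^ 2 := by
        rw [show (T : ℝ) ^ 4 = (T ^ 2) ^ 2 by ring]
        exact Real.sqrt_sq (by positivity)
      simpa [h4] using this
    · intro m hm
      obtain ⟨hmS, hn⟩ := mem_filter.1 hm
      have hmS := mem_initialPart.1 hmS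
      obtain ⟨u, v, hu, hv, h⟩ :=
        (exists_prime_mul_or_balanced hT hmS.1.1 hmS.1.2).resolve_left hn
      exact ⟨u, mem_Icc.2 hu, v, mem_Icc.2 hv, h⟩
  have h2' : #S₂ ≤ T ^ 4 + T ^ 3 * T ^ 2 := by exact_mod_cast h2
  have h45 : T ^ 4 ≤ T ^ 5 := Nat.pow_le_pow_right hT (by norm_num)
  rw [show T ^ 2 * T ^ 2 = T ^ 4 by ring] at h1
  rw [show T ^ 3 * T ^ 2 = T ^ 5 by ring] at h2'
  omega

open Finset in
/-- The elements of `A` of the form `p * w` with `p` prime and `p, w ≤ T ^ 6` are few. -/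
lemma MulSidon.card_prime_mul_le {A : Set ℕ} (hA : MulSidon A) {T : ℕ} (hT : 1 ≤ T)
    (hAT : Nat.primeCounting (T ^ 6) ≤ #(initialPart A (T ^ 6))) {S : Finset ℕ}
    (hSA : ∀ m ∈ S, m ∈ A)
    (h : ∀ m ∈ S, ∃ p w, p.Prime ∧ p ≤ T ^ 6 ∧ (1 ≤ w ∧ w ≤ T ^ 6) ∧ p * w = m) :
    #S ≤ 6 * T ^ 8 := by
  classical
  choose! p w hp hpT hw hpw using h
  set D := primesWithMultiple A T
  set Q := {p ∈ (Icc 1 (T ^ 6)).filter Nat.Prime | p ∉ D}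
  have hQ : #Q ≤ 3 * T ^ 5 := by
    have h1 : #{p ∈ (Icc 1 (T ^ 6)).filter Nat.Prime | p ∈ D} + #Q
        = Nat.primeCounting (T ^ 6) := by
      rw [card_filter_add_card_filter_not, card_filter_prime_Icc]
    have h2 : D ⊆ {p ∈ (Icc 1 (T ^ 6)).filter Nat.Prime | p ∈ D} := by
      intro q hq
      have := mem_primesWithMultiple.1 hq
      simp only [mem_filter, mem_Icc]
      exact ⟨⟨⟨this.2.1.one_le, this.1⟩, this.2.1⟩, hq⟩
    have h3 := card_le_card h2
    have h4 : _ ≤ #D + 3 * T ^ 5 := hA.card_initialPart_le hT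
    omega
  have hcD : ∀ q ∈ D, ∃ c, (1 ≤ c ∧ c ≤ T ^ 2) ∧ q * c ∈ A :=
    fun q hq => (mem_primesWithMultiple.1 hq).2.2
  choose! c hc hcA using hcD
  set S₁ := {m ∈ S | p m ∉ D}
  set S₂ := {m ∈ {m ∈ S | p m ∈ D} | w m = c (p m)}
  set S₃ := {m ∈ {m ∈ S | p m ∈ D} | ¬ w m = c (p m)}
  have hS : #S₂ + #S₃ + #S₁ = #S := by
    rw [card_filter_add_card_filter_not, card_filter_add_card_filter_not]
  have h1 : (#S₁ : ℝ) ≤ T ^ 6 + (3 * T ^ 5) * T ^ 3 := by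
    have := hA.card_le_add_mul_sqrt (S := S₁) (U := Icc 1 (T ^ 6)) (V := Q)
      (fun m hm => hSA m (mem_filter.1 hm).1) ?_
    · have h4 : √((T : ℝ) ^ 6) = T ^ 3 := by
        rw [show (T : ℝ) ^ 6 = (T ^ 3) ^ 2 by ring]
        exact Real.sqrt_sq (by positivity)
      simp only [Nat.card_Icc, Nat.add_sub_cancel, Nat.cast_pow, h4] at this
      have hQ' : (#Q : ℝ) ≤ 3 * T ^ 5 := by exact_mod_cast hQ
      exact this.trans (by gcongr)
    · intro m hm
      obtain ⟨hmS, hn⟩ := mem_filter.1 hm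
      refine ⟨w m, mem_Icc.2 (hw m hmS), p m, ?_, by rw [mul_comm, hpw m hmS]⟩
      simp only [Q, mem_filter, mem_Icc]
      exact ⟨⟨⟨(hp m hmS).one_le, hpT m hmS⟩, hp m hmS⟩, hn⟩
  have h1' : #S₁ ≤ T ^ 6 + (3 * T ^ 5) * T ^ 3 := by exact_mod_cast h1
  have h2 : #S₂ ≤ T ^ 6 := by
    have : #S₂ ≤ #(Icc 1 (T ^ 6)) := by
      refine card_le_card_of_injOn p ?_ ?_
      · intro m hm
        have hmS := (mem_filter.1 (mem_filter.1 (mem_coe.1 hm)).1).1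
        exact mem_coe.2 (mem_Icc.2 ⟨(hp m hmS).one_le, hpT m hmS⟩)
      · intro m hm m' hm' he
        obtain ⟨hm1, hm2⟩ := mem_filter.1 (mem_coe.1 hm)
        obtain ⟨hm1', hm2'⟩ := mem_filter.1 (mem_coe.1 hm')
        rw [← hpw m (mem_filter.1 hm1).1, ← hpw m' (mem_filter.1 hm1').1, hm2, hm2', he]
    simpa using this
  have h3 : #S₃ ≤ T ^ 2 * T ^ 6 := by
    have : #S₃ ≤ #(Icc 1 (T ^ 2) ×ˢ Icc 1 (T ^ 6)) := by
      refine card_le_card_of_injOn (fun m => (c (p m), w m)) ?_ ?_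
      · intro m hm
        obtain ⟨hmS, hmD⟩ := mem_filter.1 (mem_filter.1 (mem_coe.1 hm)).1
        exact mem_coe.2 (mem_product.2 ⟨mem_Icc.2 (hc _ hmD), mem_Icc.2 (hw m hmS)⟩)
      · intro m hm m' hm' he
        obtain ⟨hm1, hm2⟩ := mem_filter.1 (mem_coe.1 hm)
        obtain ⟨hm1', -⟩ := mem_filter.1 (mem_coe.1 hm')
        obtain ⟨hmS, hmD⟩ := mem_filter.1 hm1
        obtain ⟨hmS', hmD'⟩ := mem_filter.1 hm1'
        simp only [Prod.mk.injEq] at he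
        have key : (p m * c (p m)) * m' = (p m' * c (p m')) * m := by
          have e1 := hpw m hmS
          have e2 := hpw m' hmS'
          rw [← he.2] at e2
          rw [← he.1]
          calc p m * c (p m) * m' = p m * c (p m) * (p m' * w m) := by rw [e2]
            _ = p m' * c (p m) * (p m * w m) := by ring
            _ = p m' * c (p m) * m := by rw [e1]
        rcases hA _ (hcA _ hmD) _ (hSA _ hmS') _ (hcA _ hmD') _ (hSA _ hmS) key with h | h
        · exact h.2.symm
        · exfalso
          have h5 := h.1.trans (hpw m hmS).symm
          exact hm2 (Nat.eq_of_mul_eq_mul_left (hp m hmS).pos h5).symm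
    simpa using this
  have h68 : T ^ 6 ≤ T ^ 8 := Nat.pow_le_pow_right hT (by norm_num)
  rw [show T ^ 2 * T ^ 6 = T ^ 8 by ring] at h3
  rw [show 3 * T ^ 5 * T ^ 3 = 3 * T ^ 8 by ring] at h1'
  omega

lemma exists_max_prime_mul {m : ℕ} (hm : 2 ≤ m) :
    ∃ p c, p.Prime ∧ 1 ≤ c ∧ p * c = m ∧ ∀ q, q.Prime → q ∣ m → q ≤ p := by
  have hne : m.primeFactors.Nonempty := Nat.nonempty_primeFactors.2 hm
  have h1 := Finset.max'_mem _ hne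
  set p := m.primeFactors.max' hne
  obtain ⟨hp, ⟨c, hc⟩, hm0⟩ := Nat.mem_primeFactors.1 h1
  refine ⟨p, c, hp, ?_, hc.symm, fun q hq hqm =>
    Finset.le_max' _ _ (Nat.mem_primeFactors.2 ⟨hq, hqm, hm0⟩)⟩
  rcases Nat.eq_zero_or_pos c with h | h
  · rw [h] at hc; omega
  · exact h

/-- Shapes of the integers up to `z ^ 120`, according to their largest prime factors. -/
lemma factorization_cases {z m : ℕ} (hz : 2 ≤ z) (hmz : m ≤ z ^ 120) :
    m < z ^ 84 ∨ (∃ u v, u * v = m ∧ z ^ 66 ≤ u ∧ u < z ^ 84) ∨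
    (∃ p c, p.Prime ∧ (1 ≤ c ∧ c ≤ z ^ 36) ∧ p * c = m) ∨
    (∃ p w, p.Prime ∧ p ≤ z ^ 66 ∧ (1 ≤ w ∧ w ≤ z ^ 66) ∧ p * w = m) ∨
    (∃ u v, (1 ≤ u ∧ u ≤ z ^ 66) ∧ (1 ≤ v ∧ v ≤ z ^ 42) ∧ u * v = m) ∨
    (∃ p₁ p₂ p₃ p₄ w, (p₁.Prime ∧ p₂.Prime ∧ p₃.Prime ∧ p₄.Prime) ∧
      (z ^ 18 ≤ p₄ ∧ p₄ ≤ p₃ ∧ p₃ ≤ p₂ ∧ p₂ ≤ p₁) ∧ 1 ≤ w ∧ p₁ * p₂ * w * (p₃ * p₄) = m) := by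
  rcases Nat.lt_or_ge m (z ^ 84) with h0 | h0
  · exact Or.inl h0
  refine Or.inr ?_
  by_cases hg : ∃ u v, u * v = m ∧ z ^ 66 ≤ u ∧ u < z ^ 84
  · exact Or.inl hg
  refine Or.inr ?_
  have hng : ∀ e, e ∣ m → z ^ 66 ≤ e → z ^ 84 ≤ e := by
    rintro e ⟨v, hv⟩ he
    by_contra! hcon
    exact hg ⟨e, v, hv.symm, he, hcon⟩
  have hz1 : 1 < z := by omega
  have hpos : ∀ i, 0 < z ^ i := fun i => by positivity
  have hlt : ∀ {i j : ℕ}, i < j → z ^ i < z ^ j := fun h => Nat.pow_lt_pow_right hz1 h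
  have hm0 : m ≠ 0 := by have := hpos 84; omega
  have hm2 : 2 ≤ m := by
    have := hlt (show 0 < 84 by norm_num)
    rw [pow_zero] at this
    omega
  obtain ⟨p₁, c₁, hp₁, hc₁, hm₁, hmax₁⟩ := exists_max_prime_mul hm2
  rcases Nat.lt_or_ge p₁ (z ^ 84) with h1 | h1
  swap
  · refine Or.inl ⟨p₁, c₁, hp₁, ⟨hc₁, ?_⟩, hm₁⟩
    refine Nat.le_of_mul_le_mul_left ?_ (hpos 84)
    calc z ^ 84 * c₁ ≤ p₁ * c₁ := Nat.mul_le_mul_right _ h1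
      _ ≤ z ^ 84 * z ^ 36 := by rw [hm₁, ← pow_add]; exact hmz
  refine Or.inr ?_
  have h1' : p₁ < z ^ 66 := by
    by_contra! hcon
    have := hng p₁ ⟨c₁, hm₁.symm⟩ hcon
    omega
  rcases Nat.lt_or_ge p₁ (z ^ 42) with h2 | h2
  swap
  · refine Or.inl ⟨p₁, c₁, hp₁, h1'.le, ⟨hc₁, ?_⟩, hm₁⟩
    by_contra! hcon
    have h3 := hng c₁ ⟨p₁, by rw [← hm₁]; ring⟩ hcon.le
    have h4 : z ^ 42 * z ^ 84 ≤ p₁ * c₁ := Nat.mul_le_mul h2 h3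
    rw [hm₁, ← pow_add] at h4
    have := hlt (show 120 < 42 + 84 by norm_num)
    omega
  refine Or.inr ?_
  have hc₁2 : 2 ≤ c₁ := by
    by_contra! hcon
    have : c₁ = 1 := by omega
    rw [this, mul_one] at hm₁
    have := hlt (show 42 < 84 by norm_num)
    omega
  obtain ⟨p₂, c₂, hp₂, hc₂, hm₂, hmax₂⟩ := exists_max_prime_mul hc₁2
  have hp21 : p₂ ≤ p₁ := hmax₁ p₂ hp₂ ⟨c₂ * p₁, by rw [← hm₁, ← hm₂]; ring⟩
  have hm₂' : p₁ * p₂ * c₂ = m := by rw [← hm₁, ← hm₂]; ring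
  have hpp : p₁ * p₂ < z ^ 66 := by
    by_contra! hcon
    have h3 := hng (p₁ * p₂) ⟨c₂, hm₂'.symm⟩ hcon
    have h4 : p₁ * p₂ < z ^ 42 * z ^ 42 :=
      Nat.mul_lt_mul_of_lt_of_le h2 (hp21.trans h2.le) (hpos 42)
    rw [show z ^ 42 * z ^ 42 = z ^ 84 by ring] at h4
    omega
  have hpp0 : 0 < p₁ * p₂ := Nat.mul_pos hp₁.pos hp₂.pos
  have hc₂2 : 2 ≤ c₂ := by
    by_contra! hcon
    have : c₂ = 1 := by omega
    rw [this, mul_one] at hm₂'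
    have := hlt (show 66 < 84 by norm_num)
    omega
  obtain ⟨p₃, c₃, hp₃, hc₃, hm₃, hmax₃⟩ := exists_max_prime_mul hc₂2
  have hp32 : p₃ ≤ p₂ := hmax₂ p₃ hp₃ ⟨c₃ * p₂, by rw [← hm₂, ← hm₃]; ring⟩
  have hstep : ∀ q, q < z ^ 18 → q * z ^ 66 ≤ z ^ 84 := fun q hq => by
    calc q * z ^ 66 ≤ z ^ 18 * z ^ 66 := Nat.mul_le_mul_right _ hq.le
      _ = z ^ 84 := by rw [← pow_add]
  rcases Nat.lt_or_ge p₃ (z ^ 18) with h3 | h3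
  · exfalso
    obtain ⟨e, he, heX, heY⟩ := exists_dvd_mem_Ico (X := z ^ 66) (Y := z ^ 84) hm0
      ⟨c₂, hm₂'.symm⟩ hpp ((hlt (show 66 < 84 by norm_num)).le.trans h0) (by
        intro q hq hqd
        rw [← hm₂', Nat.mul_div_cancel_left _ hpp0] at hqd
        exact hstep q ((hmax₃ q hq hqd).trans_lt h3))
    have := hng e he heX
    omega
  by_cases h4 : ∃ q, q.Prime ∧ q ∣ c₃ ∧ z ^ 18 ≤ q
  · obtain ⟨p₄, hp₄, ⟨w, hw⟩, h18⟩ := h4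
    refine Or.inr ⟨p₁, p₂, p₃, p₄, w, ⟨hp₁, hp₂, hp₃, hp₄⟩, ⟨h18, ?_, hp32, hp21⟩, ?_, ?_⟩
    · exact hmax₃ p₄ hp₄ ⟨w * p₃, by rw [← hm₃, hw]; ring⟩
    · rcases Nat.eq_zero_or_pos w with h | h
      · rw [h] at hw; omega
      · exact h
    · rw [← hm₂', ← hm₃, hw]; ring
  · push Not at h4
    refine Or.inl ⟨p₁ * p₂ * c₃, p₃, ⟨Nat.mul_pos hpp0 hc₃, ?_⟩,
      ⟨hp₃.one_le, (hp32.trans hp21).trans h2.le⟩, by rw [← hm₂', ← hm₃]; ring⟩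
    by_contra! hcon
    obtain ⟨e, he, heX, heY⟩ := exists_dvd_mem_Ico (X := z ^ 66) (Y := z ^ 84)
      (Nat.mul_pos hpp0 hc₃).ne' ⟨c₃, rfl⟩ hpp hcon.le (by
        intro q hq hqd
        rw [Nat.mul_div_cancel_left _ hpp0] at hqd
        exact hstep q (h4 q hq hqd))
    have := hng e (he.trans ⟨p₃, by rw [← hm₂', ← hm₃]; ring⟩) heX
    omega

lemma sum_sq_mul_pow_le {y : ℝ} (hy0 : 0 ≤ y) (hy : y ≤ 0.7072) (T : ℕ) :
    ∑ τ ∈ Finset.range T, (τ : ℝ) ^ 2 * y ^ τ ≤ 48.5 := by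
  have h : ∑ τ ∈ Finset.range T, (τ : ℝ) ^ 2 * (0.7072 : ℝ) ^ τ
      ≤ 48.5 - (3.42 * (T : ℝ) ^ 2 + 16.6 * T + 48.5) * 0.7072 ^ T := by
    induction T with
    | zero => norm_num
    | succ T ih =>
      rw [Finset.sum_range_succ, pow_succ (0.7072 : ℝ) T]
      have h1 : (0 : ℝ) ≤ (0.7072 : ℝ) ^ T := by positivity
      have h2 : (0 : ℝ) ≤ T := Nat.cast_nonneg _
      push_cast
      nlinarith [mul_nonneg h1 h2, mul_nonneg h1 (sq_nonneg (T : ℝ))]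
  calc ∑ τ ∈ Finset.range T, (τ : ℝ) ^ 2 * y ^ τ
      ≤ ∑ τ ∈ Finset.range T, (τ : ℝ) ^ 2 * (0.7072 : ℝ) ^ τ := by gcongr
    _ ≤ _ := h
    _ ≤ 48.5 := by
      have : (0 : ℝ) ≤ (3.42 * (T : ℝ) ^ 2 + 16.6 * T + 48.5) * 0.7072 ^ T := by positivity
      linarith

section fourPrimes

open Finset

variable (r τ : ℕ)

/-- Exponents of the dyadic intervals of the two smaller primes. -/
def smallExponents : Finset (ℕ × ℕ) :=
  {a ∈ Icc (18 * r) (120 * r) ×ˢ Icc (18 * r) (120 * r) |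
    a.1 + a.2 + τ = 60 * r ∧ a.2 ≤ a.1 ∧ 2 * a.1 + 1 ≤ 60 * r + τ}

/-- Exponents of the dyadic intervals of the two larger primes. -/
def largeExponents : Finset (ℕ × ℕ) :=
  {a ∈ Icc (18 * r) (120 * r) ×ˢ Icc (18 * r) (120 * r) |
    60 * r ≤ 2 * a.2 + τ ∧ a.2 ≤ a.1 ∧ a.1 + a.2 + 1 ≤ 60 * r + τ}

/-- Products of the two smaller primes. -/
def smallProducts : Finset ℕ :=
  (smallExponents r τ).biUnion fun a => image₂ (· * ·) (dyadicPrimes a.1) (dyadicPrimes a.2)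

/-- Products of the two larger primes and a cofactor. -/
def largeProducts : Finset ℕ :=
  (largeExponents r τ).biUnion fun a =>
    image₂ (· * ·) (image₂ (· * ·) (dyadicPrimes a.1) (dyadicPrimes a.2))
      (Icc 1 (2 ^ (60 * r + τ - (a.1 + a.2))))

variable {r τ}

lemma card_smallExponents_le (hτ : τ ≤ 60 * r) : #(smallExponents r τ) ≤ τ := by
  have : #(smallExponents r τ) ≤ #(Ico ((60 * r - τ + 1) / 2) ((60 * r + τ + 1) / 2)) := by
    refine card_le_card_of_injOn Prod.fst ?_ ?_
    · intro a ha
      simp only [smallExponents, coe_filter, Set.mem_ofPred_eq] at ha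
      simp only [coe_Ico, Set.mem_Ico]
      omega
    · rintro ⟨a, b⟩ ha ⟨a', b'⟩ ha' h
      simp only [smallExponents, coe_filter, Set.mem_ofPred_eq] at ha ha' h
      simp only [Prod.mk.injEq]
      omega
  rw [Nat.card_Ico] at this
  omega

lemma card_largeExponents_le (hτ : τ ≤ 60 * r) : #(largeExponents r τ) ≤ 2 * τ * τ := by
  have h : #(largeExponents r τ) ≤ #(Ico ((60 * r - τ + 1) / 2) ((60 * r + 3 * τ) / 2) ×ˢ
      Ico ((60 * r - τ + 1) / 2) ((60 * r + τ + 1) / 2)) := by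
    refine card_le_card fun a ha => ?_
    simp only [largeExponents, mem_filter] at ha
    simp only [mem_product, mem_Ico]
    omega
  rw [card_product, Nat.card_Ico, Nat.card_Ico] at h
  exact h.trans (Nat.mul_le_mul (by omega) (by omega))

lemma card_dyadicPrimes_le {a : ℕ} (hr : 1 ≤ r) (ha : 18 * r ≤ a) :
    (#(dyadicPrimes a) : ℝ) ≤ 2 ^ a / (9 * r) := by
  have h1 : 18 * r * #(dyadicPrimes a) ≤ 2 ^ (a + 1) :=
    (Nat.mul_le_mul_right _ ha).trans (mul_card_dyadicPrimes_le (by omega))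
  have h2 : (18 * r * #(dyadicPrimes a) : ℝ) ≤ 2 ^ (a + 1) := by exact_mod_cast h1
  have hr0 : (0 : ℝ) < r := by exact_mod_cast hr
  rw [le_div_iff₀ (by positivity)]
  rw [pow_succ] at h2
  linarith

lemma card_smallProducts_le (hr : 1 ≤ r) (hτ : τ ≤ 60 * r) :
    (#(smallProducts r τ) : ℝ) ≤ τ * (2 ^ (60 * r) / 2 ^ τ / (81 * r ^ 2)) := by
  have hr0 : (0 : ℝ) < r := by exact_mod_cast hr
  have h1 : (#(smallProducts r τ) : ℝ) ≤ ∑ a ∈ smallExponents r τ,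
      (#(dyadicPrimes a.1) * #(dyadicPrimes a.2) : ℝ) := by
    have : #(smallProducts r τ) ≤ ∑ a ∈ smallExponents r τ,
        #(dyadicPrimes a.1) * #(dyadicPrimes a.2) :=
      card_biUnion_le.trans (sum_le_sum fun a _ => card_image₂_le _ _ _)
    exact_mod_cast this
  have h2 : ∀ a ∈ smallExponents r τ, (#(dyadicPrimes a.1) * #(dyadicPrimes a.2) : ℝ) ≤
      2 ^ (60 * r) / 2 ^ τ / (81 * r ^ 2) := by
    intro a ha
    simp only [smallExponents, mem_filter, mem_product, mem_Icc] at ha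
    calc (#(dyadicPrimes a.1) * #(dyadicPrimes a.2) : ℝ)
        ≤ (2 ^ a.1 / (9 * r)) * (2 ^ a.2 / (9 * r)) := by
          gcongr
          · exact card_dyadicPrimes_le hr ha.1.1.1
          · exact card_dyadicPrimes_le hr ha.1.2.1
      _ = _ := by
          rw [← ha.2.1, pow_add, pow_add]
          field_simp
          norm_num
  refine (h1.trans (sum_le_card_nsmul _ _ _ h2)).trans ?_
  rw [nsmul_eq_mul]
  gcongr
  exact card_smallExponents_le hτ

lemma card_largeProducts_le (hr : 1 ≤ r) (hτ : τ ≤ 60 * r) :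
    (#(largeProducts r τ) : ℝ) ≤ 2 * τ ^ 2 * (2 ^ (60 * r) * 2 ^ τ / (81 * r ^ 2)) := by
  have hr0 : (0 : ℝ) < r := by exact_mod_cast hr
  have h1 : (#(largeProducts r τ) : ℝ) ≤ ∑ a ∈ largeExponents r τ,
      (#(dyadicPrimes a.1) * #(dyadicPrimes a.2) * 2 ^ (60 * r + τ - (a.1 + a.2)) : ℝ) := by
    have : #(largeProducts r τ) ≤ ∑ a ∈ largeExponents r τ,
        #(dyadicPrimes a.1) * #(dyadicPrimes a.2) * 2 ^ (60 * r + τ - (a.1 + a.2)) := by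
      refine card_biUnion_le.trans (sum_le_sum fun a _ => ?_)
      refine (card_image₂_le _ _ _).trans ?_
      rw [Nat.card_Icc, Nat.add_sub_cancel]
      exact Nat.mul_le_mul_right _ (card_image₂_le _ _ _)
    exact_mod_cast this
  have h2 : ∀ a ∈ largeExponents r τ,
      (#(dyadicPrimes a.1) * #(dyadicPrimes a.2) * 2 ^ (60 * r + τ - (a.1 + a.2)) : ℝ) ≤
      2 ^ (60 * r) * 2 ^ τ / (81 * r ^ 2) := by
    intro a ha
    simp only [largeExponents, mem_filter, mem_product, mem_Icc] at ha
    calc (#(dyadicPrimes a.1) * #(dyadicPrimes a.2) * 2 ^ (60 * r + τ - (a.1 + a.2)) : ℝ)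
        ≤ (2 ^ a.1 / (9 * r)) * (2 ^ a.2 / (9 * r)) * 2 ^ (60 * r + τ - (a.1 + a.2)) := by
          gcongr
          · exact card_dyadicPrimes_le hr ha.1.1.1
          · exact card_dyadicPrimes_le hr ha.1.2.1
      _ = (2 ^ (a.1 + a.2) * 2 ^ (60 * r + τ - (a.1 + a.2))) / (81 * r ^ 2) := by
          rw [pow_add]
          field_simp
          norm_num
      _ = _ := by
          rw [← pow_add, ← pow_add]
          congr 2
          omega
  refine (h1.trans (sum_le_card_nsmul _ _ _ h2)).trans ?_
  rw [nsmul_eq_mul]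
  gcongr
  have : (#(largeExponents r τ) : ℝ) ≤ 2 * τ * τ := by
    exact_mod_cast card_largeExponents_le hτ
  linarith
lemma exists_mem_products {m p₁ p₂ p₃ p₄ w : ℕ} (hr : 1 ≤ r) (hm : m ≤ 2 ^ (120 * r))
    (hp₁ : p₁.Prime) (hp₂ : p₂.Prime) (hp₃ : p₃.Prime) (hp₄ : p₄.Prime)
    (h18 : 2 ^ (18 * r) ≤ p₄) (h43 : p₄ ≤ p₃) (h32 : p₃ ≤ p₂) (h21 : p₂ ≤ p₁) (hw : 1 ≤ w)
    (hprod : p₁ * p₂ * w * (p₃ * p₄) = m) :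
    ∃ τ ∈ Icc 1 (24 * r), ∃ u ∈ largeProducts r τ, ∃ v ∈ smallProducts r τ, u * v = m := by
  have ha₄ : 18 * r ≤ Nat.log 2 p₄ := Nat.le_log_of_pow_le one_lt_two h18
  have ha₃ : Nat.log 2 p₄ ≤ Nat.log 2 p₃ := Nat.log_mono_right h43
  have ha₂ : Nat.log 2 p₃ ≤ Nat.log 2 p₂ := Nat.log_mono_right h32
  have ha₁ : Nat.log 2 p₂ ≤ Nat.log 2 p₁ := Nat.log_mono_right h21
  have hd₁ := mem_dyadicPrimes_log hp₁
  have hd₂ := mem_dyadicPrimes_log hp₂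
  have hd₃ := mem_dyadicPrimes_log hp₃
  have hd₄ := mem_dyadicPrimes_log hp₄
  set a₁ := Nat.log 2 p₁
  set a₂ := Nat.log 2 p₂
  set a₃ := Nat.log 2 p₃
  set a₄ := Nat.log 2 p₄
  have hl₁ := (prime_and_lt_of_mem_dyadicPrimes (by omega) hd₁).2.1
  have hl₂ := (prime_and_lt_of_mem_dyadicPrimes (by omega) hd₂).2.1
  have hl₃ := (prime_and_lt_of_mem_dyadicPrimes (by omega) hd₃).2.1
  have hl₄ := (prime_and_lt_of_mem_dyadicPrimes (by omega) hd₄).2.1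
  have hlt : 2 ^ (a₁ + a₂ + (a₃ + a₄)) < p₁ * p₂ * (p₃ * p₄) := by
    rw [pow_add, pow_add, pow_add]
    gcongr
  have hmw : p₁ * p₂ * (p₃ * p₄) * w = m := by rw [← hprod]; ring
  have hsum : a₁ + a₂ + (a₃ + a₄) < 120 * r := by
    refine (Nat.pow_lt_pow_iff_right one_lt_two).1 (hlt.trans_le ?_)
    exact (Nat.le_mul_of_pos_right _ hw).trans (hmw.le.trans hm)
  have hwle : w ≤ 2 ^ (120 * r - (a₁ + a₂ + (a₃ + a₄))) := by
    refine Nat.le_of_mul_le_mul_left ?_ (pow_pos two_pos (a₁ + a₂ + (a₃ + a₄)))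
    rw [← pow_add, Nat.add_sub_cancel' hsum.le]
    exact (Nat.mul_le_mul_right _ hlt.le).trans (hmw.le.trans hm)
  refine ⟨60 * r - (a₃ + a₄), mem_Icc.2 (by omega), p₁ * p₂ * w, ?_, p₃ * p₄, ?_, hprod⟩
  · refine mem_biUnion.2 ⟨(a₁, a₂), ?_, mem_image₂_of_mem (mem_image₂_of_mem hd₁ hd₂) ?_⟩
    · simp only [largeExponents, mem_filter, mem_product, mem_Icc]
      omega
    · refine mem_Icc.2 ⟨hw, hwle.trans (Nat.pow_le_pow_right two_pos ?_)⟩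
      dsimp only
      omega
  · refine mem_biUnion.2 ⟨(a₃, a₄), ?_, mem_image₂_of_mem hd₃ hd₄⟩
    simp only [smallExponents, mem_filter, mem_product, mem_Icc]
    omega

lemma card_products_bound (hr : 1 ≤ r) (hτ : τ ≤ 24 * r) :
    #(largeProducts r τ) + #(smallProducts r τ) * √(#(largeProducts r τ) : ℝ) ≤
      15 * 2 ^ (84 * r) +
        (√2 / 729 * (2 ^ (90 * r) / r ^ 3)) * (τ ^ 2 * (√2 / 2 : ℝ) ^ τ) := by
  have hr0 : (0 : ℝ) < r := by exact_mod_cast hr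
  have hU := card_largeProducts_le hr (show τ ≤ 60 * r by omega)
  have hV := card_smallProducts_le hr (show τ ≤ 60 * r by omega)
  have hτr : (τ : ℝ) ≤ 24 * r := by exact_mod_cast hτ
  have hs2 : √(2 : ℝ) ^ 2 = 2 := Real.sq_sqrt (by norm_num)
  refine add_le_add (hU.trans ?_) ?_
  · calc 2 * (τ : ℝ) ^ 2 * (2 ^ (60 * r) * 2 ^ τ / (81 * r ^ 2))
        ≤ 2 * (24 * r : ℝ) ^ 2 * (2 ^ (60 * r) * 2 ^ (24 * r) / (81 * r ^ 2)) := by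
          gcongr
          norm_num
      _ = 2 * 24 ^ 2 / 81 * 2 ^ (84 * r) := by
          rw [← pow_add, show 60 * r + 24 * r = 84 * r by ring]
          field_simp
      _ ≤ _ := by gcongr; norm_num
  · have hsq : √(#(largeProducts r τ) : ℝ) ≤ √2 * τ * (2 ^ (30 * r) * √2 ^ τ / (9 * r)) := by
      refine Real.sqrt_le_iff.2 ⟨by positivity, hU.trans_eq ?_⟩
      have e1 : (2 : ℝ) ^ (60 * r) = (2 ^ (30 * r)) ^ 2 := by
        rw [← pow_mul]; congr 1; ring
      have e2 : (2 : ℝ) ^ τ = (√2 ^ τ) ^ 2 := by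
        rw [← pow_mul, mul_comm, pow_mul, hs2]
      rw [e1, e2, mul_pow, mul_pow, hs2]
      field_simp
      norm_num
    calc #(smallProducts r τ) * √(#(largeProducts r τ) : ℝ)
        ≤ τ * (2 ^ (60 * r) / 2 ^ τ / (81 * r ^ 2)) *
          (√2 * τ * (2 ^ (30 * r) * √2 ^ τ / (9 * r))) := by gcongr
      _ = _ := by
          rw [show 90 * r = 60 * r + 30 * r by ring, pow_add, div_pow]
          field_simp
          ring

end fourPrimes

open Finset in
/-- The elements of `A` with four prime factors near the fourth root of `2 ^ (120 * r)` carry the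
main term. -/
lemma MulSidon.card_four_primes_le {A : Set ℕ} (hA : MulSidon A) {r : ℕ} (hr : 1 ≤ r)
    {S : Finset ℕ} (hSA : ∀ m ∈ S, m ∈ A)
    (h : ∀ m ∈ S, ∃ τ ∈ Icc 1 (24 * r), ∃ u ∈ largeProducts r τ, ∃ v ∈ smallProducts r τ,
      u * v = m) :
    (#S : ℝ) ≤ 69 / 729 * (2 ^ (90 * r) / r ^ 3) + 360 * r * 2 ^ (84 * r) := by
  classical
  set F := fun τ => {m ∈ S | ∃ u ∈ largeProducts r τ, ∃ v ∈ smallProducts r τ, u * v = m}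
  have h1 : (#S : ℝ) ≤ ∑ τ ∈ Icc 1 (24 * r), (#(F τ) : ℝ) := by
    have : #S ≤ ∑ τ ∈ Icc 1 (24 * r), #(F τ) := by
      refine (card_le_card fun m hm => ?_).trans card_biUnion_le
      obtain ⟨τ, hτ, hm'⟩ := h m hm
      exact mem_biUnion.2 ⟨τ, hτ, mem_filter.2 ⟨hm, hm'⟩⟩
    exact_mod_cast this
  set c : ℝ := √2 / 729 * (2 ^ (90 * r) / r ^ 3) with hc
  have h2 : ∀ τ ∈ Icc 1 (24 * r), (#(F τ) : ℝ) ≤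
      15 * 2 ^ (84 * r) + c * (τ ^ 2 * (√2 / 2 : ℝ) ^ τ) := fun τ hτ =>
    (hA.card_le_add_mul_sqrt (fun m hm => hSA m (mem_filter.1 hm).1)
      fun m hm => (mem_filter.1 hm).2).trans (card_products_bound hr (mem_Icc.1 hτ).2)
  have hs : √(2 : ℝ) ≤ 1.41424 := Real.sqrt_le_iff.2 ⟨by norm_num, by norm_num⟩
  have hc0 : 0 ≤ c := by positivity
  have h3 : ∑ τ ∈ Icc 1 (24 * r), ((τ : ℝ) ^ 2 * (√2 / 2 : ℝ) ^ τ) ≤ 48.5 := by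
    refine le_trans ?_ (sum_sq_mul_pow_le (y := √2 / 2) (by positivity) (by linarith)
      (24 * r + 1))
    refine sum_le_sum_of_subset_of_nonneg (fun τ hτ => ?_) fun τ _ _ => by positivity
    have := mem_Icc.1 hτ
    exact mem_range.2 (by omega)
  calc (#S : ℝ) ≤ ∑ τ ∈ Icc 1 (24 * r),
        (15 * 2 ^ (84 * r) + c * (τ ^ 2 * (√2 / 2 : ℝ) ^ τ)) := h1.trans (sum_le_sum h2)
    _ = 360 * r * 2 ^ (84 * r) +
        c * ∑ τ ∈ Icc 1 (24 * r), ((τ : ℝ) ^ 2 * (√2 / 2 : ℝ) ^ τ) := by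
      rw [sum_add_distrib, sum_const, ← mul_sum, Nat.card_Icc, nsmul_eq_mul]
      push_cast [Nat.add_sub_cancel]
      ring
    _ ≤ 360 * r * 2 ^ (84 * r) + c * 48.5 := by gcongr
    _ ≤ _ := by
      have h4 : (0 : ℝ) ≤ 2 ^ (90 * r) / r ^ 3 := by positivity
      have h5 : c * 48.5 ≤ 69 / 729 * (2 ^ (90 * r) / r ^ 3) := by
        rw [hc, mul_right_comm]
        gcongr
        linarith
      linarith

open Finset in
/-- The upper bound along the sequence `2 ^ (120 * r)`. -/
lemma MulSidon.card_initialPart_two_pow_le {A : Set ℕ} (hA : MulSidon A) {r : ℕ} (hr : 1 ≤ r)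
    (hAr : Nat.primeCounting (2 ^ (66 * r)) ≤ #(initialPart A (2 ^ (66 * r)))) :
    (#(initialPart A (2 ^ (120 * r))) : ℝ) ≤ Nat.primeCounting (2 ^ (120 * r)) +
      69 / 729 * (2 ^ (90 * r) / r ^ 3) + (16 + 360 * r) * 2 ^ (89 * r) := by
  classical
  obtain ⟨z, hz⟩ : ∃ z, z = 2 ^ r := ⟨_, rfl⟩
  have hpow : ∀ i, 2 ^ (i * r) = z ^ i := fun i => by rw [hz, mul_comm, pow_mul]
  have hpowR : ∀ i, (2 : ℝ) ^ (i * r) = (z : ℝ) ^ i := fun i => by exact_mod_cast hpow i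
  have hz2 : 2 ≤ z := by
    rw [hz]; exact Nat.le_self_pow (by omega) 2
  rw [hpow] at hAr
  set S := initialPart A (2 ^ (120 * r)) with hS
  have hSA : ∀ m ∈ S, m ∈ A := fun m hm => (mem_initialPart.1 hm).2
  have hS1 : ∀ m ∈ S, 1 ≤ m := fun m hm => (mem_initialPart.1 hm).1.1
  have hSz : ∀ m ∈ S, m ≤ z ^ 120 := fun m hm => by
    rw [← hpow]; exact (mem_initialPart.1 hm).1.2
  have hzp : ∀ i, 0 < z ^ i := fun i => by positivity
  have hzR : (1 : ℝ) ≤ z := by exact_mod_cast (show 1 ≤ z by omega)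
  have hmid : ∀ (P : ℕ → Prop) (i j k : ℕ), i + k = 120 →
      (∀ m, P m → ∃ u v, u * v = m ∧ z ^ i ≤ u ∧ u < z ^ (2 * j)) →
      (#{m ∈ S | P m} : ℝ) ≤ z ^ (2 * j) + z ^ k * z ^ j := by
    intro P i j k hik hP
    have := hA.card_le_add_mul_sqrt (S := {m ∈ S | P m}) (U := Icc 1 (z ^ (2 * j)))
      (V := Icc 1 (z ^ k)) (fun m hm => hSA m (mem_filter.1 hm).1) ?_
    · have h4 : √((z : ℝ) ^ (2 * j)) = z ^ j := by
        rw [mul_comm, pow_mul]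
        exact Real.sqrt_sq (by positivity)
      simpa [h4] using this
    · intro m hm
      obtain ⟨hmS, hm⟩ := mem_filter.1 hm
      obtain ⟨u, v, huv, hu1, hu2⟩ := hP m hm
      have hm1 := hS1 m hmS
      have hv : 1 ≤ v := by
        rcases Nat.eq_zero_or_pos v with h | h
        · rw [h] at huv; omega
        · exact h
      refine ⟨u, mem_Icc.2 ⟨(hzp i).trans_le hu1, hu2.le⟩, v, mem_Icc.2 ⟨hv, ?_⟩, huv⟩
      refine Nat.le_of_mul_le_mul_left ?_ (hzp i)
      calc z ^ i * v ≤ u * v := Nat.mul_le_mul_right _ hu1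
        _ ≤ z ^ i * z ^ k := by rw [huv, ← pow_add, hik]; exact hSz m hmS
  set P₁ : ℕ → Prop := fun m => ∃ u v, u * v = m ∧ z ^ 66 ≤ u ∧ u < z ^ (2 * 35)
  set P₂ : ℕ → Prop := fun m => ∃ u v, u * v = m ∧ z ^ 70 ≤ u ∧ u < z ^ (2 * 39)
  set P₃ : ℕ → Prop := fun m => ∃ u v, u * v = m ∧ z ^ 78 ≤ u ∧ u < z ^ (2 * 42)
  set P₄ : ℕ → Prop := fun m => ∃ p c, p.Prime ∧ (1 ≤ c ∧ c ≤ z ^ 36) ∧ p * c = m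
  set P₅ : ℕ → Prop := fun m =>
    ∃ p w, p.Prime ∧ p ≤ z ^ 66 ∧ (1 ≤ w ∧ w ≤ z ^ 66) ∧ p * w = m
  set P₆ : ℕ → Prop := fun m => ∃ u v, (1 ≤ u ∧ u ≤ z ^ 66) ∧ (1 ≤ v ∧ v ≤ z ^ 42) ∧ u * v = m
  set P₇ : ℕ → Prop := fun m => ∃ τ ∈ Icc 1 (24 * r), ∃ u ∈ largeProducts r τ,
    ∃ v ∈ smallProducts r τ, u * v = m
  have hcover : S ⊆ {m ∈ S | m < z ^ 84} ∪ ({m ∈ S | P₁ m} ∪ ({m ∈ S | P₂ m} ∪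
      ({m ∈ S | P₃ m} ∪ ({m ∈ S | P₄ m} ∪ ({m ∈ S | P₅ m} ∪
      ({m ∈ S | P₆ m} ∪ {m ∈ S | P₇ m})))))) := by
    intro m hm
    simp only [mem_union, mem_filter, hm, true_and]
    rcases factorization_cases hz2 (hSz m hm) with h | h | h | h | h | h
    · exact Or.inl h
    · obtain ⟨u, v, huv, hu1, hu2⟩ := h
      rcases Nat.lt_or_ge u (z ^ 70) with h70 | h70
      · exact Or.inr (Or.inl ⟨u, v, huv, hu1, h70⟩)
      rcases Nat.lt_or_ge u (z ^ 78) with h78 | h78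
      · exact Or.inr (Or.inr (Or.inl ⟨u, v, huv, h70, h78⟩))
      · exact Or.inr (Or.inr (Or.inr (Or.inl ⟨u, v, huv, h78, hu2⟩)))
    · exact Or.inr (Or.inr (Or.inr (Or.inr (Or.inl h))))
    · exact Or.inr (Or.inr (Or.inr (Or.inr (Or.inr (Or.inl h)))))
    · exact Or.inr (Or.inr (Or.inr (Or.inr (Or.inr (Or.inr (Or.inl h))))))
    · obtain ⟨p₁, p₂, p₃, p₄, w, ⟨hp₁, hp₂, hp₃, hp₄⟩, ⟨h18, h43, h32, h21⟩, hw, hprod⟩ := h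
      refine Or.inr (Or.inr (Or.inr (Or.inr (Or.inr (Or.inr (Or.inr ?_))))))
      exact exists_mem_products hr ((hpow 120).symm ▸ hSz m hm) hp₁ hp₂ hp₃ hp₄
        ((hpow 18).symm ▸ h18) h43 h32 h21 hw hprod
  have hcard : (#S : ℝ) ≤ #{m ∈ S | m < z ^ 84} + (#{m ∈ S | P₁ m} + (#{m ∈ S | P₂ m} +
      (#{m ∈ S | P₃ m} + (#{m ∈ S | P₄ m} + (#{m ∈ S | P₅ m} +
      (#{m ∈ S | P₆ m} + #{m ∈ S | P₇ m})))))) := by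
    refine le_trans (Nat.cast_le.2 (card_le_card hcover)) ?_
    norm_cast
    iterate 6 refine (card_union_le _ _).trans (Nat.add_le_add_left ?_ _)
    exact card_union_le _ _
  have h0 : (#{m ∈ S | m < z ^ 84} : ℝ) ≤ z ^ 84 := by
    have : #{m ∈ S | m < z ^ 84} ≤ #(range (z ^ 84)) :=
      card_le_card fun m hm => mem_range.2 (mem_filter.1 hm).2
    rw [card_range] at this
    exact_mod_cast this
  have h1 := hmid P₁ 66 35 54 rfl fun m hm => hm
  have h2 := hmid P₂ 70 39 50 rfl fun m hm => hm
  have h3 := hmid P₃ 78 42 42 rfl fun m hm => hm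
  have h4 : (#{m ∈ S | P₄ m} : ℝ) ≤ Nat.primeCounting (2 ^ (120 * r)) + z ^ 36 * z ^ 36 := by
    have := hA.card_le_add_sq_s1 (S := {m ∈ S | P₄ m})
      (U := (Icc 1 (2 ^ (120 * r))).filter Nat.Prime) (V := Icc 1 (z ^ 36))
      (fun m hm => hSA m (mem_filter.1 hm).1) ?_
    · rw [card_filter_prime_Icc, Nat.card_Icc, Nat.add_sub_cancel] at this
      exact_mod_cast this
    · intro m hm
      obtain ⟨hmS, p, c, hp, hc, rfl⟩ := mem_filter.1 hm
      refine ⟨p, mem_filter.2 ⟨mem_Icc.2 ⟨hp.one_le, ?_⟩, hp⟩, c, mem_Icc.2 hc, rfl⟩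
      rw [hpow]
      exact (Nat.le_mul_of_pos_right p hc.1).trans (hSz _ hmS)
  have h5 : (#{m ∈ S | P₅ m} : ℝ) ≤ 6 * z ^ 88 := by
    have := hA.card_prime_mul_le (T := z ^ 11) (hzp 11) (by rwa [← pow_mul])
      (S := {m ∈ S | P₅ m}) (fun m hm => hSA m (mem_filter.1 hm).1)
      (fun m hm => by rw [← pow_mul]; exact (mem_filter.1 hm).2)
    rw [← pow_mul] at this
    exact_mod_cast this
  have h6 : (#{m ∈ S | P₆ m} : ℝ) ≤ z ^ 66 + z ^ 42 * z ^ 33 := by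
    have := hA.card_le_add_mul_sqrt (S := {m ∈ S | P₆ m}) (U := Icc 1 (z ^ 66))
      (V := Icc 1 (z ^ 42)) (fun m hm => hSA m (mem_filter.1 hm).1) ?_
    · have h4 : √((z : ℝ) ^ 66) = z ^ 33 := by
        rw [show (z : ℝ) ^ 66 = (z ^ 33) ^ 2 by ring]
        exact Real.sqrt_sq (by positivity)
      simpa [h4] using this
    · intro m hm
      obtain ⟨hmS, u, v, hu, hv, huv⟩ := mem_filter.1 hm
      exact ⟨u, mem_Icc.2 hu, v, mem_Icc.2 hv, huv⟩
  have h7 := hA.card_four_primes_le hr (S := {m ∈ S | P₇ m})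
    (fun m hm => hSA m (mem_filter.1 hm).1) (fun m hm => (mem_filter.1 hm).2)
  have hle : ∀ i, i ≤ 89 → (z : ℝ) ^ i ≤ z ^ 89 := fun i hi => pow_le_pow_right₀ hzR hi
  have h84 : 360 * (r : ℝ) * 2 ^ (84 * r) ≤ 360 * r * 2 ^ (89 * r) := by
    gcongr <;> norm_num
  simp only [← pow_add] at h1 h2 h3 h4 h6
  norm_num only at h1 h2 h3 h4 h6
  have e89 := hpowR 89
  rw [add_mul, e89]
  rw [e89] at h84
  linarith [hle 84 (by norm_num), hle 70 (by norm_num), hle 78 (by norm_num),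
    hle 72 (by norm_num), hle 88 (by norm_num), hle 66 (by norm_num), hle 75 (by norm_num)]

/-- The lower order terms of the upper bound at `2 ^ (120 * r)` are negligible. -/
lemma eventually_lower_order_le :
    ∀ᶠ r : ℕ in atTop, (16 + 360 * r : ℝ) * 2 ^ (89 * r) ≤ 1 / 100 * (2 ^ (90 * r) / r ^ 3) := by
  have h := tendsto_pow_const_div_const_pow_of_one_lt 4 (r := (2 : ℝ)) (by norm_num)
  filter_upwards [h.eventually_le_const (show (0 : ℝ) < 1 / 37600 by norm_num),
    eventually_ge_atTop 1] with r hr hr1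
  have hr1 : (1 : ℝ) ≤ r := by exact_mod_cast hr1
  rw [div_le_iff₀ (by positivity)] at hr
  rw [← mul_div_assoc, le_div_iff₀ (by positivity),
    show 90 * r = 89 * r + r by ring, pow_add]
  calc (16 + 360 * (r : ℝ)) * (2 : ℝ) ^ (89 * r) * (r : ℝ) ^ 3
      ≤ (16 * r + 360 * r) * (2 : ℝ) ^ (89 * r) * (r : ℝ) ^ 3 := by
        gcongr; linarith
    _ = 376 * 2 ^ (89 * r) * (r : ℝ) ^ 4 := by ring
    _ ≤ 376 * 2 ^ (89 * r) * (1 / 37600 * 2 ^ r) := by gcongr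
    _ = _ := by ring

lemma natCard_inter_Icc (A : Set ℕ) (n : ℕ) :
    Nat.card ↥(A ∩ Set.Icc 1 n) = (initialPart A n).card := by
  have : A ∩ Set.Icc 1 n = ↑(initialPart A n) := by
    ext m
    simp [mem_initialPart, and_comm]
  rw [this, Nat.card_coe_set_eq, Set.ncard_coe_finset]

theorem stmt_1 (A : Set ℕ) (hpos : ∀ a ∈ A, 0 < a) (hinf : A.Infinite) (hS : MulSidon A) :
    Filter.liminf (fun n : ℕ =>
        ((((Nat.card ↥(A ∩ Set.Icc 1 n) : ℝ) - (Nat.primeCounting n : ℝ)) /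
          ((n : ℝ) ^ ((3 : ℝ) / 4) / (Real.log n) ^ 3) : ℝ) : EReal)) atTop
      < ((73643 : ℝ) : EReal) := by
  by_contra hcon
  have hev := eventually_lt_of_lt_liminf
    ((EReal.coe_lt_coe_iff.2 (show (73000 : ℝ) < 73643 by norm_num)).trans_le (not_lt.1 hcon))
  have hlt : ∀ᶠ n : ℕ in atTop, Nat.primeCounting n +
      73000 * ((n : ℝ) ^ ((3 : ℝ) / 4) / Real.log n ^ 3) < (initialPart A n).card := by
    filter_upwards [hev, eventually_ge_atTop 2] with n hn h2
    have hlog : 0 < Real.log n := Real.log_pos (by exact_mod_cast h2)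
    have hn0 : (0 : ℝ) < n := by exact_mod_cast (show 0 < n by omega)
    rw [EReal.coe_lt_coe_iff, lt_div_iff₀ (by positivity), natCard_inter_Icc] at hn
    linarith
  have htend : ∀ k : ℕ, 0 < k → Tendsto (fun r : ℕ => 2 ^ (k * r)) atTop atTop := fun k hk =>
    (tendsto_pow_atTop_atTop_of_one_lt one_lt_two).comp (tendsto_id.const_mul_atTop' hk)
  obtain ⟨r, h66, h120, hsmall, hr⟩ := ((htend 66 (by norm_num)).eventually hlt |>.and <|
    (htend 120 (by norm_num)).eventually hlt |>.and <|
    eventually_lower_order_le.and (eventually_ge_atTop 1)).exists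
  have hrR : (1 : ℝ) ≤ r := by exact_mod_cast hr
  have hπ : Nat.primeCounting (2 ^ (66 * r)) ≤ (initialPart A (2 ^ (66 * r))).card := by
    have h0 : (0 : ℝ) ≤ 73000 * (((2 ^ (66 * r) : ℕ) : ℝ) ^ ((3 : ℝ) / 4) /
        Real.log (2 ^ (66 * r) : ℕ) ^ 3) := by
      have := Real.log_natCast_nonneg (2 ^ (66 * r))
      positivity
    have : (Nat.primeCounting (2 ^ (66 * r)) : ℝ) ≤ (initialPart A (2 ^ (66 * r))).card := by
      linarith
    exact_mod_cast this
  have hupper := hS.card_initialPart_two_pow_le hr hπ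
  have hroot : ((2 ^ (120 * r) : ℕ) : ℝ) ^ ((3 : ℝ) / 4) = 2 ^ (90 * r) := by
    rw [Nat.cast_pow, Nat.cast_ofNat, ← Real.rpow_natCast_mul zero_le_two, ← Real.rpow_natCast]
    congr 1
    push_cast
    ring
  have hlog : Real.log (2 ^ (120 * r) : ℕ) = 120 * Real.log 2 * r := by
    rw [Nat.cast_pow, Nat.cast_ofNat, Real.log_pow]
    push_cast
    ring
  rw [hroot, hlog, mul_pow, ← div_div, div_right_comm] at h120
  have hL : (120 * Real.log 2) ^ 3 ≤ 600000 := by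
    have h1 := Real.log_two_lt_d9
    have h0 := Real.log_pos one_lt_two
    calc (120 * Real.log 2) ^ 3 ≤ (84 : ℝ) ^ 3 := by gcongr; linarith
      _ ≤ 600000 := by norm_num
  have hlogpos : 0 < (120 * Real.log 2) ^ 3 := by
    have := Real.log_pos one_lt_two
    positivity
  have hmain : (73000 / 600000 : ℝ) * (2 ^ (90 * r) / r ^ 3) ≤
      73000 * (2 ^ (90 * r) / r ^ 3 / (120 * Real.log 2) ^ 3) := by
    rw [div_mul_eq_mul_div, mul_div_assoc]
    gcongr
  have hX : (0 : ℝ) < 2 ^ (90 * r) / r ^ 3 := by positivity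
  linarith
end

section
/- There exists a multiplicative Sidon set A of positive integers such that liminf_{n→∞} (|A(n)| − π(n)) / (n^{3/4}/(log n)^3) > 1/196608. -/
open Filter

open ArithmeticFunction
open scoped ArithmeticFunction.Omega

section QuadrupleSystem

variable {F : Type*} [Field F]

/-- The quadruples `g` over a field in which `g 3` is the value at `g 0` of the affine function
taking the distinct values `g 1`, `g 2` at `0`, `1`, and `g 0` is neither `0` nor `1`. -/
def IsInterp (g : Fin 4 → F) : Prop :=
  g 0 ≠ 0 ∧ g 0 ≠ 1 ∧ g 1 ≠ g 2 ∧ g 3 = g 1 + g 0 * (g 2 - g 1)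

lemma IsInterp.eq_of_agree {g h : Fin 4 → F} (hg : IsInterp g) (hh : IsInterp h) (j : Fin 4)
    (H : ∀ i, i ≠ j → g i = h i) : g = h := by
  obtain ⟨g0, g1, g2, g3⟩ := hg
  obtain ⟨h0, h1, h2, h3⟩ := hh
  suffices hj : g j = h j by
    ext i
    by_cases hi : i = j
    · rw [hi, hj]
    · exact H i hi
  have H0 := H 0
  have H1 := H 1
  have H2 := H 2
  have H3 := H 3
  fin_cases j <;> simp at H0 H1 H2 H3 ⊢
  · rw [H1, H2] at g3
    have : (g 0 - h 0) * (h 2 - h 1) = 0 := by linear_combination h3 - g3 + H3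
    rcases mul_eq_zero.1 this with h | h
    · exact sub_eq_zero.1 h
    · exact absurd (sub_eq_zero.1 h).symm h2
  · rw [H0, H2] at g3
    have : (g 1 - h 1) * (1 - h 0) = 0 := by linear_combination h3 - g3 + H3
    rcases mul_eq_zero.1 this with h | h
    · exact sub_eq_zero.1 h
    · exact absurd (sub_eq_zero.1 h).symm h1
  · rw [H0, H1] at g3
    have : (g 2 - h 2) * h 0 = 0 := by linear_combination h3 - g3 + H3
    rcases mul_eq_zero.1 this with h | h
    · exact sub_eq_zero.1 h
    · exact absurd h h0
  · rw [g3, h3, H0, H1, H2]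

/-- A quadruple obtained from `a` and `b` by exchanging coordinates, together with its
complement, cannot be new. -/
lemma IsInterp.eq_or_eq_of_swap {a b c d : Fin 4 → F} (ha : IsInterp a) (hb : IsInterp b)
    (hc : IsInterp c) (hd : IsInterp d)
    (H : ∀ i, (a i = c i ∧ b i = d i) ∨ (a i = d i ∧ b i = c i)) : a = c ∨ a = d := by
  have T0 {g h : Fin 4 → F} (hg : IsInterp g) (hh : IsInterp h) (e1 : g 1 = h 1) (e2 : g 2 = h 2)
      (e3 : g 3 = h 3) : g = h :=
    hg.eq_of_agree hh 0 (by intro i hi; fin_cases i <;> simp_all)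
  have T1 {g h : Fin 4 → F} (hg : IsInterp g) (hh : IsInterp h) (e1 : g 0 = h 0) (e2 : g 2 = h 2)
      (e3 : g 3 = h 3) : g = h :=
    hg.eq_of_agree hh 1 (by intro i hi; fin_cases i <;> simp_all)
  have T2 {g h : Fin 4 → F} (hg : IsInterp g) (hh : IsInterp h) (e1 : g 0 = h 0) (e2 : g 1 = h 1)
      (e3 : g 3 = h 3) : g = h :=
    hg.eq_of_agree hh 2 (by intro i hi; fin_cases i <;> simp_all)
  have T3 {g h : Fin 4 → F} (hg : IsInterp g) (hh : IsInterp h) (e1 : g 0 = h 0) (e2 : g 1 = h 1)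
      (e3 : g 2 = h 2) : g = h :=
    hg.eq_of_agree hh 3 (by intro i hi; fin_cases i <;> simp_all)
  have K {c d : Fin 4 → F} (hc : IsInterp c) (hd : IsInterp d) (H0 : a 0 = c 0 ∧ b 0 = d 0)
      (H : ∀ i, (a i = c i ∧ b i = d i) ∨ (a i = d i ∧ b i = c i)) : a = c ∨ a = d := by
    have ea := ha.2.2.2
    have eb := hb.2.2.2
    rcases H 1 with H1 | H1 <;> rcases H 2 with H2 | H2 <;> rcases H 3 with H3 | H3
    · exact .inl (T3 ha hc H0.1 H1.1 H2.1)
    · exact .inl (T3 ha hc H0.1 H1.1 H2.1)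
    · exact .inl (T2 ha hc H0.1 H1.1 H3.1)
    · have ec := hc.2.2.2
      have ed := hd.2.2.2
      rw [← H0.1, ← H1.1, ← H2.2, ← H3.2] at ec
      rw [← H0.2, ← H1.2, ← H2.1, ← H3.1] at ed
      have e : (a 0 - b 0) * (a 2 - b 2) = 0 := by linear_combination ec - ea + ed - eb
      rcases mul_eq_zero.1 e with e | e
      · exact .inr (T1 ha hd ((sub_eq_zero.1 e).trans H0.2) H2.1 H3.1)
      · exact .inl (T3 ha hc H0.1 H1.1 ((sub_eq_zero.1 e).trans H2.2))
    · exact .inl (T1 ha hc H0.1 H2.1 H3.1)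
    · have ec := hc.2.2.2
      have ed := hd.2.2.2
      rw [← H0.1, ← H1.2, ← H2.1, ← H3.2] at ec
      rw [← H0.2, ← H1.1, ← H2.2, ← H3.1] at ed
      have e : (a 0 - b 0) * (a 1 - b 1) = 0 := by linear_combination ea - ec + eb - ed
      rcases mul_eq_zero.1 e with e | e
      · exact .inr (T2 ha hd ((sub_eq_zero.1 e).trans H0.2) H1.1 H3.1)
      · exact .inl (T3 ha hc H0.1 ((sub_eq_zero.1 e).trans H1.2) H2.1)
    · have ec := hc.2.2.2
      have ed := hd.2.2.2
      rw [← H0.1, ← H1.2, ← H2.2, ← H3.1] at ec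
      rw [← H0.2, ← H1.1, ← H2.1, ← H3.2] at ed
      have e : (a 0 - b 0) * ((a 2 - a 1) - (b 2 - b 1)) = 0 := by
        linear_combination ec - ea + ed - eb
      rcases mul_eq_zero.1 e with e | e
      · exact .inr (T3 ha hd ((sub_eq_zero.1 e).trans H0.2) H1.1 H2.1)
      · have e1 : a 1 = b 1 := by linear_combination ec - ea - a 0 * e
        exact .inl (T2 ha hc H0.1 (e1.trans H1.2) H3.1)
    · exact .inr (T0 ha hd H1.1 H2.1 H3.1)
  rcases H 0 with H0 | H0
  · exact K hc hd H0 H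
  · exact (K hd hc H0 fun i ↦ (H i).symm).symm

end QuadrupleSystem

section Product

variable {α : Type*} {e : Fin 4 × α → ℕ}

lemma factorization_prod_embedding [DecidableEq α] (he : Function.Injective e)
    (hp : ∀ v, (e v).Prime) (g : Fin 4 → α) (i : Fin 4) (x : α) :
    (∏ j, e (j, g j)).factorization (e (i, x)) = if g i = x then 1 else 0 := by
  rw [Nat.factorization_prod (fun j _ ↦ (hp _).ne_zero), Finset.sum_apply']
  rw [Finset.sum_eq_single i]
  · rw [(hp _).factorization, Finsupp.single_apply]
    simp [he.eq_iff]
  · intro j _ hj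
    rw [(hp _).factorization, Finsupp.single_apply]
    simp [he.eq_iff, hj]
  · simp

lemma eq_or_eq_of_prod_mul_prod_eq (he : Function.Injective e) (hp : ∀ v, (e v).Prime)
    {a b c d : Fin 4 → α}
    (h : (∏ j, e (j, a j)) * ∏ j, e (j, b j) = (∏ j, e (j, c j)) * ∏ j, e (j, d j)) (i : Fin 4) :
    (a i = c i ∧ b i = d i) ∨ (a i = d i ∧ b i = c i) := by
  classical
  have h0 (g : Fin 4 → α) : ∏ j, e (j, g j) ≠ 0 :=
    Finset.prod_ne_zero_iff.2 fun _ _ ↦ (hp _).ne_zero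
  have key (x : α) : (if a i = x then 1 else 0) + (if b i = x then 1 else 0) =
      (if c i = x then 1 else 0) + (if d i = x then 1 else 0) := by
    have := congrArg (fun n ↦ n.factorization (e (i, x))) h
    simpa [Nat.factorization_mul (h0 _) (h0 _), factorization_prod_embedding he hp] using this
  have k1 := key (a i)
  have k2 := key (b i)
  grind

lemma prod_embedding_injective (he : Function.Injective e) (hp : ∀ v, (e v).Prime) :
    Function.Injective fun g : Fin 4 → α ↦ ∏ j, e (j, g j) := by
  intro a b h
  ext i
  have := eq_or_eq_of_prod_mul_prod_eq he hp (congrArg₂ (· * ·) h h) i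
  grind

end Product

/-- Within a large enough set `B` of primes there is a multiplicative Sidon set of products of four
primes, any two of which share at most two primes. -/
lemma exists_quadruple_products (B : Finset ℕ) (hB : ∀ p ∈ B, p.Prime) :
    ∃ H : Finset ℕ, (∀ a ∈ H, a ≠ 0 ∧ Ω a = 4 ∧ ∀ p, p.Prime → p ∣ a → p ∈ B) ∧
      (∀ M, (∀ p ∈ B, p ≤ M) → ∀ a ∈ H, a ≤ M ^ 4) ∧
      MulSidon H ∧
      (∀ a ∈ H, ∀ b ∈ H, ∀ p q : ℕ, p.Prime → q.Prime → p * a = q * b → p = q) ∧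
      (B.card / 8 + 1 - 2) ^ 3 ≤ H.card := by
  rcases Nat.eq_zero_or_pos (B.card / 8) with h0 | h0
  · exact ⟨∅, by simp, by simp, by simp [MulSidon], by simp, by simp [h0]⟩
  obtain ⟨q, hq, hq1, hq2⟩ := Nat.exists_prime_lt_and_le_two_mul _ h0.ne'
  have := Fact.mk hq
  obtain ⟨e⟩ : Nonempty (Fin 4 × ZMod q ↪ B) := by
    apply Function.Embedding.nonempty_of_card_le
    simp [ZMod.card]
    omega
  set f : Fin 4 × ZMod q → ℕ := fun v ↦ e v
  have he : Function.Injective f := Subtype.val_injective.comp e.injective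
  have hp (v) : (f v).Prime := hB _ (e v).2
  set P : (Fin 4 → ZMod q) → ℕ := fun g ↦ ∏ j, f (j, g j) with hP
  have hP0 (g) : P g ≠ 0 := Finset.prod_ne_zero_iff.2 fun _ _ ↦ (hp _).ne_zero
  have hPi : Function.Injective P := prod_embedding_injective he hp
  have hPf (g i x) : (P g).factorization (f (i, x)) = if g i = x then 1 else 0 :=
    factorization_prod_embedding he hp g i x
  classical
  let T : Finset (ZMod q × ZMod q × ZMod q) :=
    ((Finset.univ.erase 0).erase 1) ×ˢ Finset.univ.offDiag
  let G : ZMod q × ZMod q × ZMod q → Fin 4 → ZMod q :=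
    fun t ↦ ![t.1, t.2.1, t.2.2, t.2.1 + t.1 * (t.2.2 - t.2.1)]
  have hG : ∀ t ∈ T, IsInterp (G t) := by
    intro t ht
    simp [T] at ht
    simp [IsInterp, G]
    tauto
  have hGi : Function.Injective G := by
    intro s t h
    have h0 := congrFun h 0
    have h1 := congrFun h 1
    have h2 := congrFun h 2
    simp [G] at h0 h1 h2
    ext <;> simp [*]
  refine ⟨T.image (P ∘ G), ?_, ?_, ?_, ?_, ?_⟩
  · simp only [Finset.forall_mem_image, Function.comp]
    intro t _
    refine ⟨hP0 _, ?_, ?_⟩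
    · simp only [hP, Fin.prod_univ_four]
      rw [cardFactors_mul, cardFactors_mul, cardFactors_mul]
      · simp [cardFactors_apply_prime (hp _)]
      all_goals simp [(hp _).ne_zero]
    · intro p hpp hd
      obtain ⟨j, _, hj⟩ := (hpp.prime.dvd_finsetProd_iff _).1 hd
      rw [(Nat.prime_dvd_prime_iff_eq hpp (hp _)).1 hj]
      exact (e _).2
  · simp only [Finset.forall_mem_image, Function.comp]
    intro M hM t _
    simpa using Finset.prod_le_pow_card Finset.univ (fun j ↦ f (j, G t j)) M
      fun j _ ↦ hM _ (e _).2
  · simp only [MulSidon, Finset.mem_coe, Finset.forall_mem_image, Function.comp]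
    intro a ha b hb c hc d hd h
    have := (hG a ha).eq_or_eq_of_swap (hG b hb) (hG c hc) (hG d hd)
      (eq_or_eq_of_prod_mul_prod_eq he hp h)
    rcases this with h1 | h1 <;> rw [h1] at h ⊢
    · exact .inl ⟨rfl, Nat.eq_of_mul_eq_mul_left (Nat.pos_of_ne_zero (hP0 _)) h⟩
    · rw [mul_comm (P (G c))] at h
      exact .inr ⟨rfl, Nat.eq_of_mul_eq_mul_left (Nat.pos_of_ne_zero (hP0 _)) h⟩
  · simp only [Finset.forall_mem_image, Function.comp]
    intro a ha b hb p r hpp hr h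
    by_contra hne
    have key (i : Fin 4) (hi : G a i ≠ G b i) : r = f (i, G a i) := by
      have := congrArg (fun n ↦ n.factorization (f (i, G a i))) h
      simp only [Nat.factorization_mul hpp.ne_zero (hP0 _), Nat.factorization_mul hr.ne_zero (hP0 _),
        Finsupp.add_apply, hPf, hpp.factorization, hr.factorization, Finsupp.single_apply,
        if_neg hi.symm] at this
      by_contra hne'
      simp [hne'] at this
    have hab : G a ≠ G b := by
      intro hab
      rw [hab] at h
      exact hne (Nat.eq_of_mul_eq_mul_right (Nat.pos_of_ne_zero (hP0 _)) h)
    obtain ⟨j, hj⟩ := Function.ne_iff.1 hab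
    refine hab ((hG a ha).eq_of_agree (hG b hb) j fun i hij ↦ ?_)
    by_contra hi
    have := he ((key i hi).symm.trans (key j hj))
    simp at this
    exact hij this.1
  · rw [Finset.card_image_of_injective _ (hPi.comp hGi), Finset.card_product, Finset.offDiag_card,
      Finset.card_erase_of_mem (by simp), Finset.card_erase_of_mem (by simp)]
    simp only [Finset.card_univ, ZMod.card]
    calc (B.card / 8 + 1 - 2) ^ 3 ≤ (q - 1 - 1) ^ 3 := Nat.pow_le_pow_left (by omega) 3
      _ = (q - 1 - 1) * ((q - 1 - 1) * (q - 1 - 1)) := by ring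
      _ ≤ (q - 1 - 1) * ((q - 1) * q) := by gcongr <;> omega
      _ = _ := by rw [Nat.sub_one_mul q q]

/-- Multiplicative Sidon sets of products of four primes, drawn from disjoint sets of primes, can be
joined to the set of all primes. -/
lemma mulSidon_primes_union {H : ℕ → Finset ℕ} {B : ℕ → Finset ℕ}
    (hB : Pairwise fun k l ↦ Disjoint (B k) (B l))
    (hH : ∀ k, ∀ a ∈ H k, a ≠ 0 ∧ Ω a = 4 ∧ ∀ p, p.Prime → p ∣ a → p ∈ B k)
    (hS : ∀ k, MulSidon (H k))
    (hp : ∀ k, ∀ a ∈ H k, ∀ b ∈ H k, ∀ p q : ℕ, p.Prime → q.Prime → p * a = q * b → p = q) :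
    MulSidon ({p | p.Prime} ∪ ⋃ k, (H k : Set ℕ)) := by
  have hBk {k l p} (h1 : p ∈ B k) (h2 : p ∈ B l) : k = l := by
    by_contra h
    exact Finset.disjoint_left.1 (hB h) h1 h2
  have hex {k a} (ha : a ∈ H k) : ∃ p, p.Prime ∧ p ∣ a := by
    refine Nat.exists_prime_and_dvd fun h ↦ ?_
    have := (hH k a ha).2.1
    simp [h] at this
  have hcop {k l a b} (ha : a ∈ H k) (hb : b ∈ H l) (hkl : k ≠ l) : a.Coprime b :=
    Nat.coprime_of_dvd fun p hpp h1 h2 ↦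
      hkl (hBk ((hH k a ha).2.2 p hpp h1) ((hH l b hb).2.2 p hpp h2))
  have hdvd {k l a b} (ha : a ∈ H k) (hb : b ∈ H l) (hab : a ∣ b) : a = b := by
    obtain ⟨t, rfl⟩ := hab
    obtain ⟨h0, h1, -⟩ := hH l _ hb
    have ht : t ≠ 0 := right_ne_zero_of_mul h0
    rw [cardFactors_mul (left_ne_zero_of_mul h0) ht, (hH k a ha).2.1] at h1
    have : Ω t = 0 := by omega
    rw [cardFactors_eq_zero_iff_eq_zero_or_one] at this
    simp [this.resolve_left ht]
  have h2 {x y z w : ℕ} (hx : x.Prime) (hy : y.Prime) (hz : z.Prime) (hw : w.Prime)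
      (h : x * y = z * w) : (x = z ∧ y = w) ∨ (x = w ∧ y = z) := by
    rcases (Nat.Prime.dvd_mul hz).1 (h ▸ dvd_mul_right z w) with h1 | h1
    · obtain rfl := (Nat.prime_dvd_prime_iff_eq hz hx).1 h1
      exact .inl ⟨rfl, Nat.eq_of_mul_eq_mul_left hz.pos h⟩
    · obtain rfl := (Nat.prime_dvd_prime_iff_eq hz hy).1 h1
      rw [mul_comm] at h
      exact .inr ⟨Nat.eq_of_mul_eq_mul_left hz.pos h, rfl⟩
  have h5 {p q k l a b} (hpp : p.Prime) (hq : q.Prime) (ha : a ∈ H k) (hb : b ∈ H l)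
      (h : p * a = q * b) : p = q ∧ a = b := by
    have hpq : p = q := by
      by_cases hkl : k = l
      · subst hkl
        exact hp k a ha b hb p q hpp hq h
      · have h1 : a ∣ q := (hcop ha hb hkl).dvd_of_dvd_mul_right (h ▸ dvd_mul_left a p)
        obtain ⟨h0, h4, -⟩ := hH k a ha
        rcases (Nat.dvd_prime hq).1 h1 with rfl | rfl
        · simp at h4
        · simp [cardFactors_apply_prime hq] at h4
    subst hpq
    exact ⟨rfl, Nat.eq_of_mul_eq_mul_left hpp.pos h⟩
  have h8' {k l i j a b c d} (ha : a ∈ H k) (hb : b ∈ H l) (hc : c ∈ H i) (hd : d ∈ H j)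
      (h : a * b = c * d) (hkl : k ≠ l) (hki : k = i) : a = c ∧ b = d := by
    subst hki
    have h1 : c ∣ a := (hcop hc hb hkl).dvd_of_dvd_mul_right (h ▸ dvd_mul_right c d)
    obtain rfl := hdvd hc ha h1
    exact ⟨rfl, Nat.eq_of_mul_eq_mul_left (Nat.pos_of_ne_zero (hH k _ hc).1) h⟩
  have hmem {k l i a b c d} (ha : a ∈ H k) (hb : b ∈ H l) (hc : c ∈ H i)
      (h : a * b = c * d) : k = i ∨ l = i := by
    obtain ⟨p, hpp, hpc⟩ := hex hc
    have hi := (hH i c hc).2.2 p hpp hpc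
    rcases (Nat.Prime.dvd_mul hpp).1 (h ▸ hpc.mul_right d) with h1 | h1
    · exact .inl (hBk ((hH k a ha).2.2 p hpp h1) hi)
    · exact .inr (hBk ((hH l b hb).2.2 p hpp h1) hi)
  have h8 {k l i j a b c d} (ha : a ∈ H k) (hb : b ∈ H l) (hc : c ∈ H i) (hd : d ∈ H j)
      (h : a * b = c * d) : (a = c ∧ b = d) ∨ (a = d ∧ b = c) := by
    by_cases hkl : k = l
    · subst hkl
      obtain rfl : k = i := by simpa using hmem ha hb hc h
      obtain rfl : k = j := by simpa using hmem ha hb hd (h.trans (mul_comm c d))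
      exact hS k a ha b hb c hc d hd h
    · rcases hmem ha hb hc h with h1 | h1
      · exact .inl (h8' ha hb hc hd h hkl h1)
      · exact .inr (h8' hb ha hc hd ((mul_comm b a).trans h) (Ne.symm hkl) h1).symm
  intro x hx y hy z hz w hw h
  simp only [Set.mem_union, Set.mem_ofPred_eq, Set.mem_iUnion, Finset.mem_coe] at hx hy hz hw
  have hΩ {x} (hx : x.Prime ∨ ∃ k, x ∈ H k) :
      x ≠ 0 ∧ ((x.Prime ∧ Ω x = 1) ∨ ((∃ k, x ∈ H k) ∧ Ω x = 4)) := by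
    rcases hx with hx | ⟨k, hx⟩
    · exact ⟨hx.ne_zero, .inl ⟨hx, cardFactors_apply_prime hx⟩⟩
    · exact ⟨(hH k x hx).1, .inr ⟨⟨k, hx⟩, (hH k x hx).2.1⟩⟩
  obtain ⟨x0, hx⟩ := hΩ hx
  obtain ⟨y0, hy⟩ := hΩ hy
  obtain ⟨z0, hz⟩ := hΩ hz
  obtain ⟨w0, hw⟩ := hΩ hw
  have key : Ω x + Ω y = Ω z + Ω w := by
    rw [← cardFactors_mul x0 y0, ← cardFactors_mul z0 w0, h]
  rcases hx with ⟨hx, ex⟩ | ⟨⟨k, hx⟩, ex⟩ <;> rcases hy with ⟨hy, ey⟩ | ⟨⟨l, hy⟩, ey⟩ <;>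
    rcases hz with ⟨hz, ez⟩ | ⟨⟨i, hz⟩, ez⟩ <;> rcases hw with ⟨hw, ew⟩ | ⟨⟨j, hw⟩, ew⟩ <;>
    rw [ex, ey, ez, ew] at key <;> try omega
  · exact h2 hx hy hz hw h
  · exact .inl (h5 hx hz hy hw h)
  · exact .inr (h5 hx hw hy hz (h.trans (mul_comm z w)))
  · exact .inr (h5 hy hz hx hw ((mul_comm y x).trans h)).symm
  · exact .inl (h5 hy hw hx hz ((mul_comm y x).trans (h.trans (mul_comm z w)))).symm
  · exact h8 hx hy hz hw h

/-- A lower bound of Chebyshev type for the number of primes in `(4 ^ k, 4 ^ (k + 1)]`. -/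
lemma eventually_le_primeCounting_four_pow_sub :
    ∀ᶠ k : ℕ in atTop, (5 / 32 : ℝ) * (4 ^ (k + 1) / (k + 1)) ≤
      (Nat.primeCounting (4 ^ (k + 1)) : ℝ) - Nat.primeCounting (4 ^ k) := by
  have hl2 : 0 < Real.log 2 := Real.log_pos (by norm_num)
  have l4 : Real.log 4 = 2 * Real.log 2 := by
    rw [show (4 : ℝ) = 2 ^ 2 by norm_num, Real.log_pow]; norm_num
  have hpow : Tendsto (fun k : ℕ ↦ (4 : ℝ) ^ k) atTop atTop :=
    tendsto_pow_atTop_atTop_of_one_lt (by norm_num)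
  have hε : 0 < Real.log 2 / 8 := by positivity
  filter_upwards [hpow.eventually (Chebyshev.eventually_primeCounting_le hε), eventually_ge_atTop 17]
    with k hk h17
  have hk17 : (17 : ℝ) ≤ k := by exact_mod_cast h17
  have hfl : ⌊(4 : ℝ) ^ k⌋₊ = 4 ^ k := by
    rw [show (4 : ℝ) ^ k = ((4 ^ k : ℕ) : ℝ) by push_cast; rfl, Nat.floor_natCast]
  rw [hfl, Real.log_pow, l4] at hk
  have hN : (4 : ℝ) ^ k = 4 ^ (k + 1) / 4 := by rw [pow_succ]; ring
  set N : ℝ := 4 ^ (k + 1) with hNdef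
  have hN0 : 0 < N := by positivity
  have up : (Nat.primeCounting (4 ^ k) : ℝ) ≤ 18 / 64 * (N / (k + 1)) := by
    refine hk.trans ?_
    rw [hN, div_le_iff₀ (by positivity)]
    have : 18 / 64 * (N / (k + 1)) * (k * (2 * Real.log 2)) =
      (36 / 64 * (k / (k + 1))) * (N * Real.log 2) := by ring
    rw [this]
    have h1 : (17 / 18 : ℝ) ≤ k / (k + 1) := by
      rw [div_le_div_iff₀ (by norm_num) (by positivity)]; linarith
    calc _ = (34 / 64) * (N * Real.log 2) := by ring
      _ ≤ _ := by gcongr; linarith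
  have lo : 7 / 16 * (N / (k + 1)) ≤ (Nat.primeCounting (4 ^ (k + 1)) : ℝ) := by
    refine le_trans ?_ (Chebyshev.pi_ge (4 ^ (k + 1)))
    push_cast
    rw [← hNdef]
    have hlogN : Real.log N = (k + 1) * (2 * Real.log 2) := by
      rw [hNdef, Real.log_pow, l4]; push_cast; ring
    have h1 : Real.log (N + 1) ≤ N * Real.log 2 / 8 := by
      have hN1 : 1 ≤ N := one_le_pow₀ (by norm_num)
      have h3 : (8 : ℝ) * (2 * (k + 1) + 1) ≤ N := by
        have : ∀ m : ℕ, 17 ≤ m → 8 * (2 * (m + 1) + 1) ≤ 4 ^ (m + 1) := by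
          intro m hm
          induction m, hm using Nat.le_induction with
          | base => norm_num
          | succ m hm ih => rw [pow_succ]; omega
        rw [hNdef]
        exact_mod_cast this k h17
      calc Real.log (N + 1) ≤ Real.log (2 * N) := Real.log_le_log (by positivity) (by linarith)
        _ = (2 * (k + 1) + 1) * Real.log 2 := by
          rw [Real.log_mul (by norm_num) hN0.ne', hlogN]; ring
        _ ≤ (N / 8) * Real.log 2 := by gcongr; linarith
        _ = _ := by ring
    rw [hlogN, le_div_iff₀ (by positivity)]
    have : 7 / 16 * (N / (k + 1)) * ((k + 1) * (2 * Real.log 2)) = 7 / 8 * (N * Real.log 2) := by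
      field_simp; ring
    linarith
  linarith

lemma pow_le_natCast_div_eight_of_le {k C : ℕ} (hk : 9 ≤ k)
    (hC : (5 / 32 : ℝ) * (4 ^ (k + 1) / (k + 1)) ≤ C) :
    (4 ^ (k + 1) / (64 * (k + 1)) : ℝ) ^ 3 ≤ ((C / 8 + 1 - 2) ^ 3 : ℕ) := by
  have h3 : (512 : ℝ) * (k + 1) ≤ 4 ^ (k + 1) := by
    have : ∀ m : ℕ, 9 ≤ m → 512 * (m + 1) ≤ 4 ^ (m + 1) := by
      intro m hm
      induction m, hm using Nat.le_induction with
      | base => norm_num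
      | succ m hm ih => rw [pow_succ]; omega
    exact_mod_cast this k hk
  have h4 : (512 : ℝ) ≤ 4 ^ (k + 1) / (k + 1) := by
    rwa [le_div_iff₀ (by positivity)]
  have h5 : (C : ℝ) / 8 - 2 ≤ ((C / 8 + 1 - 2 : ℕ) : ℝ) := by
    have : C ≤ 8 * (C / 8 + 1 - 2) + 16 := by omega
    have : (C : ℝ) ≤ 8 * ((C / 8 + 1 - 2 : ℕ) : ℝ) + 16 := by exact_mod_cast this
    linarith
  rw [Nat.cast_pow]
  gcongr
  rw [mul_comm, ← div_div]
  linarith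

/-- The comparison function at `n < 4 ^ (4 * k + 8)`. -/
lemma rpow_div_log_pow_le {n k : ℕ} (hk : 1 ≤ k) (h1 : 4 ^ (4 * k + 4) ≤ n)
    (h2 : n ≤ 4 ^ (4 * k + 8)) :
    0 < (n : ℝ) ^ ((3 : ℝ) / 4) / (Real.log n) ^ 3 ∧
    (1 / 140000) * ((n : ℝ) ^ ((3 : ℝ) / 4) / (Real.log n) ^ 3) ≤
      (4 ^ (k + 1) / (64 * (k + 1)) : ℝ) ^ 3 := by
  have hn : (4 : ℝ) ^ (4 * k + 4) ≤ n := by exact_mod_cast h1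
  have hn2 : (n : ℝ) ≤ 4 ^ (4 * k + 8) := by exact_mod_cast h2
  have hn0 : (0 : ℝ) < n := lt_of_lt_of_le (by positivity) hn
  have hlog : 5 * ((k : ℝ) + 1) ≤ Real.log n := by
    have := Real.log_le_log (by positivity) hn
    rw [Real.log_pow, show (4 : ℝ) = 2 ^ 2 by norm_num, Real.log_pow] at this
    push_cast at this
    have h2 := Real.log_two_gt_d9
    nlinarith
  have hlog0 : 0 < Real.log n := lt_of_lt_of_le (by positivity) hlog
  have hr : (n : ℝ) ^ ((3 : ℝ) / 4) ≤ (4 * 4 ^ (k + 1)) ^ 3 := by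
    calc (n : ℝ) ^ ((3 : ℝ) / 4) ≤ (4 ^ (4 * k + 8)) ^ ((3 : ℝ) / 4) := by gcongr
      _ = _ := by
        rw [← pow_succ', ← Real.rpow_natCast 4 (4 * k + 8), ← Real.rpow_mul (by norm_num),
          ← pow_mul, ← Real.rpow_natCast 4 ((k + 1 + 1) * 3)]
        congr 1
        push_cast
        ring
  refine ⟨by positivity, ?_⟩
  calc _ ≤ (1 / 140000) * ((4 * 4 ^ (k + 1)) ^ 3 / (5 * ((k : ℝ) + 1)) ^ 3) := by gcongr
    _ = (64 ^ 4 / (140000 * 125)) * (4 ^ (k + 1) / (64 * (k + 1)) : ℝ) ^ 3 := by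
      field_simp; ring
    _ ≤ 1 * _ := by gcongr; norm_num
    _ = _ := one_mul _

/-- The primes in `(4 ^ k, 4 ^ (k + 1)]`. -/
def primeBlock (k : ℕ) : Finset ℕ := {p ∈ Finset.Ioc (4 ^ k) (4 ^ (k + 1)) | p.Prime}

lemma primeBlock_disjoint : Pairwise fun k l ↦ Disjoint (primeBlock k) (primeBlock l) := by
  intro k l hne
  wlog hkl : k < l generalizing k l
  · exact (this hne.symm (by omega)).symm
  refine Finset.disjoint_left.2 fun p hk hl ↦ ?_
  simp only [primeBlock, Finset.mem_filter, Finset.mem_Ioc] at hk hl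
  have h4 : 4 ^ (k + 1) ≤ 4 ^ l := Nat.pow_le_pow_right (by norm_num) hkl
  omega

lemma card_primeBlock (k : ℕ) :
    ((primeBlock k).card : ℝ) = Nat.primeCounting (4 ^ (k + 1)) - Nat.primeCounting (4 ^ k) := by
  have h : Nat.primesLE (4 ^ (k + 1)) = Nat.primesLE (4 ^ k) ∪ primeBlock k := by
    have : 4 ^ k ≤ 4 ^ (k + 1) := Nat.pow_le_pow_right (by norm_num) (by omega)
    ext p
    simp only [primeBlock, Finset.mem_union, Finset.mem_filter, Finset.mem_Ioc, Nat.mem_primesLE]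
    grind
  have hd : Disjoint (Nat.primesLE (4 ^ k)) (primeBlock k) := by
    refine Finset.disjoint_left.2 fun p h1 h2 ↦ ?_
    simp only [primeBlock, Finset.mem_filter, Finset.mem_Ioc, Nat.mem_primesLE] at h1 h2
    omega
  have := congrArg Finset.card h
  rw [Finset.card_union_of_disjoint hd, Nat.primesLE_card_eq_primeCounting,
    Nat.primesLE_card_eq_primeCounting] at this
  rw [this]
  push_cast
  ring

theorem stmt_2 :
    ∃ A : Set ℕ, (∀ a ∈ A, 0 < a) ∧ MulSidon A ∧
      ((1 / 196608 : ℝ) : EReal) < Filter.liminf (fun n : ℕ =>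
        ((((Nat.card ↥(A ∩ Set.Icc 1 n) : ℝ) - (Nat.primeCounting n : ℝ)) /
          ((n : ℝ) ^ ((3 : ℝ) / 4) / (Real.log n) ^ 3) : ℝ) : EReal)) atTop := by
  have hB (k) : ∀ p ∈ primeBlock k, p.Prime := fun p hp ↦ (Finset.mem_filter.1 hp).2
  choose H hH hle hS hpq hcard using fun k ↦ exists_quadruple_products (primeBlock k) (hB k)
  refine ⟨{p | p.Prime} ∪ ⋃ k, (H k : Set ℕ), ?_,
    mulSidon_primes_union primeBlock_disjoint hH hS hpq, ?_⟩
  · rintro a (ha | ha)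
    · exact Nat.Prime.pos ha
    · obtain ⟨k, hk⟩ := Set.mem_iUnion.1 ha
      exact Nat.pos_of_ne_zero (hH k a hk).1
  set A : Set ℕ := {p | p.Prime} ∪ ⋃ k, (H k : Set ℕ)
  have hlow {k n : ℕ} (hkn : 4 ^ (4 * k + 4) ≤ n) :
      ((H k).card : ℝ) ≤ (Nat.card ↥(A ∩ Set.Icc 1 n) : ℝ) - Nat.primeCounting n := by
    have hd : Disjoint (Nat.primesLE n) (H k) := by
      refine Finset.disjoint_left.2 fun p h1 h2 ↦ ?_
      have h4 := (hH k p h2).2.1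
      rw [cardFactors_apply_prime (Nat.mem_primesLE.1 h1).2] at h4
      omega
    have hsub : ((Nat.primesLE n ∪ H k : Finset ℕ) : Set ℕ) ⊆ A ∩ Set.Icc 1 n := by
      intro a ha
      rcases Finset.mem_union.1 (Finset.mem_coe.1 ha) with ha | ha
      · obtain ⟨h1, h2⟩ := Nat.mem_primesLE.1 ha
        exact ⟨.inl h2, h2.pos, h1⟩
      · refine ⟨.inr (Set.mem_iUnion.2 ⟨k, ha⟩), Nat.pos_of_ne_zero (hH k a ha).1, ?_⟩
        refine (hle k (4 ^ (k + 1)) (fun p hp ↦ ?_) a ha).trans ?_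
        · exact (Finset.mem_Ioc.1 (Finset.mem_filter.1 hp).1).2
        · rwa [← pow_mul, add_mul, mul_comm k, one_mul]
    have := Set.ncard_le_ncard hsub ((Set.finite_Icc 1 n).inter_of_right A)
    rw [Set.ncard_coe_finset, Finset.card_union_of_disjoint hd,
      Nat.primesLE_card_eq_primeCounting] at this
    rw [le_sub_iff_add_le', Nat.card_coe_set_eq]
    exact_mod_cast this
  refine lt_of_lt_of_le (b := ((1 / 140000 : ℝ) : EReal)) (by
    rw [EReal.coe_lt_coe_iff]; norm_num) (le_liminf_of_le (h := ?_))
  obtain ⟨K, hK⟩ := eventually_atTop.1 eventually_le_primeCounting_four_pow_sub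
  filter_upwards [eventually_ge_atTop (256 ^ (K + 10))] with n hn
  rw [EReal.coe_le_coe_iff]
  have hn0 : n ≠ 0 := (lt_of_lt_of_le (by positivity) hn).ne'
  obtain ⟨k, hk⟩ : ∃ k, Nat.log 256 n = k + 1 :=
    ⟨Nat.log 256 n - 1, by have := Nat.le_log_of_pow_le (by norm_num) hn; omega⟩
  have hkK : K + 9 ≤ k := by have := Nat.le_log_of_pow_le (by norm_num) hn; omega
  have h1 : 4 ^ (4 * k + 4) ≤ n := by
    have := Nat.pow_log_le_self 256 hn0
    rwa [hk, show 256 = 4 ^ 4 by norm_num, ← pow_mul, mul_add, mul_one] at this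
  have h2 : n ≤ 4 ^ (4 * k + 8) := by
    have := (Nat.lt_pow_succ_log_self (b := 256) (by norm_num) n).le
    rwa [hk, show 256 = 4 ^ 4 by norm_num, ← pow_mul,
      show 4 * (k + 1).succ = 4 * k + 8 by omega] at this
  obtain ⟨hpos, hcmp⟩ := rpow_div_log_pow_le (by omega) h1 h2
  rw [le_div_iff₀ hpos]
  have hC := hK k (by omega)
  rw [← card_primeBlock] at hC
  exact hcmp.trans ((pow_le_natCast_div_eight_of_le (by omega) hC).trans
    ((Nat.cast_le.2 (hcard k)).trans (hlow h1)))
end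

section
/- For every real x > 1, the number π(x) of primes not exceeding x satisfies π(x) ≤ 1.26·x/log x. -/
open Real
open scoped Nat ArithmeticFunction.vonMangoldt

/-- `f n`, written so that the kernel evaluates `n` to a numeral before unfolding `f`. -/
def evalArg (n : ℕ) (f : ℕ → Bool) : Bool :=
  match n with
  | 0 => f 0
  | k + 1 => f (k + 1)

theorem evalArg_eq (n : ℕ) (f : ℕ → Bool) : evalArg n f = f n := by
  cases n <;> rfl

/-- The number of `m ∈ (a, a + k]` coprime to `P`. -/
def coprimeCount (P a : ℕ) : ℕ → ℕ
  | 0 => 0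
  | k + 1 => coprimeCount P a k + bif Nat.beq (Nat.gcd (a + k + 1) P) 1 then 1 else 0

/-- The product of the `m ∈ (a, a + k]` coprime to `P`. -/
def coprimeProd (P a : ℕ) : ℕ → ℕ
  | 0 => 1
  | k + 1 => coprimeProd P a k * bif Nat.beq (Nat.gcd (a + k + 1) P) 1 then a + k + 1 else 1

/-- The length of the block following `a` in the numerical verification. -/
def blockLength (a : ℕ) : ℕ := (a - 99) / 20 + 1

/-- Starting from `c = π a` and `P = a#`, verify block by block
`π n * log n ≤ 1.26 * n` and `θ n ≤ 1.11 * n`, and finally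
`π N * log N ≤ θ N + f`, in exponentiated form. -/
def checkBlocks (N f : ℕ) : ℕ → ℕ → ℕ → ℕ → Bool
  | 0, a, c, P => Nat.beq a N && Nat.ble (N ^ c * 1000 ^ f) (P * 2718 ^ f)
  | k + 1, a, c, P =>
      evalArg (a + blockLength a) fun b ↦
      evalArg (c + coprimeCount P a (blockLength a)) fun c' ↦
      evalArg (P * coprimeProd P a (blockLength a)) fun P' ↦
        Nat.ble ((a + 1) ^ c' * 1000 ^ (a + 1)) (3525 ^ (a + 1)) &&
        Nat.ble (P' * 1000 ^ (a + 1)) (3034 ^ (a + 1)) &&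
        checkBlocks N f k b c' P'

theorem checkBlocks_eq_true : checkBlocks 10027 1504 235 2 1 2 = true := by
  decide +kernel

theorem prime_iff_coprime_primorial {a n : ℕ} (han : a < n) (hn : n ≤ 2 * a) :
    n.Prime ↔ Nat.gcd n (primorial a) = 1 := by
  constructor
  · intro hp
    refine (Nat.Prime.coprime_iff_not_dvd hp).2 fun h ↦ ?_
    exact absurd ((hp.dvd_primorial_iff).1 h) (by omega)
  · intro h
    by_contra hp
    have h1 : n ≠ 1 := by omega
    have hf := Nat.minFac_prime h1
    have hle : n.minFac ≤ a := by
      have h2 := Nat.minFac_le_div (by omega : 0 < n) hp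
      have h3 : n / n.minFac ≤ n / 2 := Nat.div_le_div_left hf.two_le (by norm_num)
      omega
    have : n.minFac ∣ Nat.gcd n (primorial a) :=
      Nat.dvd_gcd (Nat.minFac_dvd n) (hf.dvd_primorial_iff.2 hle)
    rw [h] at this
    exact hf.one_lt.ne' (Nat.dvd_one.1 this)

theorem primeCounting_succ (n : ℕ) :
    Nat.primeCounting (n + 1) = Nat.primeCounting n + if (n + 1).Prime then 1 else 0 := by
  simp only [Nat.primeCounting, Nat.primeCounting', Nat.count_succ]

theorem primorial_succ_eq (n : ℕ) :
    primorial (n + 1) = primorial n * if (n + 1).Prime then n + 1 else 1 := by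
  rw [primorial, Finset.range_add_one, Finset.filter_insert, primorial]
  split_ifs with h
  · rw [Finset.prod_insert (by simp), mul_comm]
  · rw [mul_one]

theorem primeCounting_add_eq {a k : ℕ} (hk : k ≤ a) :
    Nat.primeCounting (a + k) = Nat.primeCounting a + coprimeCount (primorial a) a k := by
  induction k with
  | zero => rfl
  | succ k ih =>
    rw [← add_assoc, primeCounting_succ, ih (by omega), coprimeCount, add_assoc]
    congr 2
    have h := prime_iff_coprime_primorial (a := a) (n := a + k + 1) (by omega) (by omega)
    rw [← Nat.beq_eq] at h
    cases hb : Nat.beq (Nat.gcd (a + k + 1) (primorial a)) 1 <;> simp [h, hb]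

theorem primorial_add_eq {a k : ℕ} (hk : k ≤ a) :
    primorial (a + k) = primorial a * coprimeProd (primorial a) a k := by
  induction k with
  | zero => simp [coprimeProd]
  | succ k ih =>
    rw [← add_assoc, primorial_succ_eq, ih (by omega), coprimeProd, mul_assoc]
    congr 2
    have h := prime_iff_coprime_primorial (a := a) (n := a + k + 1) (by omega) (by omega)
    rw [← Nat.beq_eq] at h
    cases hb : Nat.beq (Nat.gcd (a + k + 1) (primorial a)) 1 <;> simp [h, hb]

theorem of_checkBlocks (N f k a : ℕ) (ha : 2 ≤ a)
    (h : checkBlocks N f k a (Nat.primeCounting a) (primorial a) = true) :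
    (∀ n, a < n → n ≤ N → ∃ m c, 3 ≤ m ∧ m ≤ n ∧ Nat.primeCounting n ≤ c ∧
      m ^ c * 1000 ^ m ≤ 3525 ^ m ∧ primorial n * 1000 ^ m ≤ 3034 ^ m) ∧
    N ^ Nat.primeCounting N * 1000 ^ f ≤ primorial N * 2718 ^ f := by
  induction k generalizing a with
  | zero =>
    simp only [checkBlocks, Bool.and_eq_true, Nat.beq_eq, Nat.ble_eq] at h
    obtain ⟨rfl, h1⟩ := h
    exact ⟨fun n h3 h4 ↦ absurd h4 h3.not_ge, h1⟩
  | succ k ih =>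
    have hb : blockLength a ≤ a := by unfold blockLength; omega
    simp only [checkBlocks, evalArg_eq, Bool.and_eq_true, Nat.ble_eq, ← primeCounting_add_eq hb,
      ← primorial_add_eq hb] at h
    obtain ⟨⟨h1, h2⟩, h3⟩ := h
    obtain ⟨h4, h5⟩ := ih _ (by omega) h3
    refine ⟨fun n hn hn' ↦ ?_, h5⟩
    by_cases hc : n ≤ a + blockLength a
    · exact ⟨a + 1, _, by omega, by omega, Nat.monotone_primeCounting hc, h1,
        (Nat.mul_le_mul_right _ (primorial_mono hc)).trans h2⟩
    · exact h4 n (by omega) hn'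

theorem primeCounting_primorial_bounds : ∃ N f : ℕ, 10000 ≤ N ∧ 20 * f ≤ 3 * N ∧
    (∀ n, 2 < n → n ≤ N → ∃ m c, 3 ≤ m ∧ m ≤ n ∧ Nat.primeCounting n ≤ c ∧
      m ^ c * 1000 ^ m ≤ 3525 ^ m ∧ primorial n * 1000 ^ m ≤ 3034 ^ m) ∧
    N ^ Nat.primeCounting N * 1000 ^ f ≤ primorial N * 2718 ^ f := by
  suffices h : checkBlocks 10027 1504 235 2 (Nat.primeCounting 2) (primorial 2) = true from
    ⟨10027, 1504, by norm_num, by norm_num, of_checkBlocks 10027 1504 235 2 le_rfl h⟩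
  have h : Nat.primeCounting 2 = 1 := by decide
  rw [h, primorial_two]
  exact checkBlocks_eq_true

theorem log_le_of_pow_le {m P q : ℕ} {s : ℝ} (hP : 0 < P) (hq : (q : ℝ) / 1000 ≤ exp s)
    (h : P * 1000 ^ m ≤ q ^ m) : log P ≤ s * m := by
  have h' : (P : ℝ) * 1000 ^ m ≤ (q : ℝ) ^ m := by exact_mod_cast h
  rw [log_le_iff_le_exp (by positivity), mul_comm, exp_nat_mul]
  calc (P : ℝ) ≤ ((q : ℝ) / 1000) ^ m := by
        rw [div_pow, le_div_iff₀ (by positivity)]; exact h'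
    _ ≤ exp s ^ m := by gcongr

theorem pow_le_of_exp_one {q : ℝ} (k : ℕ) (h : q ^ 100 ≤ 2.7182818283 ^ k) :
    q ≤ exp (k / 100) := by
  refine le_of_pow_le_pow_left₀ (n := 100) (by norm_num) (exp_pos _).le (h.trans ?_)
  rw [← exp_nat_mul]
  calc (2.7182818283 : ℝ) ^ k ≤ exp 1 ^ k := by gcongr; exact exp_one_gt_d9.le
    _ = exp ((100 : ℕ) * (k / 100)) := by rw [← exp_nat_mul]; congr 1; push_cast; ring

theorem theta_le_of_le {n : ℕ} (h2 : 2 < n) (hn : n ≤ 10000) :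
    Chebyshev.theta n ≤ 1.11 * n := by
  obtain ⟨N, f, hN, -, hb, -⟩ := primeCounting_primorial_bounds
  obtain ⟨m, c, -, hm, -, -, h⟩ := hb n h2 (hn.trans hN)
  rw [Chebyshev.theta_eq_log_primorial, Nat.floor_natCast]
  have h1 : ((3034 : ℕ) : ℝ) / 1000 ≤ exp 1.11 := by
    convert pow_le_of_exp_one (q := 3034 / 1000) 111 (by norm_num) using 2 <;> norm_num
  refine (log_le_of_pow_le (primorial_pos n) h1 h).trans ?_
  gcongr

theorem primeCounting_mul_log_le_of_pow_le {n m c : ℕ} (h3 : 3 ≤ m) (hm : m ≤ n)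
    (hc : Nat.primeCounting n ≤ c) (h : m ^ c * 1000 ^ m ≤ 3525 ^ m) {x : ℝ} (hx : n ≤ x) :
    Nat.primeCounting n * log x ≤ 1.26 * x := by
  have h1 : ((3525 : ℕ) : ℝ) / 1000 ≤ exp 1.26 := by
    convert pow_le_of_exp_one (q := 3525 / 1000) 126 (by norm_num) using 2 <;> norm_num
  have hl := log_le_of_pow_le (by positivity) h1 h
  push_cast at hl
  rw [log_pow] at hl
  have h3' : (3 : ℝ) ≤ m := by exact_mod_cast h3
  have hmx : (m : ℝ) ≤ x := le_trans (by exact_mod_cast hm) hx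
  have he : exp 1 ≤ m := by linarith [exp_one_lt_d9]
  have hx0 : 0 < x := by linarith
  have ha : log x / x ≤ log m / m := log_div_self_antitoneOn he (he.trans hmx) hmx
  rw [← div_le_iff₀ hx0, mul_div_assoc]
  calc (Nat.primeCounting n : ℝ) * (log x / x) ≤ c * (log m / m) := by
        gcongr
        exact div_nonneg (log_nonneg (by linarith)) hx0.le
    _ ≤ 1.26 := by rwa [← mul_div_assoc, div_le_iff₀ (by linarith)]

theorem factorial_quotient_step (m : ℕ) :
    (m + 1) * ∏ j ∈ Finset.range 30, (30 * m + j + 1) ≤ 2 ^ 14 * 3 ^ 9 * 5 ^ 5 *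
      ((∏ j ∈ Finset.range 15, (15 * m + j + 1)) * (∏ j ∈ Finset.range 10, (10 * m + j + 1)) *
        ∏ j ∈ Finset.range 6, (6 * m + j + 1)) := by
  have h : (30 * m + 1) * (30 * m + 7) * (30 * m + 11) * (30 * m + 13) * (30 * m + 17) *
      (30 * m + 19) * (30 * m + 23) * (30 * m + 29) ≤
      (30 * m + 6) * (30 * m + 10) * (30 * m + 12) * (30 * m + 15) * (30 * m + 18) *
      (30 * m + 20) * (30 * m + 24) * (30 * m + 30) := by
    gcongr <;> norm_num
  have h' := Nat.mul_le_mul_right ((m + 1) * ((30 * m + 2) * (30 * m + 3) * (30 * m + 4) *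
    (30 * m + 5) * (30 * m + 6) * (30 * m + 8) * (30 * m + 9) * (30 * m + 10) * (30 * m + 12) *
    (30 * m + 14) * (30 * m + 15) * (30 * m + 16) * (30 * m + 18) * (30 * m + 20) *
    (30 * m + 21) * (30 * m + 22) * (30 * m + 24) * (30 * m + 25) * (30 * m + 26) *
    (30 * m + 27) * (30 * m + 28) * (30 * m + 30))) h
  simp only [Finset.prod_range_succ, Finset.prod_range_zero, one_mul]
  calc _ = _ := by ring
    _ ≤ _ := h'
    _ = _ := by ring

theorem factorial_add_eq (n k : ℕ) :
    (n + k)! = n ! * ∏ j ∈ Finset.range k, (n + j + 1) := by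
  induction k with
  | zero => simp
  | succ k ih => rw [← add_assoc, Nat.factorial_succ, ih, Finset.prod_range_succ]; ring

theorem factorial_quotient_le (m : ℕ) :
    (30 * m)! * m ! ≤ (2 ^ 14 * 3 ^ 9 * 5 ^ 5) ^ m * ((15 * m)! * (10 * m)! * (6 * m)!) := by
  induction m with
  | zero => simp
  | succ m ih =>
    simp only [mul_add, mul_one]
    rw [factorial_add_eq (30 * m), factorial_add_eq (15 * m), factorial_add_eq (10 * m),
      factorial_add_eq (6 * m), Nat.factorial_succ]
    have h := Nat.mul_le_mul ih (factorial_quotient_step m)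
    generalize ∏ j ∈ Finset.range 30, (30 * m + j + 1) = A at *
    generalize ∏ j ∈ Finset.range 15, (15 * m + j + 1) = B at *
    generalize ∏ j ∈ Finset.range 10, (10 * m + j + 1) = C at *
    generalize ∏ j ∈ Finset.range 6, (6 * m + j + 1) = D at *
    generalize 2 ^ 14 * 3 ^ 9 * 5 ^ 5 = K at *
    rw [pow_succ]
    calc _ = (30 * m)! * m ! * ((m + 1) * A) := by ring
      _ ≤ _ := h
      _ = _ := by ring

theorem log_factorial_eq_sum_vonMangoldt {n N : ℕ} (h : n ≤ N) :
    log (n ! : ℝ) = ∑ d ∈ Finset.Ioc 0 N, Λ d * (n / d : ℕ) := by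
  induction n with
  | zero => simp
  | succ n ih =>
    rw [Nat.factorial_succ, Nat.cast_mul, log_mul (by positivity) (by positivity),
      ih (by omega), ← ArithmeticFunction.vonMangoldt_sum]
    simp_rw [Nat.succ_div]
    push_cast
    simp_rw [mul_add, Finset.sum_add_distrib]
    rw [add_comm]
    congr 1
    simp_rw [mul_ite, mul_one, mul_zero]
    rw [← Finset.sum_filter]
    refine Finset.sum_congr ?_ fun _ _ ↦ rfl
    ext d
    simp only [Nat.mem_divisors, Finset.mem_filter, Finset.mem_Ioc]
    constructor
    · rintro ⟨hd, -⟩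
      exact ⟨⟨Nat.pos_of_dvd_of_pos hd (by omega), (Nat.le_of_dvd (by omega) hd).trans h⟩, hd⟩
    · rintro ⟨-, hd⟩
      exact ⟨hd, by omega⟩

theorem floor_quotients_le (m d : ℕ) :
    15 * m / d + 10 * m / d + 6 * m / d + (if 5 * m < d ∧ d ≤ 30 * m then 1 else 0) ≤
      30 * m / d + m / d := by
  rcases Nat.eq_zero_or_pos d with rfl | hd
  · simp
  have e (k l : ℕ) (hl : 0 < l) : k * m / d = l * k * m / d / l := by
    rw [Nat.div_div_eq_div_mul, mul_assoc, mul_comm d, Nat.mul_div_mul_left _ _ hl]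
  have e1 := e 15 2 (by norm_num)
  have e2 := e 10 3 (by norm_num)
  have e3 := e 6 5 (by norm_num)
  have e4 := e 1 30 (by norm_num)
  norm_num at e1 e2 e3 e4
  rw [e1, e2, e3, e4]
  split_ifs with h
  · have h1 : 1 ≤ 30 * m / d := (Nat.one_le_div_iff hd).2 h.2
    have h2 : 30 * m / d < 6 := (Nat.div_lt_iff_lt_mul hd).2 (by omega)
    omega
  · omega

theorem theta_sub_theta_le (m : ℕ) :
    Chebyshev.theta (30 * m : ℕ) - Chebyshev.theta (5 * m : ℕ) ≤
      m * log (2 ^ 14 * 3 ^ 9 * 5 ^ 5) := by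
  have hfac : log ((30 * m)! : ℝ) + log (m ! : ℝ) ≤ m * log (2 ^ 14 * 3 ^ 9 * 5 ^ 5) +
      (log ((15 * m)! : ℝ) + log ((10 * m)! : ℝ) + log ((6 * m)! : ℝ)) := by
    rw [← log_pow, ← log_mul, ← log_mul, ← log_mul, ← log_mul]
    · refine log_le_log (by positivity) ?_
      exact_mod_cast factorial_quotient_le m
    all_goals positivity
  have hsum : ∑ d ∈ Finset.Ioc 0 (30 * m), (if 5 * m < d ∧ d ≤ 30 * m then Λ d else 0) +
      (log ((15 * m)! : ℝ) + log ((10 * m)! : ℝ) + log ((6 * m)! : ℝ)) ≤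
      log ((30 * m)! : ℝ) + log (m ! : ℝ) := by
    rw [log_factorial_eq_sum_vonMangoldt (show 15 * m ≤ 30 * m by omega),
      log_factorial_eq_sum_vonMangoldt (show 10 * m ≤ 30 * m by omega),
      log_factorial_eq_sum_vonMangoldt (show 6 * m ≤ 30 * m by omega),
      log_factorial_eq_sum_vonMangoldt (show m ≤ 30 * m by omega),
      log_factorial_eq_sum_vonMangoldt (le_refl (30 * m))]
    simp only [← Finset.sum_add_distrib]
    refine Finset.sum_le_sum fun d _ ↦ ?_
    have h := floor_quotients_le m d
    have h' : ((15 * m / d : ℕ) : ℝ) + (10 * m / d : ℕ) + (6 * m / d : ℕ) +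
      (if 5 * m < d ∧ d ≤ 30 * m then 1 else 0) ≤ (30 * m / d : ℕ) + (m / d : ℕ) := by
      exact_mod_cast h
    have h2 := mul_le_mul_of_nonneg_left h' (ArithmeticFunction.vonMangoldt_nonneg (n := d))
    simp only [mul_add, mul_ite, mul_one, mul_zero] at h2
    linarith
  have htheta : Chebyshev.theta (30 * m : ℕ) - Chebyshev.theta (5 * m : ℕ) ≤
      ∑ d ∈ Finset.Ioc 0 (30 * m), (if 5 * m < d ∧ d ≤ 30 * m then Λ d else 0) := by
    have hs : Finset.Ioc 0 (5 * m) ⊆ Finset.Ioc 0 (30 * m) :=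
      Finset.Ioc_subset_Ioc_right (by omega)
    simp only [Chebyshev.theta, Nat.floor_natCast, Finset.sum_filter]
    rw [← Finset.sum_sdiff hs, add_sub_cancel_right, ← Finset.sum_sdiff hs]
    refine le_add_of_le_of_nonneg (Finset.sum_le_sum fun d hd ↦ ?_)
      (Finset.sum_nonneg fun d _ ↦ by
        split_ifs; exacts [ArithmeticFunction.vonMangoldt_nonneg, le_rfl])
    simp only [Finset.mem_sdiff, Finset.mem_Ioc] at hd
    rw [if_pos (show 5 * m < d ∧ d ≤ 30 * m by omega)]
    split_ifs with hp
    · exact (ArithmeticFunction.vonMangoldt_apply_prime hp).ge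
    · exact ArithmeticFunction.vonMangoldt_nonneg
  linarith

theorem theta_le_of_gt {n : ℕ} (h2 : 2 < n) : Chebyshev.theta n ≤ 1.11 * n := by
  induction n using Nat.strong_induction_on with
  | _ n ih =>
    rcases le_or_gt n 10000 with hn | hn
    · exact theta_le_of_le h2 hn
    obtain ⟨m, hm⟩ : ∃ m, m = (n + 29) / 30 := ⟨_, rfl⟩
    have h1 := ih (5 * m) (by omega) (by omega)
    have h3 := theta_sub_theta_le m
    have h4 : Chebyshev.theta n ≤ Chebyshev.theta (30 * m : ℕ) :=
      Chebyshev.theta_mono (by exact_mod_cast (by omega : n ≤ 30 * m))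
    have hlog : log (2 ^ 14 * 3 ^ 9 * 5 ^ 5) ≤ 27.64 := by
      rw [log_mul (by positivity) (by positivity), log_mul (by positivity) (by positivity),
        log_pow, log_pow, log_pow]
      push_cast
      linarith [log_two_lt_d9, log_three_lt_d9, log_five_lt_d9]
    have h5 := h3.trans (mul_le_mul_of_nonneg_left hlog m.cast_nonneg)
    have h6 : (30 * m : ℝ) ≤ n + 29 := by exact_mod_cast (by omega : 30 * m ≤ n + 29)
    have h7 : (10000 : ℝ) ≤ n := by exact_mod_cast hn.le
    push_cast at h1 h4 h5
    linarith

theorem theta_le {t : ℝ} (ht : 3 ≤ t) : Chebyshev.theta t ≤ 1.11 * t := by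
  rw [Chebyshev.theta_eq_theta_coe_floor]
  have h : 3 ≤ ⌊t⌋₊ := Nat.le_floor (by exact_mod_cast ht)
  refine (theta_le_of_gt h).trans ?_
  gcongr
  exact Nat.floor_le (by linarith)

theorem nine_le_log {t : ℝ} (ht : 10000 ≤ t) : 9 ≤ log t := by
  rw [le_log_iff_exp_le (by linarith)]
  refine le_trans ?_ ht
  calc exp 9 = exp 1 ^ 9 := by rw [← exp_nat_mul]; norm_num
    _ ≤ 2.7182818286 ^ 9 := by gcongr; exact exp_one_lt_d9.le
    _ ≤ 10000 := by norm_num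

theorem hasDerivAt_div_log {t : ℝ} (ht : 1 < t) :
    HasDerivAt (fun t ↦ 0.15 * (t / log t)) (0.15 * (1 / log t - 1 / log t ^ 2)) t := by
  have hl := log_pos ht
  have h := ((hasDerivAt_id t).div (hasDerivAt_log (by positivity)) hl.ne').const_mul 0.15
  refine h.congr_deriv ?_
  simp only [id]
  field_simp

theorem primeCounting_mul_log_le_of_ge {N f : ℕ} (hN : 10000 ≤ N) (hf : 20 * f ≤ 3 * N)
    (h : N ^ Nat.primeCounting N * 1000 ^ f ≤ primorial N * 2718 ^ f) {x : ℝ} (hx : N ≤ x) :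
    Nat.primeCounting ⌊x⌋₊ * log x ≤ 1.26 * x := by
  have hN' : (10000 : ℝ) ≤ N := by exact_mod_cast hN
  have hL := nine_le_log hN'
  have hint : IntervalIntegrable (fun t ↦ Chebyshev.theta t / (t * log t ^ 2))
      MeasureTheory.volume 2 x :=
    (intervalIntegrable_iff_integrableOn_Icc_of_le (by linarith)).2
      (Chebyshev.integrableOn_theta_div_id_mul_log_sq x)
  have h1 := Chebyshev.primeCounting_eq_theta_div_log_add_integral (x := x) (by linarith)
  have h2 := Chebyshev.primeCounting_eq_theta_div_log_add_integral (x := N) (by linarith)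
  rw [Nat.floor_natCast] at h2
  have hsplit := intervalIntegral.integral_interval_sub_left hint (hint.mono_set (c := 2)
    (d := N) (by
      rw [Set.uIcc_of_le (by linarith), Set.uIcc_of_le (by linarith)]
      exact Set.Icc_subset_Icc_right hx))
  have hbound : ∫ t in (N : ℝ)..x, Chebyshev.theta t / (t * log t ^ 2) ≤
      0.15 * (x / log x) - 0.15 * (N / log N) :=
    intervalIntegral.integral_le_sub_of_hasDeriv_right_of_le
    (g := fun t ↦ 0.15 * (t / log t)) (g' := fun t ↦ 0.15 * (1 / log t - 1 / log t ^ 2)) hx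
    (fun t ht ↦ (hasDerivAt_div_log (by linarith [ht.1])).continuousAt.continuousWithinAt)
    (fun t ht ↦ (hasDerivAt_div_log (by linarith [ht.1])).hasDerivWithinAt)
    ((Chebyshev.integrableOn_theta_div_id_mul_log_sq x).mono_set
      (Set.Icc_subset_Icc_left (by linarith)))
    (fun t ht ↦ by
      have htN : N < t := ht.1
      have ht0 : 0 < t := by linarith
      have hlt : 9 ≤ log t := nine_le_log (by linarith)
      have hth := theta_le (t := t) (by linarith)
      calc Chebyshev.theta t / (t * log t ^ 2) ≤ 1.11 * t / (t * log t ^ 2) := by gcongr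
        _ = 1.11 / log t ^ 2 := by field_simp
        _ ≤ 0.15 * (log t - 1) / log t ^ 2 := by gcongr; linarith
        _ = _ := by field_simp)
  have hend : Nat.primeCounting N * log N ≤ Chebyshev.theta N + 0.15 * N := by
    have hf' : 20 * (f : ℝ) ≤ 3 * N := by exact_mod_cast hf
    have h' : (N : ℝ) ^ Nat.primeCounting N * 1000 ^ f ≤
        primorial N * 2718 ^ f := by
      exact_mod_cast h
    have hN0 : (0 : ℝ) < N := by linarith
    have hp : (0 : ℝ) < primorial N := by exact_mod_cast primorial_pos _
    have h3 := log_le_log (by positivity) h'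
    rw [log_mul (by positivity) (by positivity), log_mul (by positivity) (by positivity),
      log_pow, log_pow, log_pow] at h3
    have h4 : log 2718 ≤ 1 + log 1000 := by
      rw [← log_exp 1, ← log_mul (by positivity) (by norm_num)]
      exact log_le_log (by norm_num) (by linarith [exp_one_gt_d9])
    have h5 : Chebyshev.theta N = log (primorial N) := by
      have := Chebyshev.theta_eq_log_primorial N
      rwa [Nat.floor_natCast] at this
    have h6 : (f : ℝ) * log 2718 ≤ f * (1 + log 1000) := by gcongr
    rw [h5]
    linarith
  have hend' : (Nat.primeCounting N : ℝ) ≤ Chebyshev.theta N / log N + 0.15 * (N / log N) := by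
    rw [← mul_div_assoc, ← add_div, le_div_iff₀ (by linarith)]
    exact hend
  have hlx : 0 < log x := log_pos (by linarith)
  have htx : Chebyshev.theta x / log x ≤ 1.11 * x / log x := by
    gcongr
    exact theta_le (by linarith)
  rw [← le_div_iff₀ hlx]
  have hfin : 1.26 * x / log x = 1.11 * x / log x + 0.15 * (x / log x) := by ring
  linarith

theorem primeCounting_floor_mul_log_le {x : ℝ} (hx : 1 < x) :
    Nat.primeCounting ⌊x⌋₊ * log x ≤ 1.26 * x := by
  obtain ⟨N, f, hN, hf, hb, hend⟩ := primeCounting_primorial_bounds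
  rcases le_or_gt (N : ℝ) x with h | h
  · exact primeCounting_mul_log_le_of_ge hN hf hend h
  rcases le_or_gt 3 x with h3 | h3
  · obtain ⟨m, c, h3m, hm, hc, hpow, -⟩ :=
      hb ⌊x⌋₊ (Nat.le_floor (by exact_mod_cast h3)) (Nat.floor_le_of_le h.le)
    exact primeCounting_mul_log_le_of_pow_le h3m hm hc hpow (Nat.floor_le (by linarith))
  have hf : ⌊x⌋₊ ≤ 2 :=
    Nat.lt_succ_iff.1 ((Nat.floor_lt (by linarith)).2 (by exact_mod_cast h3))
  have hc : Nat.primeCounting ⌊x⌋₊ ≤ 1 := Nat.monotone_primeCounting hf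
  have hc' : (Nat.primeCounting ⌊x⌋₊ : ℝ) ≤ 1 := by exact_mod_cast hc
  have hl := log_pos hx
  have := log_le_sub_one_of_pos (by linarith : 0 < x)
  nlinarith

theorem card_primes_le_eq_primeCounting {x : ℝ} (hx : 0 ≤ x) :
    Nat.card {p : ℕ | p.Prime ∧ (p : ℝ) ≤ x} = Nat.primeCounting ⌊x⌋₊ := by
  have h : {p : ℕ | p.Prime ∧ (p : ℝ) ≤ x} = ↑(Nat.primesLE ⌊x⌋₊) := by
    ext p
    simp [Nat.mem_primesLE, Nat.le_floor_iff hx, and_comm]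
  rw [h, ← Nat.primesLE_card_eq_primeCounting]
  simp

theorem stmt_6 (x : ℝ) (hx : 1 < x) :
    (Nat.card {p : ℕ | p.Prime ∧ (p : ℝ) ≤ x} : ℝ) ≤ 1.26 * x / Real.log x := by
  rw [card_primes_le_eq_primeCounting (by linarith), le_div_iff₀ (log_pos hx)]
  exact primeCounting_floor_mul_log_le hx
end
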